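/- Let N,k ≥ 1 be integers, 0 < γ < 1, and p1, p2 > 1. Let u0 ∈ L¹(ℝ^{N+k}) satisfy ∫_{ℝ^{N+k}} u0(z) dz > 0. If p1 ≤ 1 + 2(2−γ)/(N+2k−2+2γ), or p2 ≤ 1 + 2/(N+2k), or p1 < 1/γ, then there is no global nonnegative weak solution of u_t − Δ_G u = ∫_0^t (t−s)^{−γ} |u(s)|^{p1−1}u(s) ds + |u(t)|^{p2−1}u(t) on ℝ^{N+k} × (0,∞) with initial datum u(·,0) = u0. -/

import Mathlib

open MeasureTheory Real Filter
open scoped ENNReal NNReal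

noncomputable section

abbrev Euc (n : ℕ) : Type := EuclideanSpace ℝ (Fin n)

/-- Second derivative of `f` at `z`, taken twice in the direction `v`. -/
def secondDeriv {N k : ℕ} (f : Euc N × Euc k → ℝ) (z v : Euc N × Euc k) : ℝ :=
  fderiv ℝ (fun w => fderiv ℝ f w v) z v

/-- The Laplacian in the `x`-variables. -/
def laplacianX {N k : ℕ} (f : Euc N × Euc k → ℝ) (z : Euc N × Euc k) : ℝ :=
  ∑ i : Fin N, secondDeriv f z (EuclideanSpace.single i 1, 0)

/-- The Laplacian in the `y`-variables. -/
def laplacianY {N k : ℕ} (f : Euc N × Euc k → ℝ) (z : Euc N × Euc k) : ℝ :=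
  ∑ j : Fin k, secondDeriv f z (0, EuclideanSpace.single j 1)

/-- The Grushin operator `Δ_G = Δ_x + |x|² Δ_y`. -/
def grushin {N k : ℕ} (f : Euc N × Euc k → ℝ) (z : Euc N × Euc k) : ℝ :=
  laplacianX f z + ‖z.1‖ ^ 2 * laplacianY f z

/-- The power nonlinearity `|v|^(p-1) · v`. -/
def absPow (p v : ℝ) : ℝ := |v| ^ (p - 1) * v

/-- The Riemann–Liouville fractional integral `I^α_{0|t} f`. -/
def fracInt (α : ℝ) (f : ℝ → ℝ) (t : ℝ) : ℝ :=
  (1 / Real.Gamma α) * ∫ s in Set.Ioc (0 : ℝ) t, (t - s) ^ (α - 1) * f s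


/-- Weak solution on `ℝ^{N+k} × [0,T]` of
`u_t − Δ_G u = k1 ∫_0^t (t−s)^{−γ}|u(s)|^{p1−1}u(s) ds + k2 |u|^{p2−1}u`, `u(·,0) = u0`
(with `α = 1 − γ`). -/
def IsWeakSolutionGen (N k : ℕ) (k1 k2 γ p1 p2 T : ℝ) (u0 : Euc N × Euc k → ℝ)
    (u : Euc N × Euc k → ℝ → ℝ) : Prop :=
  LocallyIntegrableOn
      (fun q : (Euc N × Euc k) × ℝ => fracInt (1 - γ) (fun s => absPow p1 (u q.1 s)) q.2)
      (Set.univ ×ˢ Set.Ioo 0 T) volume ∧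
  LocallyIntegrableOn (fun q : (Euc N × Euc k) × ℝ => absPow p2 (u q.1 q.2))
      (Set.univ ×ˢ Set.Ioo 0 T) volume ∧
  ∀ φ : Euc N × Euc k → ℝ → ℝ,
    ContDiff ℝ 2 (fun q : (Euc N × Euc k) × ℝ => φ q.1 q.2) →
    HasCompactSupport (fun q : (Euc N × Euc k) × ℝ => φ q.1 q.2) →
    (∀ z, φ z T = 0) →
    ((∫ z, u z T * φ z T) - ∫ z, u0 z * φ z 0) =
      k1 * Real.Gamma (1 - γ) *
        (∫ t in Set.Ioc (0 : ℝ) T, ∫ z,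
          fracInt (1 - γ) (fun s => absPow p1 (u z s)) t * φ z t) +
      k2 * (∫ t in Set.Ioc (0 : ℝ) T, ∫ z, absPow p2 (u z t) * φ z t) +
      (∫ t in Set.Ioc (0 : ℝ) T, ∫ z, u z t * grushin (fun w => φ w t) z) +
      (∫ t in Set.Ioc (0 : ℝ) T, ∫ z, u z t * deriv (φ z) t)


def pp (n : ℕ) (x : ℝ) : ℝ := max x 0 ^ n

lemma pp_nonneg (n : ℕ) (x : ℝ) : 0 ≤ pp n x := pow_nonneg (le_max_right _ _) _

lemma hasDerivAt_pp (n : ℕ) (x : ℝ) :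
    HasDerivAt (pp (n + 2)) (((n : ℝ) + 2) * pp (n + 1) x) x := by
  rcases lt_trichotomy x 0 with hx | hx | hx
  · have h1 : pp (n + 2) =ᶠ[nhds x] fun _ => 0 := by
      filter_upwards [gt_mem_nhds hx] with y hy
      simp [pp, max_eq_right hy.le]
    have h2 : pp (n + 1) x = 0 := by simp [pp, max_eq_right hx.le]
    rw [h2, mul_zero]
    exact (hasDerivAt_const x (0 : ℝ)).congr_of_eventuallyEq h1
  · subst hx
    have h2 : pp (n + 1) 0 = 0 := by simp [pp]
    rw [h2, mul_zero]
    rw [hasDerivAt_iff_isLittleO]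
    have h3 : pp (n + 2) 0 = 0 := by simp [pp]
    simp only [h3, sub_zero, smul_zero]
    have : (fun x : ℝ => pp (n + 2) x) =O[nhds 0] fun x => x ^ (n + 2) := by
      refine Asymptotics.IsBigO.of_bound 1 (Eventually.of_forall fun x => ?_)
      rw [one_mul, pp, norm_pow, norm_pow]
      gcongr
      rw [Real.norm_eq_abs, Real.norm_eq_abs, abs_of_nonneg (le_max_right _ _)]
      exact max_le (le_abs_self _) (abs_nonneg _)
    refine this.trans_isLittleO ?_
    have := Asymptotics.isLittleO_pow_id (𝕜 := ℝ) (n := n + 2) (by omega)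
    exact this
  · have h1 : pp (n + 2) =ᶠ[nhds x] fun y => y ^ (n + 2) := by
      filter_upwards [lt_mem_nhds hx] with y hy
      simp [pp, max_eq_left hy.le]
    have h2 : pp (n + 1) x = x ^ (n + 1) := by simp [pp, max_eq_left hx.le]
    rw [h2]
    have := (hasDerivAt_pow (n + 2) x).congr_of_eventuallyEq h1
    refine this.congr_deriv ?_
    push_cast
    congr 1

lemma continuous_pp (n : ℕ) : Continuous (pp n) := by
  unfold pp; fun_prop

lemma contDiff_pp (n : ℕ) : ContDiff ℝ 2 (pp (n + 3)) := by
  have h1 : ∀ n, ContDiff ℝ 1 (pp (n + 2)) := by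
    intro n
    rw [contDiff_one_iff_deriv]
    refine ⟨fun x => (hasDerivAt_pp n x).differentiableAt, ?_⟩
    have : deriv (pp (n + 2)) = fun x => ((n : ℝ) + 2) * pp (n + 1) x :=
      funext fun x => (hasDerivAt_pp n x).deriv
    rw [this]
    exact continuous_const.mul (continuous_pp _)
  have : (2 : WithTop ℕ∞) = 1 + 1 := by norm_num
  rw [this, contDiff_succ_iff_deriv]
  refine ⟨fun x => (hasDerivAt_pp (n + 1) x).differentiableAt, by simp, ?_⟩
  have : deriv (pp (n + 3)) = fun x => (((n + 1 : ℕ) : ℝ) + 2) * pp (n + 2) x :=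
    funext fun x => (hasDerivAt_pp (n + 1) x).deriv
  rw [this]
  exact contDiff_const.mul (h1 n)

/-- base cutoff profile -/
def kk (s : ℝ) : ℝ := max (1 - pp 3 (2 * s - 1)) 0

/-- C² cutoff -/
def hh (m : ℕ) (s : ℝ) : ℝ := kk s ^ (m + 3)

lemma hh_eq (m : ℕ) (s : ℝ) : hh m s = pp (m + 3) (1 - pp 3 (2 * s - 1)) := rfl

lemma kk_nonneg (s : ℝ) : 0 ≤ kk s := le_max_right _ _
lemma kk_le_one (s : ℝ) : kk s ≤ 1 :=
  max_le (by linarith [pp_nonneg 3 (2 * s - 1)]) zero_le_one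
lemma kk_eq_one {s : ℝ} (hs : s ≤ 1 / 2) : kk s = 1 := by
  have : max (2 * s - 1) 0 = 0 := max_eq_right (by linarith)
  simp [kk, pp, this]
lemma kk_eq_zero {s : ℝ} (hs : 1 ≤ s) : kk s = 0 := by
  have h : max (2 * s - 1) 0 = 2 * s - 1 := max_eq_left (by linarith)
  have h2 : (1 : ℝ) ≤ (2 * s - 1) ^ 3 := one_le_pow₀ (by linarith)
  unfold kk pp
  rw [h]
  exact max_eq_right (by linarith)
lemma continuous_kk : Continuous kk := by
  unfold kk; exact ((continuous_const.sub ((continuous_pp 3).comp (by fun_prop))).max continuous_const)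

lemma kk_le (s : ℝ) (hs : s ≤ 1) : kk s ≤ 6 * (1 - s) := by
  rcases le_total s (1 / 2) with h | h
  · rw [kk_eq_one h]; linarith
  · have h1 : max (2 * s - 1) 0 = 2 * s - 1 := max_eq_left (by linarith)
    unfold kk pp
    rw [h1]
    refine max_le ?_ (by linarith)
    nlinarith [sq_nonneg (2 * s - 1), sq_nonneg (s - 1), mul_nonneg (sub_nonneg.2 hs) (sub_nonneg.2 h)]

/-- the profile does not decay too quickly -/
lemma kk_lower {s t : ℝ} (hs0 : 0 ≤ s) (hs : s ≤ 1) (ht : t ≤ (1 + s) / 2) : kk s / 6 ≤ kk t := by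
  have h1 := kk_le s hs
  have h2 : 1 - s ≤ kk t := by
    refine le_trans ?_ (le_max_left _ _)
    have : pp 3 (2 * t - 1) ≤ s ^ 3 := by
      unfold pp
      gcongr
      exact max_le (by linarith) hs0
    nlinarith [pow_le_of_le_one hs0 hs (three_ne_zero)]
  linarith

lemma hh_nonneg (m : ℕ) (s : ℝ) : 0 ≤ hh m s := pow_nonneg (kk_nonneg s) _
lemma hh_le_one (m : ℕ) (s : ℝ) : hh m s ≤ 1 := pow_le_one₀ (kk_nonneg s) (kk_le_one s)
lemma hh_eq_one (m : ℕ) {s : ℝ} (hs : s ≤ 1 / 2) : hh m s = 1 := by simp [hh, kk_eq_one hs]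
lemma hh_eq_zero (m : ℕ) {s : ℝ} (hs : 1 ≤ s) : hh m s = 0 := by simp [hh, kk_eq_zero hs]
lemma contDiff_hh (m : ℕ) : ContDiff ℝ 2 (hh m) := by
  have : hh m = fun s => pp (m + 3) (1 - pp 3 (2 * s - 1)) := rfl
  rw [this]
  refine (contDiff_pp m).comp (contDiff_const.sub ((contDiff_pp 0).comp ?_))
  fun_prop

def hh1 (m : ℕ) (s : ℝ) : ℝ := -(6 * ((m : ℝ) + 3)) * (kk s ^ (m + 2) * pp 2 (2 * s - 1))
def hh2 (m : ℕ) (s : ℝ) : ℝ :=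
  (36 * ((m : ℝ) + 3) * (m + 2)) * (kk s ^ (m + 1) * pp 2 (2 * s - 1) ^ 2)
   - (24 * ((m : ℝ) + 3)) * (kk s ^ (m + 2) * pp 1 (2 * s - 1))

lemma hasDerivAt_inner_pp (n : ℕ) (s : ℝ) :
    HasDerivAt (fun s : ℝ => pp (n + 2) (2 * s - 1)) (((n : ℝ) + 2) * pp (n + 1) (2 * s - 1) * 2) s := by
  have h : HasDerivAt (fun s : ℝ => 2 * s - 1) 2 s := by
    simpa using ((hasDerivAt_id s).const_mul 2).sub_const 1
  exact (hasDerivAt_pp n (2 * s - 1)).comp s h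

lemma hasDerivAt_kpow (n : ℕ) (s : ℝ) :
    HasDerivAt (fun s => kk s ^ (n + 2)) (-(6 * ((n : ℝ) + 2)) * (kk s ^ (n + 1) * pp 2 (2 * s - 1))) s := by
  have h1 := (hasDerivAt_inner_pp 1 s).const_sub 1
  have h2 := (hasDerivAt_pp n (1 - pp 3 (2 * s - 1))).comp s h1
  refine h2.congr_deriv ?_
  simp only [pp, kk]
  push_cast
  ring

lemma hasDerivAt_hh (m : ℕ) (s : ℝ) : HasDerivAt (hh m) (hh1 m s) s := by
  have := hasDerivAt_kpow (m + 1) s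
  refine this.congr_deriv ?_
  simp only [hh1]; push_cast; ring

lemma hasDerivAt_hh1 (m : ℕ) (s : ℝ) : HasDerivAt (hh1 m) (hh2 m s) s := by
  have h := ((hasDerivAt_kpow m s).mul (hasDerivAt_inner_pp 0 s)).const_mul (-(6 * ((m : ℝ) + 3)))
  refine h.congr_deriv ?_
  simp only [hh2]; push_cast; ring

lemma pp_inner_le {n : ℕ} {s : ℝ} (hs : s ≤ 1) : pp n (2 * s - 1) ≤ 1 :=
  pow_le_one₀ (le_max_right _ _) (max_le (by linarith) zero_le_one)

lemma hh1_nonpos (m : ℕ) (s : ℝ) : hh1 m s ≤ 0 := by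
  unfold hh1
  have := mul_nonneg (pow_nonneg (kk_nonneg s) (m + 2)) (pp_nonneg 2 (2 * s - 1))
  have h2 : (0 : ℝ) ≤ 6 * ((m : ℝ) + 3) := by positivity
  nlinarith

lemma kk_pow_mul_pp_le (n j : ℕ) (s : ℝ) : kk s ^ (n + 1) * pp j (2 * s - 1) ≤ kk s ^ (n + 1) := by
  rcases le_total s 1 with h | h
  · exact mul_le_of_le_one_right (pow_nonneg (kk_nonneg s) _) (pp_inner_le h)
  · simp [kk_eq_zero h]

lemma abs_hh1_le (m : ℕ) (s : ℝ) : |hh1 m s| ≤ 100 * ((m : ℝ) + 3) ^ 2 * kk s ^ (m + 1) := by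
  rw [abs_of_nonpos (hh1_nonpos m s)]
  unfold hh1
  have h1 := kk_pow_mul_pp_le (m + 1) 2 s
  have h2 : kk s ^ (m + 2) ≤ kk s ^ (m + 1) :=
    pow_le_pow_of_le_one (kk_nonneg s) (kk_le_one s) (by omega)
  have h3 : (0 : ℝ) ≤ m := Nat.cast_nonneg m
  have h4 : 0 ≤ kk s ^ (m + 1) := pow_nonneg (kk_nonneg s) _
  calc _ = (6 * ((m : ℝ) + 3)) * (kk s ^ (m + 2) * pp 2 (2 * s - 1)) := by ring
    _ ≤ (6 * ((m : ℝ) + 3)) * kk s ^ (m + 1) := by gcongr; exact h1.trans h2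
    _ ≤ _ := by
      refine mul_le_mul_of_nonneg_right ?_ h4
      nlinarith

lemma abs_hh2_le (m : ℕ) (s : ℝ) : |hh2 m s| ≤ 100 * ((m : ℝ) + 3) ^ 2 * kk s ^ (m + 1) := by
  have h1 := kk_pow_mul_pp_le (m + 1) 1 s
  have h2 : kk s ^ (m + 2) ≤ kk s ^ (m + 1) :=
    pow_le_pow_of_le_one (kk_nonneg s) (kk_le_one s) (by omega)
  have h3 : (0 : ℝ) ≤ m := Nat.cast_nonneg m
  have h4 : 0 ≤ kk s ^ (m + 1) := pow_nonneg (kk_nonneg s) _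
  have h5 : kk s ^ (m + 1) * pp 2 (2 * s - 1) ^ 2 ≤ kk s ^ (m + 1) := by
    have : pp 2 (2 * s - 1) ^ 2 = pp 4 (2 * s - 1) := by simp only [pp]; ring
    rw [this]; exact kk_pow_mul_pp_le m 4 s
  have h6 : 0 ≤ kk s ^ (m + 1) * pp 2 (2 * s - 1) ^ 2 := by positivity
  have h7 : 0 ≤ kk s ^ (m + 2) * pp 1 (2 * s - 1) :=
    mul_nonneg (pow_nonneg (kk_nonneg s) _) (pp_nonneg _ _)
  unfold hh2
  have e1 : (36 * ((m : ℝ) + 3) * (m + 2)) * (kk s ^ (m + 1) * pp 2 (2 * s - 1) ^ 2)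
      ≤ (36 * ((m : ℝ) + 3) * (m + 2)) * kk s ^ (m + 1) := by gcongr
  have e2 : (24 * ((m : ℝ) + 3)) * (kk s ^ (m + 2) * pp 1 (2 * s - 1))
      ≤ (24 * ((m : ℝ) + 3)) * kk s ^ (m + 1) := by gcongr; exact h1.trans h2
  have e3 : 0 ≤ (36 * ((m : ℝ) + 3) * (m + 2)) * (kk s ^ (m + 1) * pp 2 (2 * s - 1) ^ 2) := by positivity
  have e4 : 0 ≤ (24 * ((m : ℝ) + 3)) * (kk s ^ (m + 2) * pp 1 (2 * s - 1)) := by positivity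
  rw [abs_le]
  constructor <;> nlinarith [mul_nonneg h3 h4, mul_nonneg (mul_nonneg h3 h3) h4]

lemma hh1_eq_zero (m : ℕ) {s : ℝ} (hs : s ≤ 1 / 2) : hh1 m s = 0 := by
  have : max (2 * s - 1) 0 = 0 := max_eq_right (by linarith)
  simp [hh1, pp, this]
lemma hh2_eq_zero (m : ℕ) {s : ℝ} (hs : s ≤ 1 / 2) : hh2 m s = 0 := by
  have : max (2 * s - 1) 0 = 0 := max_eq_right (by linarith)
  simp [hh2, pp, this]

lemma hh1_lower (m : ℕ) {s : ℝ} (hs : 3 / 4 ≤ s) (hs2 : s ≤ 7 / 8) :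
    (1 / 2 : ℝ) ^ (m + 2) ≤ - hh1 m s := by
  have h1 : max (2 * s - 1) 0 = 2 * s - 1 := max_eq_left (by linarith)
  have h2 : 1 / 2 ≤ kk s := by
    refine le_trans ?_ (le_max_left _ _)
    unfold pp; rw [h1]
    have : (2 * s - 1) ^ 3 ≤ (3 / 4) ^ 3 := pow_le_pow_left₀ (by linarith) (by linarith) 3
    norm_num at this; linarith
  have h3 : (1 / 4 : ℝ) ≤ pp 2 (2 * s - 1) := by
    unfold pp; rw [h1]; nlinarith
  have h4 : (1 / 2 : ℝ) ^ (m + 2) ≤ kk s ^ (m + 2) := pow_le_pow_left₀ (by norm_num) h2 _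
  have h5 : (0 : ℝ) ≤ m := Nat.cast_nonneg m
  have h6 : (0 : ℝ) < (1 / 2) ^ (m + 2) := by positivity
  have h7 : (1 / 2 : ℝ) ^ (m + 2) * (1 / 4) ≤ kk s ^ (m + 2) * pp 2 (2 * s - 1) := by gcongr
  unfold hh1
  nlinarith

/-! jets -/

def Jet (g : ℝ → ℝ) (d1 d2 : ℝ) : Prop :=
  ∃ g1 : ℝ → ℝ, (∀ᶠ s in nhds 0, HasDerivAt g (g1 s) s) ∧ g1 0 = d1 ∧ HasDerivAt g1 d2 0

lemma Jet.mul {f g : ℝ → ℝ} {a b c d : ℝ} (hf : Jet f a b) (hg : Jet g c d) :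
    Jet (fun s => f s * g s) (a * g 0 + f 0 * c) (b * g 0 + 2 * a * c + f 0 * d) := by
  obtain ⟨f1, hf1, hf2, hf3⟩ := hf
  obtain ⟨g1, hg1, hg2, hg3⟩ := hg
  refine ⟨fun s => f1 s * g s + f s * g1 s, ?_, by simp only [hf2, hg2], ?_⟩
  · filter_upwards [hf1, hg1] with s h1 h2 using h1.mul h2
  · have := (hf3.mul hg1.self_of_nhds).add (hf1.self_of_nhds.mul hg3)
    refine this.congr_deriv ?_
    rw [hf2, hg2]; ring

lemma Jet.add {f g : ℝ → ℝ} {a b c d : ℝ} (hf : Jet f a b) (hg : Jet g c d) :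
    Jet (fun s => f s + g s) (a + c) (b + d) := by
  obtain ⟨f1, hf1, hf2, hf3⟩ := hf
  obtain ⟨g1, hg1, hg2, hg3⟩ := hg
  refine ⟨fun s => f1 s + g1 s, ?_, by simp only [hf2, hg2], hf3.add hg3⟩
  filter_upwards [hf1, hg1] with s h1 h2 using h1.add h2

lemma Jet.const (c : ℝ) : Jet (fun _ => c) 0 0 :=
  ⟨fun _ => 0, Eventually.of_forall fun s => hasDerivAt_const s c, rfl, hasDerivAt_const 0 0⟩

lemma Jet.comp {h h1 : ℝ → ℝ} {h2 : ℝ} {f : ℝ → ℝ} {a b : ℝ} (hf : Jet f a b)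
    (H1 : ∀ᶠ y in nhds (f 0), HasDerivAt h (h1 y) y) (H2 : HasDerivAt h1 h2 (f 0)) :
    Jet (fun s => h (f s)) (h1 (f 0) * a) (h2 * a ^ 2 + h1 (f 0) * b) := by
  obtain ⟨f1, hf1, hf2, hf3⟩ := hf
  refine ⟨fun s => h1 (f s) * f1 s, ?_, by simp only [hf2], ?_⟩
  · have hc : Tendsto f (nhds 0) (nhds (f 0)) := hf1.self_of_nhds.continuousAt
    filter_upwards [hf1, hc.eventually H1] with s h3 h4
    exact h4.comp s h3
  · have := (H2.comp (0 : ℝ) hf1.self_of_nhds).mul hf3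
    refine this.congr_deriv ?_
    simp only [Function.comp]
    rw [hf2]; ring

lemma Jet.congr {f : ℝ → ℝ} {a b c d : ℝ} (hf : Jet f a b) (h1 : a = c) (h2 : b = d) : Jet f c d := by
  subst h1; subst h2; exact hf

lemma Jet.const_mul {f : ℝ → ℝ} {a b : ℝ} (c : ℝ) (hf : Jet f a b) :
    Jet (fun s => c * f s) (c * a) (c * b) :=
  ((Jet.const c).mul hf).congr (by ring) (by ring)

lemma Jet.exp {f : ℝ → ℝ} {a b : ℝ} (hf : Jet f a b) :
    Jet (fun s => Real.exp (f s)) (Real.exp (f 0) * a) (Real.exp (f 0) * (a ^ 2 + b)) :=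
  (hf.comp (h1 := Real.exp) (Eventually.of_forall fun y => Real.hasDerivAt_exp y)
    (Real.hasDerivAt_exp _)).congr rfl (by ring)

lemma Jet.inv {f : ℝ → ℝ} {a b : ℝ} (hf : Jet f a b) (h0 : f 0 ≠ 0) :
    Jet (fun s => (f s)⁻¹) (-a / f 0 ^ 2) (2 * a ^ 2 / f 0 ^ 3 - b / f 0 ^ 2) := by
  have key : HasDerivAt (fun y : ℝ => -(y ^ 2)⁻¹) (2 / f 0 ^ 3) (f 0) := by
    have := ((hasDerivAt_pow 2 (f 0)).inv (pow_ne_zero 2 h0)).neg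
    refine this.congr_deriv ?_
    field_simp
    ring
  refine (hf.comp (h := fun y => y⁻¹) (h1 := fun y => -(y ^ 2)⁻¹) ?_ key).congr ?_ ?_
  · filter_upwards [isOpen_ne.mem_nhds h0] with y hy using hasDerivAt_inv hy
  · field_simp
  · field_simp
    ring

lemma Jet.log {f : ℝ → ℝ} {a b : ℝ} (hf : Jet f a b) (h0 : f 0 ≠ 0) :
    Jet (fun s => Real.log (f s)) (a / f 0) (b / f 0 - a ^ 2 / f 0 ^ 2) := by
  refine (hf.comp (h := Real.log) (h1 := fun y => y⁻¹) ?_ (hasDerivAt_inv h0)).congr ?_ ?_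
  · filter_upwards [isOpen_ne.mem_nhds h0] with y hy using Real.hasDerivAt_log hy
  · field_simp
  · field_simp
    ring

lemma Jet.quad (c a b : ℝ) : Jet (fun s => c + a * s + b * s ^ 2) a (2 * b) := by
  refine ⟨fun s => a + 2 * b * s, Eventually.of_forall fun s => ?_, by simp, ?_⟩
  · have := (((hasDerivAt_id s).const_mul a).const_add c).add ((hasDerivAt_pow 2 s).const_mul b)
    refine this.congr_deriv ?_
    norm_num; ring
  · have := ((hasDerivAt_id (0 : ℝ)).const_mul (2 * b)).const_add a
    refine this.congr_deriv ?_
    simp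

lemma secondDeriv_of_jet {N k : ℕ} {f : Euc N × Euc k → ℝ} {z v : Euc N × Euc k} {d1 d2 : ℝ}
    (hf : ContDiffAt ℝ 2 f z) (hj : Jet (fun s => f (z + s • v)) d1 d2) :
    secondDeriv f z v = d2 := by
  obtain ⟨g1, h1, -, h3⟩ := hj
  have hl : ∀ s : ℝ, HasDerivAt (fun s : ℝ => z + s • v) v s := fun s => by
    simpa using ((hasDerivAt_id s).smul_const v).const_add z
  have hc : Tendsto (fun s : ℝ => z + s • v) (nhds 0) (nhds z) := by
    have := (hl 0).continuousAt.tendsto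
    simpa using this
  have hd : ∀ᶠ w in nhds z, DifferentiableAt ℝ f w := by
    filter_upwards [hf.eventually (by simp)] with w hw using hw.differentiableAt (by norm_num)
  have e1 : (fun s : ℝ => fderiv ℝ f (z + s • v) v) =ᶠ[nhds 0] g1 := by
    filter_upwards [h1, hc.eventually hd] with s hs hs2
    exact (hs2.hasFDerivAt.comp_hasDerivAt s (hl s)).unique hs
  have hf' : DifferentiableAt ℝ (fun w => fderiv ℝ f w v) z := by
    have : ContDiffAt ℝ 1 (fderiv ℝ f) z := hf.fderiv_right (by norm_num)
    exact (this.differentiableAt (by norm_num)).clm_apply (differentiableAt_const v)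
  have e2 : HasDerivAt (fun s : ℝ => fderiv ℝ f (z + s • v) v) (secondDeriv f z v) 0 := by
    have h0 : DifferentiableAt ℝ (fun w => fderiv ℝ f w v) (z + (0 : ℝ) • v) := by simpa using hf'
    have := h0.hasFDerivAt.comp_hasDerivAt (0 : ℝ) (hl 0)
    simpa [secondDeriv, Function.comp_def] using this
  exact (e2.congr_of_eventuallyEq e1.symm).unique h3

lemma sq_norm_add_single {n : ℕ} (x : Euc n) (i : Fin n) (s : ℝ) :
    ‖x + s • (EuclideanSpace.single i (1 : ℝ))‖ ^ 2 = ‖x‖ ^ 2 + 2 * x i * s + 1 * s ^ 2 := by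
  rw [norm_add_sq_real]
  simp [inner_smul_right, norm_smul, EuclideanSpace.inner_single_right]
  ring


lemma grushin_of_jets {N k : ℕ} {f : Euc N × Euc k → ℝ} {z : Euc N × Euc k}
    (hf : ContDiffAt ℝ 2 f z) {a b : Fin N → ℝ} {c d : Fin k → ℝ}
    (hx : ∀ i, Jet (fun s => f (z + s • ((EuclideanSpace.single i 1, 0) : Euc N × Euc k))) (a i) (b i))
    (hy : ∀ j, Jet (fun s => f (z + s • ((0, EuclideanSpace.single j 1) : Euc N × Euc k))) (c j) (d j)) :
    grushin f z = ∑ i, b i + ‖z.1‖ ^ 2 * ∑ j, d j := by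
  unfold grushin laplacianX laplacianY
  congr 1
  · exact Finset.sum_congr rfl fun i _ => secondDeriv_of_jet hf (hx i)
  · congr 1
    exact Finset.sum_congr rfl fun i _ => secondDeriv_of_jet hf (hy i)

lemma secondDeriv_mul_const {N k : ℕ} {f : Euc N × Euc k → ℝ} (hf : ContDiff ℝ 2 f) (c : ℝ)
    (z v : Euc N × Euc k) : secondDeriv (fun w => f w * c) z v = secondDeriv f z v * c := by
  have h1 : (fun w => fderiv ℝ (fun w => f w * c) w v) = fun w => fderiv ℝ f w v * c := by
    funext w
    have hd : DifferentiableAt ℝ f w := (hf.differentiable (by norm_num)) w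
    rw [fderiv_mul_const hd]
    simp [mul_comm]
  unfold secondDeriv
  rw [h1]
  have h2 : DifferentiableAt ℝ (fun w => fderiv ℝ f w v) z := by
    have : ContDiff ℝ 1 (fderiv ℝ f) := hf.fderiv_right (by norm_num)
    exact ((this.differentiable (by norm_num)) z).clm_apply (differentiableAt_const v)
  rw [fderiv_mul_const h2]
  simp [mul_comm]

lemma grushin_mul_const {N k : ℕ} {f : Euc N × Euc k → ℝ} (hf : ContDiff ℝ 2 f) (c : ℝ)
    (z : Euc N × Euc k) : grushin (fun w => f w * c) z = grushin f z * c := by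
  unfold grushin laplacianX laplacianY
  simp only [secondDeriv_mul_const hf, ← Finset.sum_mul]
  ring

lemma continuous_grushin_slice {N k : ℕ} {F : (Euc N × Euc k) × ℝ → ℝ} (hF : ContDiff ℝ 2 F) :
    Continuous (fun q : (Euc N × Euc k) × ℝ => grushin (fun w => F (w, q.2)) q.1) := by
  have key : ∀ v : Euc N × Euc k,
      Continuous (fun q : (Euc N × Euc k) × ℝ => secondDeriv (fun w => F (w, q.2)) q.1 v) := by
    intro v
    have h1 : ∀ (w : Euc N × Euc k) (t : ℝ),
        fderiv ℝ (fun w => F (w, t)) w v = fderiv ℝ F (w, t) (v, 0) := by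
      intro w t
      have hd : DifferentiableAt ℝ F (w, t) := (hF.differentiable (by norm_num)) _
      have h2 : HasFDerivAt (fun w : Euc N × Euc k => (w, t))
          (ContinuousLinearMap.inl ℝ (Euc N × Euc k) ℝ) w := hasFDerivAt_prodMk_left w t
      have := (hd.hasFDerivAt.comp w h2).fderiv
      have e : (fun w => F (w, t)) = F ∘ fun w => (w, t) := rfl
      rw [e, this]
      simp
    let G : (Euc N × Euc k) × ℝ → ℝ := fun q => fderiv ℝ F q (v, 0)
    have hG : ContDiff ℝ 1 G := by
      have : ContDiff ℝ 1 (fderiv ℝ F) := hF.fderiv_right (by norm_num)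
      exact this.clm_apply contDiff_const
    have h3 : ∀ q : (Euc N × Euc k) × ℝ,
        secondDeriv (fun w => F (w, q.2)) q.1 v = fderiv ℝ G q (v, 0) := by
      rintro ⟨w, t⟩
      unfold secondDeriv
      simp only [h1]
      have hd : DifferentiableAt ℝ G (w, t) := (hG.differentiable (by norm_num)) _
      have h2 : HasFDerivAt (fun w : Euc N × Euc k => (w, t))
          (ContinuousLinearMap.inl ℝ (Euc N × Euc k) ℝ) w := hasFDerivAt_prodMk_left w t
      have := (hd.hasFDerivAt.comp w h2).fderiv
      have e : (fun w => fderiv ℝ F (w, t) (v, 0)) = G ∘ fun w => (w, t) := rfl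
      rw [e, this]
      simp
    simp only [h3]
    exact (hG.continuous_fderiv (by norm_num)).clm_apply continuous_const
  unfold grushin laplacianX laplacianY
  refine Continuous.add (continuous_finsetSum _ fun i _ => key _) ?_
  refine Continuous.mul (by fun_prop) (continuous_finsetSum _ fun i _ => key _)

lemma grushin_eq_zero_of_eventually {N k : ℕ} {f : Euc N × Euc k → ℝ} {z : Euc N × Euc k}
    (h : ∀ᶠ w in nhds z, f w = 0) : grushin f z = 0 := by
  have key : ∀ v, secondDeriv f z v = 0 := by
    intro v
    have h1 : (fun w => fderiv ℝ f w v) =ᶠ[nhds z] fun _ => 0 := by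
      filter_upwards [eventually_eventually_nhds.2 h] with w hw
      have : f =ᶠ[nhds w] fun _ => 0 := hw
      rw [this.fderiv_eq]; simp
    unfold secondDeriv
    rw [h1.fderiv_eq]; simp
  simp [grushin, laplacianX, laplacianY, key]

/-- homogeneous gauge -/
def gR {N k : ℕ} (R : ℝ) (z : Euc N × Euc k) : ℝ := (‖z.1‖ ^ 4 + ‖z.2‖ ^ 2) / R ^ 4

def psiR {N k : ℕ} (m : ℕ) (R : ℝ) (z : Euc N × Euc k) : ℝ := hh m (gR R z)

lemma contDiff_gR {N k : ℕ} (R : ℝ) : ContDiff ℝ 2 (gR R : Euc N × Euc k → ℝ) := by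
  have h1 : ContDiff ℝ 2 (fun z : Euc N × Euc k => ‖z.1‖ ^ 2) := contDiff_fst.norm_sq ℝ
  have h2 : ContDiff ℝ 2 (fun z : Euc N × Euc k => ‖z.2‖ ^ 2) := contDiff_snd.norm_sq ℝ
  have : (gR R : Euc N × Euc k → ℝ) = fun z => ((‖z.1‖ ^ 2) ^ 2 + ‖z.2‖ ^ 2) / R ^ 4 := by
    funext z; unfold gR; ring
  rw [this]
  exact ((h1.pow 2).add h2).div_const _

lemma contDiff_psiR {N k : ℕ} (m : ℕ) (R : ℝ) : ContDiff ℝ 2 (psiR m R : Euc N × Euc k → ℝ) :=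
  (contDiff_hh m).comp (contDiff_gR R)

lemma grushin_psiR {N k : ℕ} (m : ℕ) (R : ℝ) (z : Euc N × Euc k) :
    grushin (psiR m R) z =
      hh2 m (gR R z) * (16 * ‖z.1‖ ^ 6 / R ^ 8 + 4 * ‖z.1‖ ^ 2 * ‖z.2‖ ^ 2 / R ^ 8)
      + hh1 m (gR R z) * ((4 * N + 8 + 2 * k) * ‖z.1‖ ^ 2 / R ^ 4) := by
  have hx : ∀ i : Fin N, Jet (fun s => psiR m R
      (z + s • ((EuclideanSpace.single i 1, 0) : Euc N × Euc k)))
      (hh1 m (gR R z) * (4 * ‖z.1‖ ^ 2 * z.1 i / R ^ 4))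
      (hh2 m (gR R z) * (4 * ‖z.1‖ ^ 2 * z.1 i / R ^ 4) ^ 2
        + hh1 m (gR R z) * ((4 * ‖z.1‖ ^ 2 + 8 * z.1 i ^ 2) / R ^ 4)) := by
    intro i
    have q := Jet.quad (‖z.1‖ ^ 2) (2 * z.1 i) 1
    have q2 := (((q.mul q).add (Jet.const (‖z.2‖ ^ 2))).const_mul (1 / R ^ 4))
    have q3 := q2.comp (h := hh m) (Eventually.of_forall fun y => hasDerivAt_hh m y) (hasDerivAt_hh1 m _)
    have e : (fun s : ℝ => psiR m R (z + s • ((EuclideanSpace.single i 1, 0) : Euc N × Euc k)))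
      = fun s => hh m (1 / R ^ 4 * ((‖z.1‖ ^ 2 + 2 * z.1 i * s + 1 * s ^ 2) *
          (‖z.1‖ ^ 2 + 2 * z.1 i * s + 1 * s ^ 2) + ‖z.2‖ ^ 2)) := by
      funext s
      unfold psiR gR
      congr 1
      have := sq_norm_add_single z.1 i s
      simp only [Prod.fst_add, Prod.snd_add, Prod.smul_fst, Prod.smul_snd, smul_zero, add_zero]
      rw [← this]; ring
    rw [e]
    have e0 : (1 / R ^ 4 * ((‖z.1‖ ^ 2 + 2 * z.1 i * 0 + 1 * 0 ^ 2) *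
          (‖z.1‖ ^ 2 + 2 * z.1 i * 0 + 1 * 0 ^ 2) + ‖z.2‖ ^ 2)) = gR R z := by
      unfold gR; ring
    simp only [e0] at q3
    refine q3.congr ?_ ?_
    · ring
    · ring
  have hy : ∀ j : Fin k, Jet (fun s => psiR m R
      (z + s • ((0, EuclideanSpace.single j 1) : Euc N × Euc k)))
      (hh1 m (gR R z) * (2 * z.2 j / R ^ 4))
      (hh2 m (gR R z) * (2 * z.2 j / R ^ 4) ^ 2
        + hh1 m (gR R z) * (2 / R ^ 4)) := by
    intro i
    have q := Jet.quad (‖z.2‖ ^ 2) (2 * z.2 i) 1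
    have q2 := (((Jet.const (‖z.1‖ ^ 4)).add q).const_mul (1 / R ^ 4))
    have q3 := q2.comp (h := hh m) (Eventually.of_forall fun y => hasDerivAt_hh m y) (hasDerivAt_hh1 m _)
    have e : (fun s : ℝ => psiR m R (z + s • ((0, EuclideanSpace.single i 1) : Euc N × Euc k)))
      = fun s => hh m (1 / R ^ 4 * (‖z.1‖ ^ 4 + (‖z.2‖ ^ 2 + 2 * z.2 i * s + 1 * s ^ 2))) := by
      funext s
      unfold psiR gR
      congr 1
      have := sq_norm_add_single z.2 i s
      simp only [Prod.fst_add, Prod.snd_add, Prod.smul_fst, Prod.smul_snd, smul_zero, add_zero]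
      rw [← this]; ring
    rw [e]
    have e0 : (1 / R ^ 4 * (‖z.1‖ ^ 4 + (‖z.2‖ ^ 2 + 2 * z.2 i * 0 + 1 * 0 ^ 2))) = gR R z := by
      unfold gR; ring
    simp only [e0] at q3
    refine q3.congr ?_ ?_
    · ring
    · ring
  rw [grushin_of_jets (contDiff_psiR m R).contDiffAt hx hy]
  have s1 : ∑ i, z.1 i ^ 2 = ‖z.1‖ ^ 2 := by
    rw [EuclideanSpace.norm_sq_eq]; simp
  have s2 : ∑ i, z.2 i ^ 2 = ‖z.2‖ ^ 2 := by
    rw [EuclideanSpace.norm_sq_eq]; simp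
  have t1 : ∑ i : Fin N, (hh2 m (gR R z) * (4 * ‖z.1‖ ^ 2 * z.1 i / R ^ 4) ^ 2
        + hh1 m (gR R z) * ((4 * ‖z.1‖ ^ 2 + 8 * z.1 i ^ 2) / R ^ 4))
      = hh2 m (gR R z) * (16 * ‖z.1‖ ^ 4 / R ^ 8) * ∑ i, z.1 i ^ 2
        + hh1 m (gR R z) * (N * (4 * ‖z.1‖ ^ 2 / R ^ 4) + 8 / R ^ 4 * ∑ i, z.1 i ^ 2) := by
    have hN : (N : ℝ) * (4 * ‖z.1‖ ^ 2 / R ^ 4) = ∑ i : Fin N, (4 * ‖z.1‖ ^ 2 / R ^ 4) := by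
      simp
    rw [hN, Finset.mul_sum, Finset.mul_sum, ← Finset.sum_add_distrib, Finset.mul_sum,
      ← Finset.sum_add_distrib]
    refine Finset.sum_congr rfl fun i _ => ?_
    ring
  have t2 : ∑ i : Fin k, (hh2 m (gR R z) * (2 * z.2 i / R ^ 4) ^ 2
        + hh1 m (gR R z) * (2 / R ^ 4))
      = hh2 m (gR R z) * (4 / R ^ 8) * ∑ i, z.2 i ^ 2 + hh1 m (gR R z) * (k * (2 / R ^ 4)) := by
    have hN : (k : ℝ) * (2 / R ^ 4) = ∑ i : Fin k, (2 / R ^ 4) := by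
      simp
    rw [hN, Finset.mul_sum, Finset.mul_sum, ← Finset.sum_add_distrib]
    refine Finset.sum_congr rfl fun i _ => ?_
    ring
  rw [t1, t2, s1, s2]
  ring

lemma gR_nonneg {N k : ℕ} (R : ℝ) (z : Euc N × Euc k) : 0 ≤ gR R z := by
  unfold gR; positivity

lemma gR_bounds {N k : ℕ} {R : ℝ} (hR : 0 < R) {z : Euc N × Euc k} (h : gR R z ≤ 1) :
    ‖z.1‖ ≤ R ∧ ‖z.2‖ ≤ R ^ 2 := by
  unfold gR at h
  rw [div_le_one (by positivity)] at h
  constructor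
  · refine le_of_pow_le_pow_left₀ (four_ne_zero) hR.le ?_
    nlinarith [sq_nonneg ‖z.2‖]
  · refine le_of_pow_le_pow_left₀ (two_ne_zero) (by positivity) ?_
    have : 0 ≤ ‖z.1‖ ^ 4 := by positivity
    nlinarith

def CL (N k m : ℕ) : ℝ := 100 * ((m : ℝ) + 3) ^ 2 * (28 + 4 * N + 2 * k)

lemma CL_nonneg (N k m : ℕ) : 0 ≤ CL N k m := by unfold CL; positivity

lemma abs_grushin_psiR_le {N k : ℕ} (m : ℕ) {R : ℝ} (hR : 0 < R) (z : Euc N × Euc k) :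
    |grushin (psiR m R) z| ≤ CL N k m / R ^ 2 * kk (gR R z) ^ (m + 1) := by
  rw [grushin_psiR]
  have a1 := abs_hh1_le m (gR R z)
  have a2 := abs_hh2_le m (gR R z)
  rcases le_total (gR R z) 1 with h | h
  · obtain ⟨b1, b2⟩ := gR_bounds hR h
    have c1 : 16 * ‖z.1‖ ^ 6 / R ^ 8 + 4 * ‖z.1‖ ^ 2 * ‖z.2‖ ^ 2 / R ^ 8 ≤ 20 / R ^ 2 := by
      have : 20 / R ^ 2 = (16 * R ^ 6 / R ^ 8 + 4 * R ^ 2 * (R ^ 2) ^ 2 / R ^ 8) := by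
        field_simp; ring
      rw [this]
      gcongr
    have c2 : (4 * N + 8 + 2 * k) * ‖z.1‖ ^ 2 / R ^ 4 ≤ (4 * N + 8 + 2 * k) / R ^ 2 := by
      have : (4 * N + 8 + 2 * k) / R ^ 2 = ((4 * N + 8 + 2 * k) * R ^ 2 / R ^ 4 : ℝ) := by
        field_simp
      rw [this]
      gcongr
    have c3 : 0 ≤ 16 * ‖z.1‖ ^ 6 / R ^ 8 + 4 * ‖z.1‖ ^ 2 * ‖z.2‖ ^ 2 / R ^ 8 := by positivity
    have c4 : 0 ≤ (4 * N + 8 + 2 * k) * ‖z.1‖ ^ 2 / R ^ 4 := by positivity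
    have k0 : 0 ≤ kk (gR R z) ^ (m + 1) := pow_nonneg (kk_nonneg _) _
    refine (abs_add_le _ _).trans ?_
    rw [abs_mul, abs_mul, abs_of_nonneg c3, abs_of_nonneg c4]
    calc _ ≤ (100 * ((m : ℝ) + 3) ^ 2 * kk (gR R z) ^ (m + 1)) * (20 / R ^ 2)
          + (100 * ((m : ℝ) + 3) ^ 2 * kk (gR R z) ^ (m + 1)) * ((4 * N + 8 + 2 * k) / R ^ 2) := by
            gcongr
      _ = _ := by unfold CL; ring
  · have k0 : kk (gR R z) ^ (m + 1) = 0 := by simp [kk_eq_zero h]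
    rw [k0, mul_zero] at a1 a2
    rw [abs_nonpos_iff.1 a1, abs_nonpos_iff.1 a2]
    simp [k0]

lemma grushin_psiR_eq_zero {N k : ℕ} (m : ℕ) (R : ℝ) {z : Euc N × Euc k} (h : gR R z ≤ 1 / 2) :
    grushin (psiR m R) z = 0 := by
  rw [grushin_psiR, hh1_eq_zero m h, hh2_eq_zero m h]; simp

lemma isCompact_gR {N k : ℕ} {R : ℝ} (hR : 0 < R) : IsCompact {z : Euc N × Euc k | gR R z ≤ 1} := by
  refine IsCompact.of_isClosed_subset ((isCompact_closedBall (0 : Euc N) R).prod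
    (isCompact_closedBall (0 : Euc k) (R ^ 2)))
    (isClosed_le (contDiff_gR R).continuous continuous_const) ?_
  intro z hz
  obtain ⟨h1, h2⟩ := gR_bounds hR hz
  exact ⟨by simpa using h1, by simpa using h2⟩

lemma psiR_eq_zero {N k : ℕ} (m : ℕ) {R : ℝ} {z : Euc N × Euc k} (h : 1 ≤ gR R z) :
    psiR m R z = 0 := hh_eq_zero m h


/-- the open half space -/
def Om (N k : ℕ) : Set ((Euc N × Euc k) × ℝ) := Set.univ ×ˢ Set.Ioi 0

lemma mem_Om {N k : ℕ} {q : (Euc N × Euc k) × ℝ} : q ∈ Om N k ↔ 0 < q.2 := by simp [Om]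

lemma isOpen_Om (N k : ℕ) : IsOpen (Om N k) := isOpen_univ.prod isOpen_Ioi
lemma measurableSet_Om (N k : ℕ) : MeasurableSet (Om N k) := (isOpen_Om N k).measurableSet

structure WS (N k : ℕ) (u0 : Euc N × Euc k → ℝ) (U f1 f2 : (Euc N × Euc k) × ℝ → ℝ) : Prop where
  hU : ∀ q, 0 < q.2 → 0 ≤ U q
  h1 : ∀ q, 0 < q.2 → 0 ≤ f1 q
  h2 : ∀ q, 0 < q.2 → 0 ≤ f2 q
  iU : LocallyIntegrableOn U (Om N k) volume
  i1 : LocallyIntegrableOn f1 (Om N k) volume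
  i2 : LocallyIntegrableOn f2 (Om N k) volume
  weak : ∀ F : (Euc N × Euc k) × ℝ → ℝ, ContDiff ℝ 2 F → HasCompactSupport F →
    - ∫ z, u0 z * F (z, 0) =
      (∫ t in Set.Ioi (0 : ℝ), ∫ z, f1 (z, t) * F (z, t)) +
      (∫ t in Set.Ioi (0 : ℝ), ∫ z, f2 (z, t) * F (z, t)) +
      (∫ t in Set.Ioi (0 : ℝ), ∫ z, U (z, t) * grushin (fun w => F (w, t)) z) +
      (∫ t in Set.Ioi (0 : ℝ), ∫ z, U (z, t) * deriv (fun s => F (z, s)) t)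

lemma absPow_eq {p v : ℝ} (hv : 0 ≤ v) (hp : 1 < p) : absPow p v = v ^ p := by
  unfold absPow
  rw [abs_of_nonneg hv]
  rcases hv.eq_or_lt with h | h
  · subst h
    rw [Real.zero_rpow (by linarith), Real.zero_rpow (by linarith)]; simp
  · rw [Real.rpow_sub_one h.ne']; field_simp

lemma locInt_Om {N k : ℕ} {f : (Euc N × Euc k) × ℝ → ℝ}
    (h : ∀ T : ℝ, 0 < T → LocallyIntegrableOn f (Set.univ ×ˢ Set.Ioo 0 T) volume) :
    LocallyIntegrableOn f (Om N k) volume := by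
  intro q hq
  have hq' : 0 < q.2 := mem_Om.1 hq
  have := h (q.2 + 1) (by linarith) q ⟨trivial, hq', by linarith⟩
  rw [IsOpen.nhdsWithin_eq (isOpen_univ.prod isOpen_Ioo) ⟨trivial, hq', by linarith⟩] at this
  rwa [IsOpen.nhdsWithin_eq (isOpen_Om N k) hq]

lemma WS_of_sol {N k : ℕ} {γ p1 p2 : ℝ} (hγ1 : γ < 1) (hp1 : 1 < p1) (hp2 : 1 < p2)
    {u0 : Euc N × Euc k → ℝ} {u : Euc N × Euc k → ℝ → ℝ}
    (hu : ∀ z : Euc N × Euc k, ∀ t : ℝ, 0 ≤ t → 0 ≤ u z t)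
    (hw : ∀ T : ℝ, 0 < T → IsWeakSolutionGen N k 1 1 γ p1 p2 T u0 u) :
    WS N k u0 (fun q => u q.1 q.2)
      (fun q => ∫ s in Set.Ioc (0 : ℝ) q.2, (q.2 - s) ^ (-γ) * u q.1 s ^ p1)
      (fun q => u q.1 q.2 ^ p2) := by
  have hG : 0 < Real.Gamma (1 - γ) := Real.Gamma_pos_of_pos (by linarith)
  have ef1 : ∀ q : (Euc N × Euc k) × ℝ,
      ∫ s in Set.Ioc (0 : ℝ) q.2, (q.2 - s) ^ (-γ) * u q.1 s ^ p1 =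
      Real.Gamma (1 - γ) * fracInt (1 - γ) (fun s => absPow p1 (u q.1 s)) q.2 := by
    intro q
    unfold fracInt
    rw [← mul_assoc, mul_one_div_cancel hG.ne', one_mul]
    refine setIntegral_congr_fun measurableSet_Ioc fun s hs => ?_
    simp only
    rw [absPow_eq (hu _ _ hs.1.le) hp1]
    congr 2; ring
  have congr_loc : ∀ {f g : (Euc N × Euc k) × ℝ → ℝ}, (∀ q ∈ Om N k, f q = g q) →
      LocallyIntegrableOn f (Om N k) volume → LocallyIntegrableOn g (Om N k) volume := by
    intro f g hfg hf
    rw [locallyIntegrableOn_iff (isOpen_Om N k).isLocallyClosed] at hf ⊢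
    intro K hK hKc
    exact (hf K hK hKc).congr_fun (fun q hq => hfg q (hK hq)) hKc.measurableSet
  have i2 : LocallyIntegrableOn (fun q : (Euc N × Euc k) × ℝ => u q.1 q.2 ^ p2) (Om N k) volume := by
    refine congr_loc (fun q hq => ?_) (locInt_Om fun T hT => (hw T hT).2.1)
    exact absPow_eq (hu _ _ (mem_Om.1 hq).le) hp2
  have i1 : LocallyIntegrableOn (fun q : (Euc N × Euc k) × ℝ =>
      ∫ s in Set.Ioc (0 : ℝ) q.2, (q.2 - s) ^ (-γ) * u q.1 s ^ p1) (Om N k) volume := by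
    have h := locInt_Om fun T hT => (hw T hT).1
    have h2 := h.smul (Real.Gamma (1 - γ))
    refine congr_loc (fun q hq => ?_) h2
    rw [ef1]; rfl
  have iU : LocallyIntegrableOn (fun q : (Euc N × Euc k) × ℝ => u q.1 q.2) (Om N k) volume := by
    rw [locallyIntegrableOn_iff (isOpen_Om N k).isLocallyClosed] at i2 ⊢
    intro K hK hKc
    have h := i2 K hK hKc
    have hm : AEStronglyMeasurable (fun q : (Euc N × Euc k) × ℝ => u q.1 q.2) (volume.restrict K) := by
      have := (h.aestronglyMeasurable.aemeasurable.pow_const (1 / p2)).aestronglyMeasurable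
      refine this.congr ?_
      filter_upwards [ae_restrict_mem hKc.measurableSet] with q hq
      rw [← Real.rpow_mul (hu _ _ (mem_Om.1 (hK hq)).le), mul_one_div_cancel (by linarith), Real.rpow_one]
    have : IntegrableOn (fun _ : (Euc N × Euc k) × ℝ => (1:ℝ)) K :=
      integrableOn_const hKc.measure_lt_top.ne
    refine Integrable.mono' (Integrable.add this h) hm ?_
    filter_upwards [ae_restrict_mem hKc.measurableSet] with q hq
    have h0 := hu q.1 _ (mem_Om.1 (hK hq)).le
    rw [Real.norm_of_nonneg h0]
    simp only [Pi.add_apply]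
    rcases le_total (u q.1 q.2) 1 with h1 | h1
    · have := Real.rpow_nonneg h0 p2; linarith
    · have := Real.self_le_rpow_of_one_le h1 hp2.le; linarith
  refine ⟨fun q hq => hu _ _ hq.le, fun q hq => ?_, fun q hq => Real.rpow_nonneg (hu _ _ hq.le) _, iU, i1, i2, ?_⟩
  · refine setIntegral_nonneg measurableSet_Ioc fun s hs => ?_
    exact mul_nonneg (Real.rpow_nonneg (by linarith [hs.2]) _) (Real.rpow_nonneg (hu _ _ hs.1.le) _)
  intro F hF hFc
  obtain ⟨B, hB⟩ := hFc.isBounded.subset_closedBall 0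
  have hz : ∀ z : Euc N × Euc k, ∀ t : ℝ, |B| + 1 ≤ t → F (z, t) = 0 := by
    intro z t ht
    by_contra hne
    have h1 : (z, t) ∈ tsupport F := subset_tsupport _ hne
    have h2 := hB h1
    rw [mem_closedBall_zero_iff, Prod.norm_def] at h2
    have h3 : |t| ≤ B := le_trans (le_max_right _ _) h2
    have := le_abs_self t
    have := le_abs_self B
    linarith
  have hT : 0 < |B| + 2 := by positivity
  have key := (hw (|B| + 2) hT).2.2 (fun z t => F (z, t)) hF hFc (fun z => hz z _ (by linarith))
  have hz' : ∀ z : Euc N × Euc k, F (z, |B| + 2) = 0 := fun z => hz z _ (by linarith)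
  simp only [hz', mul_zero, integral_zero, zero_sub, one_mul] at key
  have ext : ∀ G : ℝ → ℝ, (∀ t, |B| + 2 < t → G t = 0) →
      ∫ t in Set.Ioi 0, G t = ∫ t in Set.Ioc 0 (|B| + 2), G t := by
    intro G hG0
    refine (setIntegral_eq_of_subset_of_forall_sdiff_eq_zero measurableSet_Ioi
      (Set.Ioc_subset_Ioi_self) ?_)
    intro t ht
    apply hG0
    by_contra hcon
    exact ht.2 ⟨ht.1, not_lt.1 hcon⟩
  rw [ext, ext, ext, ext, key, ← integral_const_mul]
  · have e2 : ∫ t in Set.Ioc 0 (|B| + 2), ∫ z, absPow p2 (u z t) * F (z, t) =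
      ∫ t in Set.Ioc 0 (|B| + 2), ∫ z, u z t ^ p2 * F (z, t) := ?_
    · rw [e2]
      congr 4
      funext t
      rw [← integral_const_mul]
      congr 1; funext z
      rw [ef1]; ring
    refine setIntegral_congr_fun measurableSet_Ioc fun t ht => ?_
    refine integral_congr_ae (Eventually.of_forall fun z => ?_)
    simp only
    rw [absPow_eq (hu _ _ ht.1.le) hp2]
  · intro t ht
    have : ∀ z, deriv (fun s => F (z, s)) t = 0 := by
      intro z
      have : (fun s => F (z, s)) =ᶠ[nhds t] fun _ => 0 := by
        filter_upwards [lt_mem_nhds ht] with s hs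
        exact hz _ _ (by linarith)
      rw [this.deriv_eq]; simp
    simp [this]
  · intro t ht
    have : (fun w => F (w, t)) = fun _ => 0 := by
      funext w; exact hz _ _ (by linarith)
    have h0 : ∀ z, grushin (fun w => F (w, t)) z = 0 := by
      intro z
      rw [this]
      exact grushin_eq_zero_of_eventually (Eventually.of_forall fun _ => rfl)
    simp [h0]
  · intro t ht
    simp [hz _ t (by linarith)]
  · intro t ht
    simp [hz _ t (by linarith)]

lemma integral_Om {N k : ℕ} {G : (Euc N × Euc k) × ℝ → ℝ} (hG : IntegrableOn G (Om N k)) :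
    ∫ t in Set.Ioi (0 : ℝ), ∫ z, G (z, t) = ∫ q in Om N k, G q := by
  have e : (volume : Measure ((Euc N × Euc k) × ℝ)).restrict (Om N k) =
      (volume : Measure (Euc N × Euc k)).prod (volume.restrict (Set.Ioi (0:ℝ))) := by
    rw [Om, Measure.volume_eq_prod, ← Measure.prod_restrict, Measure.restrict_univ]
  rw [IntegrableOn, e] at hG
  rw [e, integral_prod_symm _ hG]

lemma restrict_Om (N k : ℕ) : (volume : Measure ((Euc N × Euc k) × ℝ)).restrict (Om N k) =
      (volume : Measure (Euc N × Euc k)).prod (volume.restrict (Set.Ioi (0:ℝ))) := by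
    rw [Om, Measure.volume_eq_prod, ← Measure.prod_restrict, Measure.restrict_univ]

lemma integrableOn_mul_cont {N k : ℕ} {f c : (Euc N × Euc k) × ℝ → ℝ} {K : Set ((Euc N × Euc k) × ℝ)}
    (hK : IsCompact K) (hf : IntegrableOn f (K ∩ Om N k)) (hc : Continuous c)
    (h0 : ∀ q, q ∉ K → c q = 0) : IntegrableOn (fun q => f q * c q) (Om N k) := by
  have h1 : IntegrableOn (fun q => f q * c q) (K ∩ Om N k) := by
    have hb : ∃ C, ∀ q ∈ K, ‖c q‖ ≤ C := hK.exists_bound_of_continuousOn hc.continuousOn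
    obtain ⟨C, hC⟩ := hb
    refine Integrable.mul_bdd (c := C) hf hc.aestronglyMeasurable ?_
    filter_upwards [ae_restrict_mem (hK.measurableSet.inter (measurableSet_Om N k))] with q hq
    exact hC q hq.1
  have := h1.of_forall_sdiff_eq_zero (t := Om N k) (measurableSet_Om N k) ?_
  · exact this
  · rintro q ⟨hq, hq2⟩
    have : q ∉ K := fun h => hq2 ⟨h, hq⟩
    simp [h0 q this]

lemma continuous_deriv_slice {N k : ℕ} {F : (Euc N × Euc k) × ℝ → ℝ} (hF : ContDiff ℝ 2 F) :
    Continuous (fun q : (Euc N × Euc k) × ℝ => deriv (fun s => F (q.1, s)) q.2) := by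
  have : (fun q : (Euc N × Euc k) × ℝ => deriv (fun s => F (q.1, s)) q.2) =
      fun q => fderiv ℝ F q (0, 1) := by
    funext q
    have h1 : HasFDerivAt F (fderiv ℝ F q) (q.1, q.2) :=
      (hF.differentiable (by norm_num) q).hasFDerivAt
    have h2 : HasDerivAt (fun s : ℝ => (q.1, s)) (0, 1) q.2 :=
      (hasDerivAt_const _ _).prodMk (hasDerivAt_id _)
    exact (h1.comp_hasDerivAt q.2 h2).deriv
  rw [this]
  exact (hF.continuous_fderiv (by norm_num)).clm_apply continuous_const

lemma weak_prod {N k : ℕ} {u0 : Euc N × Euc k → ℝ} {U f1 f2 : (Euc N × Euc k) × ℝ → ℝ}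
    (S : WS N k u0 U f1 f2) {F : (Euc N × Euc k) × ℝ → ℝ} (hF : ContDiff ℝ 2 F)
    (hFc : HasCompactSupport F)
    (hU : IntegrableOn U (tsupport F ∩ Om N k)) (h1 : IntegrableOn f1 (tsupport F ∩ Om N k))
    (h2 : IntegrableOn f2 (tsupport F ∩ Om N k)) :
    IntegrableOn (fun q => f1 q * F q) (Om N k) ∧ IntegrableOn (fun q => f2 q * F q) (Om N k) ∧
    IntegrableOn (fun q => U q * grushin (fun w => F (w, q.2)) q.1) (Om N k) ∧
    IntegrableOn (fun q => U q * deriv (fun s => F (q.1, s)) q.2) (Om N k) ∧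
    - ∫ z, u0 z * F (z, 0) =
      (∫ q in Om N k, f1 q * F q) + (∫ q in Om N k, f2 q * F q) +
      (∫ q in Om N k, U q * grushin (fun w => F (w, q.2)) q.1) +
      (∫ q in Om N k, U q * deriv (fun s => F (q.1, s)) q.2) := by
  have hFz : ∀ q ∉ tsupport F, F =ᶠ[nhds q] 0 := fun q hq => notMem_tsupport_iff_eventuallyEq.1 hq
  have a1 := integrableOn_mul_cont hFc h1 hF.continuous (fun q hq => (hFz q hq).eq_of_nhds)
  have a2 := integrableOn_mul_cont hFc h2 hF.continuous (fun q hq => (hFz q hq).eq_of_nhds)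
  have a3 := integrableOn_mul_cont hFc hU (continuous_grushin_slice hF) (fun q hq => by
    refine grushin_eq_zero_of_eventually ?_
    have hc : ContinuousAt (fun w : Euc N × Euc k => (w, q.2)) q.1 := by fun_prop
    exact hc.eventually (hFz q hq))
  have a4 := integrableOn_mul_cont hFc hU (continuous_deriv_slice hF) (fun q hq => by
    have hc : ContinuousAt (fun s : ℝ => (q.1, s)) q.2 := by fun_prop
    have : (fun s => F (q.1, s)) =ᶠ[nhds q.2] fun _ => 0 := hc.eventually (hFz q hq)
    rw [this.deriv_eq]; simp)
  refine ⟨a1, a2, a3, a4, ?_⟩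
  rw [S.weak F hF hFc, ← integral_Om a1, ← integral_Om a2, ← integral_Om a3, ← integral_Om a4]


lemma contDiff_prodTest {N k : ℕ} (m : ℕ) (R : ℝ) {θ : ℝ → ℝ} (hθ : ContDiff ℝ 2 θ) :
    ContDiff ℝ 2 (fun q : (Euc N × Euc k) × ℝ => psiR m R q.1 * θ q.2) :=
  ((contDiff_psiR m R).comp contDiff_fst).mul (hθ.comp contDiff_snd)

lemma tsupport_prodTest {N k : ℕ} (m : ℕ) {R : ℝ} (hR : 0 < R) {θ : ℝ → ℝ} {a b : ℝ}
    (h0 : ∀ t, t ∉ Set.Icc a b → θ t = 0) :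
    tsupport (fun q : (Euc N × Euc k) × ℝ => psiR m R q.1 * θ q.2) ⊆
      {z | gR R z ≤ 1} ×ˢ Set.Icc a b := by
  refine closure_minimal ?_ ((isCompact_gR hR).isClosed.prod isClosed_Icc)
  intro q hq
  rw [Function.mem_support] at hq
  constructor
  · by_contra hcon
    exact hq (by rw [psiR_eq_zero m (not_le.1 hcon).le, zero_mul])
  · by_contra hcon
    exact hq (by rw [h0 _ hcon, mul_zero])

lemma hasCompactSupport_prodTest {N k : ℕ} (m : ℕ) {R : ℝ} (hR : 0 < R) {θ : ℝ → ℝ} {a b : ℝ}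
    (h0 : ∀ t, t ∉ Set.Icc a b → θ t = 0) :
    HasCompactSupport (fun q : (Euc N × Euc k) × ℝ => psiR m R q.1 * θ q.2) :=
  IsCompact.of_isClosed_subset ((isCompact_gR hR).prod isCompact_Icc) (isClosed_tsupport _)
    (tsupport_prodTest m hR h0)

lemma young_aux {p C : ℝ} (hp : 1 < p) (hC : 0 ≤ C) :
    ∃ C', 0 ≤ C' ∧ ∀ X : ℝ, 0 ≤ X → C * X ≤ 1 / 2 * X ^ p + C' := by
  refine ⟨C * (2 * C) ^ (1 / (p - 1)), by positivity, fun X hX => ?_⟩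
  rcases le_total X ((2 * C) ^ (1 / (p - 1))) with h | h
  · have : 0 ≤ X ^ p := Real.rpow_nonneg hX p
    have := mul_le_mul_of_nonneg_left h hC
    linarith
  · have h1 : 2 * C ≤ X ^ (p - 1) := by
      have := Real.rpow_le_rpow (by positivity) h (show 0 ≤ p - 1 by linarith)
      rwa [← Real.rpow_mul (by positivity), one_div_mul_cancel (by linarith), Real.rpow_one] at this
    have h2 : X ^ p = X ^ (p - 1) * X := by
      rcases hX.eq_or_lt with h | h
      · subst h; rw [Real.zero_rpow (by linarith), mul_zero]
      · rw [Real.rpow_sub_one h.ne']; field_simp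
    have h3 := mul_le_mul_of_nonneg_right h1 hX
    have : 0 ≤ C * (2 * C) ^ (1 / (p - 1)) := by positivity
    rw [h2]; nlinarith

lemma young_K {p C : ℝ} (hp : 1 < p) (hC : 0 ≤ C) {a b : ℕ} (hab : (b : ℝ) ≤ a * p) (ha : 0 < a) :
    ∃ C', 0 ≤ C' ∧ ∀ X K : ℝ, 0 ≤ X → 0 ≤ K → K ≤ 1 →
      C * (X * K ^ a) ≤ 1 / 2 * (X ^ p * K ^ b) + C' := by
  obtain ⟨C', h0, h⟩ := young_aux hp hC
  refine ⟨C', h0, fun X K hX hK hK1 => ?_⟩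
  refine (h (X * K ^ a) (by positivity)).trans ?_
  gcongr
  rw [Real.mul_rpow hX (by positivity)]
  gcongr
  rw [← Real.rpow_natCast, ← Real.rpow_mul hK, ← Real.rpow_natCast K b]
  rcases hK.eq_or_lt with h' | h'
  · rw [← h', Real.zero_rpow (by positivity)]
    positivity
  · exact Real.rpow_le_rpow_of_exponent_ge h' hK1 hab

def thE (m : ℕ) (T ε t : ℝ) : ℝ := hh m (t / T) * (1 - hh m (t / (2 * ε)))
def thE' (m : ℕ) (T ε t : ℝ) : ℝ := hh1 m (t / T) / T * (1 - hh m (t / (2 * ε))) +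
    hh m (t / T) * (- (hh1 m (t / (2 * ε)) / (2 * ε)))

lemma hasDerivAt_hh_div (m : ℕ) (T t : ℝ) :
    HasDerivAt (fun t => hh m (t / T)) (hh1 m (t / T) / T) t := by
  have := (hasDerivAt_hh m (t / T)).comp t ((hasDerivAt_id t).div_const T)
  rw [one_div, ← div_eq_mul_inv] at this
  exact this

lemma contDiff_hh_div (m : ℕ) (T : ℝ) : ContDiff ℝ 2 (fun t => hh m (t / T)) :=
  (contDiff_hh m).comp (contDiff_id.div_const T)

lemma contDiff_thE (m : ℕ) (T ε : ℝ) : ContDiff ℝ 2 (thE m T ε) :=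
  (contDiff_hh_div m T).mul (contDiff_const.sub (contDiff_hh_div m (2 * ε)))

lemma hasDerivAt_thE (m : ℕ) (T ε t : ℝ) : HasDerivAt (thE m T ε) (thE' m T ε t) t := by
  exact (hasDerivAt_hh_div m T t).mul ((hasDerivAt_hh_div m (2 * ε) t).const_sub 1)

lemma thE_zero (m : ℕ) {T ε t : ℝ} (hT : 0 < T) (hε : 0 < ε) (ht : t ∉ Set.Icc ε T) :
    thE m T ε t = 0 := by
  unfold thE
  rw [Set.mem_Icc, not_and_or, not_le, not_le] at ht
  rcases ht with ht | ht
  · rw [hh_eq_one m (s := t / (2 * ε))]; · simp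
    rw [div_le_iff₀ (by positivity)]; linarith
  · rw [hh_eq_zero m (s := t / T)]; · simp
    rw [le_div_iff₀ (by positivity)]; linarith

lemma thE_one (m : ℕ) {T ε t : ℝ} (hT : 0 < T) (hε : 0 < ε) (h1 : 2 * ε ≤ t) (h2 : t ≤ T / 2) :
    thE m T ε t = 1 := by
  unfold thE
  rw [hh_eq_one m (s := t / T), hh_eq_zero m (s := t / (2 * ε))]; · simp
  · rw [le_div_iff₀ (by positivity)]; linarith
  · rw [div_le_iff₀ (by positivity)]; linarith

lemma step0 {N k : ℕ} {u0 : Euc N × Euc k → ℝ} {U f1 f2 : (Euc N × Euc k) × ℝ → ℝ}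
    (S : WS N k u0 U f1 f2) {p2 : ℝ} (hp2 : 1 < p2) (hf2 : ∀ q, f2 q = U q ^ p2)
    {R T : ℝ} (hR : 0 < R) (hT : 0 < T) :
    IntegrableOn f1 ({z | gR R z ≤ 1 / 2} ×ˢ Set.Ioc 0 (T / 2)) ∧
    IntegrableOn f2 ({z | gR R z ≤ 1 / 2} ×ˢ Set.Ioc 0 (T / 2)) := by
  obtain ⟨m, hm⟩ : ∃ m : ℕ, ((m + 3 : ℕ) : ℝ) ≤ ((m + 1 : ℕ) : ℝ) * p2 := by
    obtain ⟨m, hm⟩ := exists_nat_ge (2 / (p2 - 1))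
    refine ⟨m, ?_⟩
    rw [div_le_iff₀ (by linarith)] at hm
    push_cast; nlinarith
  set A := CL N k m / R ^ 2 with hA
  have hA0 : 0 ≤ A := div_nonneg (CL_nonneg _ _ _) (by positivity)
  set B := 100 * ((m : ℝ) + 3) ^ 2 / T with hB
  have hB0 : 0 ≤ B := by positivity
  obtain ⟨C', hC'0, hC'⟩ := young_K hp2 (add_nonneg hA0 hB0) hm (by omega)
  set D : Set ((Euc N × Euc k) × ℝ) := {z | gR R z ≤ 1} ×ˢ Set.Icc 0 T with hD
  have hDc : IsCompact D := (isCompact_gR hR).prod isCompact_Icc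
  have hDm : MeasurableSet D := hDc.measurableSet
  -- main bound
  have main : ∀ ε : ℝ, 0 < ε →
      IntegrableOn (fun q => f1 q * (psiR m R q.1 * thE m T ε q.2)) (Om N k) ∧
      IntegrableOn (fun q => f2 q * (psiR m R q.1 * thE m T ε q.2)) (Om N k) ∧
      (∫ q in Om N k, f1 q * (psiR m R q.1 * thE m T ε q.2)) ≤ C' * volume.real D ∧
      (∫ q in Om N k, f2 q * (psiR m R q.1 * thE m T ε q.2)) ≤ 2 * (C' * volume.real D) := by
    intro ε hε
    have hts : tsupport (fun q : (Euc N × Euc k) × ℝ => psiR m R q.1 * thE m T ε q.2) ⊆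
      {z | gR R z ≤ 1} ×ˢ Set.Icc ε T := tsupport_prodTest m hR (fun t ht => thE_zero m hT hε ht)
    have hcs := hasCompactSupport_prodTest (N := N) (k := k) m hR (fun t ht => thE_zero m hT hε ht)
    have hsub : {z : Euc N × Euc k | gR R z ≤ 1} ×ˢ Set.Icc ε T ⊆ Om N k := by
      rintro q ⟨_, hq⟩; exact mem_Om.2 (lt_of_lt_of_le hε hq.1)
    have hcK : IsCompact ({z : Euc N × Euc k | gR R z ≤ 1} ×ˢ Set.Icc ε T) :=
      (isCompact_gR hR).prod isCompact_Icc
    have loc : ∀ f : (Euc N × Euc k) × ℝ → ℝ, LocallyIntegrableOn f (Om N k) →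
        IntegrableOn f (tsupport (fun q : (Euc N × Euc k) × ℝ => psiR m R q.1 * thE m T ε q.2) ∩ Om N k) := by
      intro f hf
      exact (hf.integrableOn_compact_subset hsub hcK).mono_set (Set.inter_subset_left.trans hts)
    obtain ⟨a1, a2, a3, a4, e⟩ := weak_prod S (contDiff_prodTest m R (contDiff_thE m T ε)) hcs
      (loc _ S.iU) (loc _ S.i1) (loc _ S.i2)
    have hg : ∀ q : (Euc N × Euc k) × ℝ,
        grushin (fun w => psiR m R w * thE m T ε q.2) q.1 = grushin (psiR m R) q.1 * thE m T ε q.2 :=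
      fun q => grushin_mul_const (contDiff_psiR m R) _ _
    have hd : ∀ q : (Euc N × Euc k) × ℝ,
        deriv (fun s => psiR m R q.1 * thE m T ε s) q.2 = psiR m R q.1 * thE' m T ε q.2 :=
      fun q => ((hasDerivAt_thE m T ε q.2).const_mul _).deriv
    simp only [hg, hd] at a3 a4 e
    have ez : ∀ z : Euc N × Euc k, u0 z * (psiR m R z * thE m T ε 0) = 0 := by
      intro z
      rw [thE_zero m hT hε (fun h => absurd h.1 (not_le.2 hε))]; ring
    simp only [ez, integral_zero, neg_zero] at e
    have hpos : ∀ q : (Euc N × Euc k) × ℝ, 0 ≤ psiR m R q.1 * thE m T ε q.2 := fun q =>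
      mul_nonneg (hh_nonneg _ _) (mul_nonneg (hh_nonneg _ _) (sub_nonneg.2 (hh_le_one _ _)))
    have n1 : 0 ≤ ∫ q in Om N k, f1 q * (psiR m R q.1 * thE m T ε q.2) :=
      setIntegral_nonneg (measurableSet_Om N k) fun q hq => mul_nonneg (S.h1 q (mem_Om.1 hq)) (hpos q)
    have n2 : 0 ≤ ∫ q in Om N k, f2 q * (psiR m R q.1 * thE m T ε q.2) :=
      setIntegral_nonneg (measurableSet_Om N k) fun q hq => mul_nonneg (S.h2 q (mem_Om.1 hq)) (hpos q)
    have iD : IntegrableOn (D.indicator fun _ => C') (Om N k) := by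
      refine Integrable.mono_measure ?_ Measure.restrict_le_self
      rw [integrable_indicator_iff hDm]
      exact integrableOn_const hDc.measure_lt_top.ne
    have vD : ∫ q in Om N k, D.indicator (fun _ => C') q ≤ C' * volume.real D := by
      have hi : Integrable (D.indicator fun _ => C') (volume : Measure ((Euc N × Euc k) × ℝ)) := by
        rw [integrable_indicator_iff hDm]
        exact integrableOn_const hDc.measure_lt_top.ne
      refine (setIntegral_le_integral hi (Eventually.of_forall fun q => Set.indicator_nonneg (fun _ _ => hC'0) q)).trans ?_
      rw [integral_indicator hDm, setIntegral_const, smul_eq_mul, mul_comm]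
    have key : (∫ q in Om N k, (-(U q * (grushin (psiR m R) q.1 * thE m T ε q.2)) -
         U q * (psiR m R q.1 * thE' m T ε q.2))) ≤
        ∫ q in Om N k, (1 / 2 * (f2 q * (psiR m R q.1 * thE m T ε q.2)) + D.indicator (fun _ => C') q) := by
      refine setIntegral_mono_on (a3.neg.sub a4) ((a2.const_mul _).add iD) (measurableSet_Om N k) ?_
      intro q hq
      have hq0 := mem_Om.1 hq
      have hU := S.hU q hq0
      by_cases hqD : q ∈ D
      · rw [Set.indicator_of_mem hqD]
        set k1 := kk (gR R q.1)
        set k2 := kk (q.2 / T)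
        set e := 1 - hh m (q.2 / (2 * ε)) with he
        have he0 : 0 ≤ e := sub_nonneg.2 (hh_le_one _ _)
        have he1 : e ≤ 1 := by have := hh_nonneg m (q.2 / (2 * ε)); linarith
        have k10 : 0 ≤ k1 := kk_nonneg _
        have k20 : 0 ≤ k2 := kk_nonneg _
        have k11 : k1 ≤ 1 := kk_le_one _
        have k21 : k2 ≤ 1 := kk_le_one _
        have g1 : -(grushin (psiR m R) q.1 * thE m T ε q.2) ≤ A * (k1 * k2) ^ (m + 1) * e := by
          have hb := (neg_le_abs _).trans (abs_grushin_psiR_le m hR q.1)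
          have ht : thE m T ε q.2 = k2 ^ (m + 3) * e := rfl
          rw [ht, mul_pow, ← neg_mul]
          have : k2 ^ (m + 3) ≤ k2 ^ (m + 1) := pow_le_pow_of_le_one k20 k21 (by omega)
          calc -grushin (psiR m R) q.1 * (k2 ^ (m + 3) * e) ≤ (A * k1 ^ (m + 1)) * (k2 ^ (m + 3) * e) := by
                gcongr
            _ ≤ (A * k1 ^ (m + 1)) * (k2 ^ (m + 1) * e) := by gcongr
            _ = _ := by ring
        have g2 : -(psiR m R q.1 * thE' m T ε q.2) ≤ B * (k1 * k2) ^ (m + 1) * e := by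
          have h1 : -thE' m T ε q.2 ≤ B * k2 ^ (m + 1) * e := by
            unfold thE'
            have x1 : -(hh1 m (q.2 / T) / T) ≤ B * k2 ^ (m + 1) := by
              have := (neg_le_abs _).trans (abs_hh1_le m (q.2 / T))
              rw [hB, ← neg_div, div_mul_eq_mul_div]
              gcongr
            have x2 := mul_le_mul_of_nonneg_right x1 he0
            have x3 : 0 ≤ hh m (q.2 / T) * (- (hh1 m (q.2 / (2 * ε)) / (2 * ε))) := by
              refine mul_nonneg (hh_nonneg _ _) ?_
              rw [← neg_div]
              exact div_nonneg (neg_nonneg.2 (hh1_nonpos _ _)) (by positivity)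
            linarith
          have h2 : psiR m R q.1 = k1 ^ (m + 3) := rfl
          have h3 : k1 ^ (m + 3) ≤ k1 ^ (m + 1) := pow_le_pow_of_le_one k10 k11 (by omega)
          rw [h2, ← mul_neg, mul_pow]
          calc k1 ^ (m + 3) * -thE' m T ε q.2 ≤ k1 ^ (m + 3) * (B * k2 ^ (m + 1) * e) := by gcongr
            _ ≤ k1 ^ (m + 1) * (B * k2 ^ (m + 1) * e) := by gcongr
            _ = _ := by ring
        have y := hC' (U q) (k1 * k2) hU (by positivity) (mul_le_one₀ k11 k20 k21)
        have hF : psiR m R q.1 * thE m T ε q.2 = (k1 * k2) ^ (m + 3) * e := by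
          have : psiR m R q.1 * thE m T ε q.2 = k1 ^ (m + 3) * (k2 ^ (m + 3) * e) := rfl
          rw [this]; ring
        rw [hF, hf2]
        have y2 := mul_le_mul_of_nonneg_right y he0
        have y3 := mul_le_mul_of_nonneg_left (add_le_add g1 g2) hU
        have y4 : C' * e ≤ C' := mul_le_of_le_one_right hC'0 he1
        nlinarith
      · rw [Set.indicator_of_notMem hqD]
        have : (psiR m R q.1 = 0 ∧ grushin (psiR m R) q.1 = 0) ∨ (thE m T ε q.2 = 0 ∧ thE' m T ε q.2 = 0) := by
          have : ¬ (gR R q.1 ≤ 1) ∨ ¬ (q.2 ≤ T) := by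
            by_contra hcon
            push Not at hcon
            exact hqD ⟨hcon.1, hq0.le, hcon.2⟩
          rcases this with h | h
          · left
            have h' := (not_le.1 h).le
            refine ⟨psiR_eq_zero m h', ?_⟩
            have := abs_grushin_psiR_le m hR q.1
            rw [kk_eq_zero h'] at this
            simpa using this
          · right
            have h' : 1 ≤ q.2 / T := by rw [le_div_iff₀ hT]; linarith
            have h2 := abs_hh1_le m (q.2 / T)
            rw [kk_eq_zero h'] at h2
            have h3 : hh1 m (q.2 / T) = 0 := by simpa using h2
            constructor
            · simp [thE, hh_eq_zero m h']
            · simp [thE', hh_eq_zero m h', h3]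
        rcases this with ⟨h, h'⟩ | ⟨h, h'⟩ <;> simp [h, h']
    have a3n : IntegrableOn (fun q => -(U q * (grushin (psiR m R) q.1 * thE m T ε q.2))) (Om N k) := a3.neg
    rw [integral_sub a3n a4, integral_add (a2.const_mul _) iD, integral_neg, integral_const_mul] at key
    refine ⟨a1, a2, ?_, ?_⟩ <;> linarith
  set D0 : Set ((Euc N × Euc k) × ℝ) := {z | gR R z ≤ 1 / 2} ×ˢ Set.Ioc 0 (T / 2) with hD0
  have hD0m : MeasurableSet D0 := by
    refine MeasurableSet.prod ?_ measurableSet_Ioc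
    exact (isClosed_le (contDiff_gR R).continuous continuous_const).measurableSet
  have hD0s : D0 ⊆ Om N k := fun q hq => mem_Om.2 hq.2.1
  have cov : AECover (volume.restrict D0) atTop (fun n : ℕ => {q : (Euc N × Euc k) × ℝ | 1 / ((n : ℝ) + 1) ≤ q.2}) := by
    refine ⟨?_, fun n => ?_⟩
    · filter_upwards [ae_restrict_mem hD0m] with q hq
      have := tendsto_one_div_add_atTop_nhds_zero_nat (𝕜 := ℝ)
      filter_upwards [this.eventually (gt_mem_nhds (hD0s hq).2)] with n hn
      exact hn.le
    · exact measurableSet_le measurable_const measurable_snd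
  have fin : ∀ (f : (Euc N × Euc k) × ℝ → ℝ) (C : ℝ), (∀ q, 0 < q.2 → 0 ≤ f q) →
      (∀ ε : ℝ, 0 < ε → IntegrableOn (fun q => f q * (psiR m R q.1 * thE m T ε q.2)) (Om N k) ∧
       (∫ q in Om N k, f q * (psiR m R q.1 * thE m T ε q.2)) ≤ C) → IntegrableOn f D0 := by
    intro f C hf h
    have hcong : ∀ n : ℕ, ∀ q ∈ {q : (Euc N × Euc k) × ℝ | 1 / ((n : ℝ) + 1) ≤ q.2} ∩ D0,
        f q * (psiR m R q.1 * thE m T (1 / ((n : ℝ) + 1) / 2) q.2) = f q := by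
      intro n q hq
      have : psiR m R q.1 = 1 := hh_eq_one m hq.2.1
      rw [this, thE_one m hT (by positivity) _ hq.2.2.2]
      · ring
      · have := hq.1; simp only [Set.mem_ofPred_eq] at this; linarith
    have hmm : ∀ n : ℕ, MeasurableSet {q : (Euc N × Euc k) × ℝ | 1 / ((n : ℝ) + 1) ≤ q.2} :=
      fun n => measurableSet_le measurable_const measurable_snd
    refine cov.integrable_of_integral_bounded_of_nonneg_ae C ?_ ?_ ?_
    · intro n
      rw [IntegrableOn, Measure.restrict_restrict (hmm n)]
      refine IntegrableOn.congr_fun ?_ (hcong n) ((hmm n).inter hD0m)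
      exact (h _ (by positivity)).1.mono_set (Set.inter_subset_right.trans hD0s)
    · filter_upwards [ae_restrict_mem hD0m] with q hq
      exact hf q hq.2.1
    · refine Eventually.of_forall fun n => ?_
      rw [Measure.restrict_restrict (hmm n), ← setIntegral_congr_fun ((hmm n).inter hD0m) (hcong n)]
      have hh' := h (1 / ((n : ℝ) + 1) / 2) (by positivity)
      refine (setIntegral_mono_set hh'.1 ?_ (Set.inter_subset_right.trans hD0s).eventuallyLE).trans hh'.2
      filter_upwards [ae_restrict_mem (measurableSet_Om N k)] with q hq
      exact mul_nonneg (hf q (mem_Om.1 hq)) (mul_nonneg (hh_nonneg _ _) (mul_nonneg (hh_nonneg _ _) (sub_nonneg.2 (hh_le_one _ _))))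
  exact ⟨fin f1 _ S.h1 fun ε hε => ⟨(main ε hε).1, (main ε hε).2.2.1⟩,
    fin f2 _ S.h2 fun ε hε => ⟨(main ε hε).2.1, (main ε hε).2.2.2⟩⟩

lemma int_up {N k : ℕ} {u0 : Euc N × Euc k → ℝ} {U f1 f2 : (Euc N × Euc k) × ℝ → ℝ}
    (S : WS N k u0 U f1 f2) {p2 : ℝ} (hp2 : 1 < p2) (hf2 : ∀ q, f2 q = U q ^ p2)
    {K : Set ((Euc N × Euc k) × ℝ)} (hK : Bornology.IsBounded K) :
    IntegrableOn U (K ∩ Om N k) ∧ IntegrableOn f1 (K ∩ Om N k) ∧ IntegrableOn f2 (K ∩ Om N k) := by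
  obtain ⟨B, hB⟩ := hK.subset_closedBall 0
  set R := 2 * (|B| ^ 4 + |B| ^ 2) + 1 with hR
  have hR1 : 1 ≤ R := by have : 0 ≤ |B| ^ 4 + |B| ^ 2 := by positivity
                         linarith
  set T := 2 * (|B| + 1) with hT
  have hT0 : 0 < T := by positivity
  set D0 : Set ((Euc N × Euc k) × ℝ) := {z | gR R z ≤ 1 / 2} ×ˢ Set.Ioc 0 (T / 2) with hD0
  have hsub : K ∩ Om N k ⊆ D0 := by
    rintro q ⟨hq, hq0⟩
    have h1 := hB hq
    rw [mem_closedBall_zero_iff] at h1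
    have h2 : ‖q‖ ≤ |B| := h1.trans (le_abs_self _)
    have hx : ‖q.1.1‖ ≤ |B| := (norm_fst_le q.1).trans ((norm_fst_le q).trans h2)
    have hy : ‖q.1.2‖ ≤ |B| := (norm_snd_le q.1).trans ((norm_fst_le q).trans h2)
    have ht : q.2 ≤ |B| := (le_abs_self _).trans ((norm_snd_le q).trans h2)
    refine ⟨?_, mem_Om.1 hq0, by rw [hT]; linarith⟩
    simp only [Set.mem_ofPred_eq, gR]
    rw [div_le_iff₀ (by positivity)]
    have : ‖q.1.1‖ ^ 4 + ‖q.1.2‖ ^ 2 ≤ |B| ^ 4 + |B| ^ 2 := by gcongr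
    have : R ≤ R ^ 4 := le_self_pow₀ hR1 (by norm_num)
    linarith
  obtain ⟨h1, h2⟩ := step0 S hp2 hf2 (by linarith) hT0 (R := R)
  refine ⟨?_, h1.mono_set hsub, h2.mono_set hsub⟩
  have hD0m : MeasurableSet D0 := by
    refine MeasurableSet.prod ?_ measurableSet_Ioc
    exact (isClosed_le (contDiff_gR R).continuous continuous_const).measurableSet
  have hD0s : D0 ⊆ Om N k := fun q hq => mem_Om.2 hq.2.1
  have hvol : volume D0 ≠ ⊤ := by
    refine ne_top_of_le_ne_top (b := volume (({z : Euc N × Euc k | gR R z ≤ 1} ×ˢ Set.Icc 0 (T / 2)))) ?_ (measure_mono ?_)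
    · exact ((isCompact_gR (by linarith)).prod isCompact_Icc).measure_lt_top.ne
    · rintro q ⟨h, h'⟩
      exact ⟨le_trans (b := (1 / 2 : ℝ)) h (by norm_num), Set.Ioc_subset_Icc_self h'⟩
  have : IntegrableOn U D0 := by
    have hc : IntegrableOn (fun _ : (Euc N × Euc k) × ℝ => (1:ℝ)) D0 := integrableOn_const hvol
    refine Integrable.mono' (Integrable.add hc h2) ?_ ?_
    · exact S.iU.aestronglyMeasurable.mono_measure (Measure.restrict_mono_set _ hD0s)
    · filter_upwards [ae_restrict_mem hD0m] with q hq
      have h0 := S.hU q (mem_Om.1 (hD0s hq))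
      rw [Real.norm_of_nonneg h0]
      simp only [Pi.add_apply]
      rw [hf2]
      rcases le_total (U q) 1 with h1 | h1
      · have := Real.rpow_nonneg h0 p2; linarith
      · have := Real.self_le_rpow_of_one_le h1 hp2.le; linarith
  exact this.mono_set hsub

lemma weak_full {N k : ℕ} {u0 : Euc N × Euc k → ℝ} {U f1 f2 : (Euc N × Euc k) × ℝ → ℝ}
    (S : WS N k u0 U f1 f2) {p2 : ℝ} (hp2 : 1 < p2) (hf2 : ∀ q, f2 q = U q ^ p2)
    {F : (Euc N × Euc k) × ℝ → ℝ} (hF : ContDiff ℝ 2 F) (hFc : HasCompactSupport F) :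
    IntegrableOn (fun q => f1 q * F q) (Om N k) ∧ IntegrableOn (fun q => f2 q * F q) (Om N k) ∧
    IntegrableOn (fun q => U q * grushin (fun w => F (w, q.2)) q.1) (Om N k) ∧
    IntegrableOn (fun q => U q * deriv (fun s => F (q.1, s)) q.2) (Om N k) ∧
    - ∫ z, u0 z * F (z, 0) =
      (∫ q in Om N k, f1 q * F q) + (∫ q in Om N k, f2 q * F q) +
      (∫ q in Om N k, U q * grushin (fun w => F (w, q.2)) q.1) +
      (∫ q in Om N k, U q * deriv (fun s => F (q.1, s)) q.2) := by
  obtain ⟨a, b, c⟩ := int_up S hp2 hf2 hFc.isBounded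
  exact weak_prod S hF hFc a b c


section avg
variable {G : Type*} [NormedAddCommGroup G] [NormedSpace ℝ G] [FiniteDimensional ℝ G]
  [MeasurableSpace G] [BorelSpace G] (μ : Measure G) [μ.IsAddHaarMeasure]

lemma transl_cont {V : G → ℝ} (hV : Integrable V μ) {η : ℝ≥0∞} (hη : 0 < η) :
    ∃ δ : ℝ, 0 < δ ∧ ∀ v : G, ‖v‖ ≤ δ → ∫⁻ q, ‖V (v + q) - V q‖ₑ ∂μ ≤ η := by
  have hL : MemLp V 1 μ := memLp_one_iff_integrable.2 hV
  set L := hL.toLp V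
  haveI : Fact ((1 : ℝ≥0∞) ≠ ∞) := ⟨ENNReal.one_ne_top⟩
  have hc : Continuous (fun v : G => (DomAddAct.mk v : Gᵈᵃᵃ) +ᵥ L) := by
    have h1 : Continuous (fun v : G => (DomAddAct.mk v : Gᵈᵃᵃ)) := DomAddAct.continuous_mk
    exact h1.vadd continuous_const
  have ht : Tendsto (fun v : G => edist ((DomAddAct.mk v : Gᵈᵃᵃ) +ᵥ L) L) (nhds 0) (nhds 0) := by
    have h2 : Tendsto (fun v : G => edist ((DomAddAct.mk v : Gᵈᵃᵃ) +ᵥ L) L) (nhds 0)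
      (nhds (edist ((DomAddAct.mk (0 : G) : Gᵈᵃᵃ) +ᵥ L) L)) :=
      (hc.edist continuous_const).tendsto 0
    have h3 : (DomAddAct.mk (0 : G) : Gᵈᵃᵃ) +ᵥ L = L := by
      rw [DomAddAct.mk_zero]; exact zero_vadd _ _
    rwa [h3, edist_self] at h2
  have := ht.eventually (ge_mem_nhds hη)
  obtain ⟨δ, hδ, h⟩ := Metric.eventually_nhds_iff.1 this
  refine ⟨δ / 2, by positivity, fun v hv => ?_⟩
  have h4 := h (y := v) (by rw [dist_zero_right]; linarith)
  rw [DomAddAct.mk_vadd_toLp, Lp.edist_toLp_toLp, eLpNorm_one_eq_lintegral_enorm] at h4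
  exact h4

lemma avg_lim {V : G → ℝ} (hV : Integrable V μ) (hm : Measurable V) (hV0 : ∀ q, 0 ≤ V q)
    {P : ℕ → Set G} (hPm : ∀ n, MeasurableSet (P n)) (hP0 : ∀ n, μ (P n) ≠ 0)
    (hPt : ∀ n, μ (P n) ≠ ⊤) {δ : ℕ → ℝ} (hδ : Tendsto δ atTop (nhds 0))
    (hP : ∀ n, ∀ v ∈ P n, ‖v‖ ≤ δ n) {W : G → ℝ≥0∞} {A : Set G}
    (h : ∀ q ∈ A, ∀ᶠ n in atTop, ∫⁻ v in P n, ENNReal.ofReal (V (v + q)) ∂μ ≤ μ (P n) * W q) :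
    ∀ᵐ q ∂μ, q ∈ A → ENNReal.ofReal (V q) ≤ W q := by
  set g : ℕ → G → ℝ≥0∞ := fun n q => (μ (P n))⁻¹ * ∫⁻ v in P n, ‖V (v + q) - V q‖ₑ ∂μ with hg
  have hmm : Measurable (fun x : G × G => ‖V (x.2 + x.1) - V x.1‖ₑ) :=
    ((hm.comp (measurable_snd.add measurable_fst)).sub (hm.comp measurable_fst)).enorm
  have gm : ∀ n, Measurable (g n) := fun n =>
    Measurable.const_mul (Measurable.lintegral_prod_right' hmm) _
  have glim : Tendsto (fun n => ∫⁻ q, g n q ∂μ) atTop (nhds 0) := by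
    rw [ENNReal.tendsto_nhds_zero]
    intro η hη
    obtain ⟨d, hd, hd2⟩ := transl_cont μ hV hη
    filter_upwards [hδ.eventually (ge_mem_nhds hd)] with n hn
    simp only [hg]
    rw [lintegral_const_mul _ (Measurable.lintegral_prod_right' hmm),
      lintegral_lintegral_swap hmm.aemeasurable]
    calc (μ (P n))⁻¹ * ∫⁻ v in P n, ∫⁻ q, ‖V (v + q) - V q‖ₑ ∂μ ∂μ
        ≤ (μ (P n))⁻¹ * ∫⁻ v in P n, η ∂μ := by
          refine mul_le_mul_right (α := ℝ≥0∞) ?_ _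
          refine setLIntegral_mono' (hPm n) fun v hv => hd2 v ((hP n v hv).trans hn)
      _ = η := by
          rw [setLIntegral_const, mul_comm η, ← mul_assoc, ENNReal.inv_mul_cancel (hP0 n) (hPt n), one_mul]
  have hf : ∫⁻ q, liminf (fun n => g n q) atTop ∂μ = 0 := by
    refine le_antisymm ((lintegral_liminf_le gm).trans ?_) zero_le
    rw [glim.liminf_eq]
  rw [lintegral_eq_zero_iff (Measurable.liminf gm)] at hf
  filter_upwards [hf] with q hq hA
  by_contra hcon
  push Not at hcon
  have h1 : ∀ᶠ n in atTop, ENNReal.ofReal (V q) - W q ≤ g n q := by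
    filter_upwards [h q hA] with n hn
    rw [tsub_le_iff_right]
    have h2 : μ (P n) * ENNReal.ofReal (V q) ≤ (∫⁻ v in P n, ‖V (v + q) - V q‖ₑ ∂μ) + μ (P n) * W q := by
      calc μ (P n) * ENNReal.ofReal (V q) = ∫⁻ v in P n, ENNReal.ofReal (V q) ∂μ := by
            rw [setLIntegral_const, mul_comm]
        _ ≤ ∫⁻ v in P n, (‖V (v + q) - V q‖ₑ + ENNReal.ofReal (V (v + q))) ∂μ := by
            refine lintegral_mono fun v => ?_
            rw [Real.enorm_eq_ofReal_abs, ← ENNReal.ofReal_add (abs_nonneg _) (hV0 _)]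
            refine ENNReal.ofReal_le_ofReal ?_
            have := neg_le_abs (V (v + q) - V q)
            linarith
        _ = (∫⁻ v in P n, ‖V (v + q) - V q‖ₑ ∂μ) + ∫⁻ v in P n, ENNReal.ofReal (V (v + q)) ∂μ := by
            refine lintegral_add_right _ ?_
            exact (hm.comp (measurable_id.add_const q)).ennreal_ofReal
        _ ≤ _ := by gcongr
    have h3 : ENNReal.ofReal (V q) = (μ (P n))⁻¹ * (μ (P n) * ENNReal.ofReal (V q)) := by
      rw [← mul_assoc, ENNReal.inv_mul_cancel (hP0 n) (hPt n), one_mul]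
    rw [h3]
    refine (mul_le_mul_right h2 _).trans ?_
    rw [mul_add, ← mul_assoc _ _ (W q), ENNReal.inv_mul_cancel (hP0 n) (hPt n), one_mul]
  have h2 := le_liminf_of_le (by isBoundedDefault) h1
  have hq' : liminf (fun n => g n q) atTop = 0 := hq
  rw [hq', nonpos_iff_eq_zero, tsub_eq_zero_iff_le] at h2
  exact absurd h2 (not_le.2 hcon)
end avg


/-! parametrix -/
def aa {N k : ℕ} (z0 w : Euc N × Euc k) : ℝ := inner ℝ z0.1 w.1
def hsq {N k : ℕ} (z0 w : Euc N × Euc k) : ℝ := ‖w.1 - z0.1‖ ^ 2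
def esq {N k : ℕ} (z0 w : Euc N × Euc k) : ℝ := ‖w.2 - z0.2‖ ^ 2
def EE {N k : ℕ} (z0 : Euc N × Euc k) (τ : ℝ) (w : Euc N × Euc k) : ℝ :=
  -(((N : ℝ) + k) / 2) * Real.log τ + (-((k : ℝ) / 2)) * Real.log (aa z0 w)
    + (-1 / (4 * τ)) * hsq z0 w + (-1 / (4 * τ)) * (esq z0 w * (aa z0 w)⁻¹)
def chi {N k : ℕ} (z0 w : Euc N × Euc k) : ℝ :=
  hh 0 (4 / ‖z0.1‖ ^ 2 * (hsq z0 w + esq z0 w))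
def par {N k : ℕ} (z0 : Euc N × Euc k) (τ : ℝ) (w : Euc N × Euc k) : ℝ :=
  Real.exp (EE z0 τ w) * chi z0 w

def bet {N k : ℕ} (z0 : Euc N × Euc k) (τ : ℝ) (w : Euc N × Euc k) : ℝ :=
  -(k : ℝ) / (2 * aa z0 w) + esq z0 w / (4 * τ * aa z0 w ^ 2)

lemma jetx (k : ℕ) {c1 a x τ H h η c : ℝ} (ha : a ≠ 0) (hτ : τ ≠ 0) :
    Jet (fun s => Real.exp (c1 + (-((k : ℝ) / 2)) * Real.log (a + x * s + 0 * s ^ 2)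
      + (-1 / (4 * τ)) * (H + 2 * h * s + 1 * s ^ 2)
      + (-1 / (4 * τ)) * (η * (a + x * s + 0 * s ^ 2)⁻¹)) *
       hh 0 (c * ((H + 2 * h * s + 1 * s ^ 2) + η)))
    (Real.exp (c1 + (-((k : ℝ) / 2)) * Real.log a + (-1 / (4 * τ)) * H + (-1 / (4 * τ)) * (η * a⁻¹)) *
      ((x * (-(k : ℝ) / (2 * a) + η / (4 * τ * a ^ 2)) - h / (2 * τ)) * hh 0 (c * (H + η)) +
        hh1 0 (c * (H + η)) * (2 * c * h)))
    (Real.exp (c1 + (-((k : ℝ) / 2)) * Real.log a + (-1 / (4 * τ)) * H + (-1 / (4 * τ)) * (η * a⁻¹)) *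
      (((k : ℝ) / 2 * x ^ 2 / a ^ 2 - 1 / (2 * τ) - η * x ^ 2 / (2 * τ * a ^ 3) +
        (x * (-(k : ℝ) / (2 * a) + η / (4 * τ * a ^ 2)) - h / (2 * τ)) ^ 2) * hh 0 (c * (H + η)) +
        2 * (x * (-(k : ℝ) / (2 * a) + η / (4 * τ * a ^ 2)) - h / (2 * τ)) *
        (hh1 0 (c * (H + η)) * (2 * c * h)) +
        (hh2 0 (c * (H + η)) * (2 * c * h) ^ 2 + hh1 0 (c * (H + η)) * (2 * c)))) := by
  have qa := Jet.quad a x 0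
  have qh := Jet.quad H (2 * h) 1
  have a0 : (fun s : ℝ => a + x * s + 0 * s ^ 2) 0 ≠ 0 := by simpa using ha
  have e1 := (((((Jet.const c1).add ((qa.log a0).const_mul (-((k : ℝ) / 2)))).add
    (qh.const_mul (-1 / (4 * τ)))).add (((qa.inv a0).const_mul η).const_mul (-1 / (4 * τ)))).exp)
  have e2 := ((qh.add (Jet.const η)).const_mul c).comp (h := hh 0)
    (Eventually.of_forall fun y => hasDerivAt_hh 0 y) (hasDerivAt_hh1 0 _)
  have e3 := e1.mul e2
  simp only [mul_zero, add_zero, zero_pow (two_ne_zero)] at e3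
  refine e3.congr ?_ ?_
  · field_simp
    ring
  · field_simp
    ring

lemma jety {c1 a τ H h η c : ℝ} (ha : a ≠ 0) (hτ : τ ≠ 0) :
    Jet (fun s => Real.exp (c1
      + (-1 / (4 * τ)) * ((H + 2 * h * s + 1 * s ^ 2) * a⁻¹)) *
       hh 0 (c * (η + (H + 2 * h * s + 1 * s ^ 2))))
    (Real.exp (c1 + (-1 / (4 * τ)) * (H * a⁻¹)) *
      (-h / (2 * τ * a) * hh 0 (c * (η + H)) + hh1 0 (c * (η + H)) * (2 * c * h)))
    (Real.exp (c1 + (-1 / (4 * τ)) * (H * a⁻¹)) *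
      ((-1 / (2 * τ * a) + (-h / (2 * τ * a)) ^ 2) * hh 0 (c * (η + H)) +
        2 * (-h / (2 * τ * a)) * (hh1 0 (c * (η + H)) * (2 * c * h)) +
        (hh2 0 (c * (η + H)) * (2 * c * h) ^ 2 + hh1 0 (c * (η + H)) * (2 * c)))) := by
  have qh := Jet.quad H (2 * h) 1
  have e1 := (((Jet.const c1).add ((qh.mul (Jet.const a⁻¹)).const_mul (-1 / (4 * τ))))).exp
  have e2 := (((Jet.const η).add qh).const_mul c).comp (h := hh 0)
    (Eventually.of_forall fun y => hasDerivAt_hh 0 y) (hasDerivAt_hh1 0 _)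
  have e3 := e1.mul e2
  simp only [mul_zero, add_zero, zero_pow (two_ne_zero)] at e3
  refine e3.congr ?_ ?_
  · field_simp
    ring
  · field_simp
    ring

lemma contDiff_hsq {N k : ℕ} (z0 : Euc N × Euc k) : ContDiff ℝ 2 (hsq z0) :=
  (contDiff_fst.sub contDiff_const).norm_sq ℝ
lemma contDiff_esq {N k : ℕ} (z0 : Euc N × Euc k) : ContDiff ℝ 2 (esq z0) :=
  (contDiff_snd.sub contDiff_const).norm_sq ℝ
lemma contDiff_aa {N k : ℕ} (z0 : Euc N × Euc k) : ContDiff ℝ 2 (aa z0) :=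
  contDiff_const.inner ℝ contDiff_fst
lemma contDiff_chi {N k : ℕ} (z0 : Euc N × Euc k) : ContDiff ℝ 2 (chi z0) :=
  (contDiff_hh 0).comp (contDiff_const.mul ((contDiff_hsq z0).add (contDiff_esq z0)))

lemma contDiffAt_parj {N k : ℕ} (z0 : Euc N × Euc k) {q : (Euc N × Euc k) × ℝ} (ha : aa z0 q.1 ≠ 0)
    (hτ : q.2 ≠ 0) : ContDiffAt ℝ 2 (fun q : (Euc N × Euc k) × ℝ => par z0 q.2 q.1) q := by
  unfold par EE
  have h1 : ContDiffAt ℝ 2 (fun q : (Euc N × Euc k) × ℝ => aa z0 q.1) q :=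
    ((contDiff_aa z0).comp contDiff_fst).contDiffAt
  have h2 : ContDiffAt ℝ 2 (fun q : (Euc N × Euc k) × ℝ => hsq z0 q.1) q :=
    ((contDiff_hsq z0).comp contDiff_fst).contDiffAt
  have h3 : ContDiffAt ℝ 2 (fun q : (Euc N × Euc k) × ℝ => esq z0 q.1) q :=
    ((contDiff_esq z0).comp contDiff_fst).contDiffAt
  have h4 : ContDiffAt ℝ 2 (fun q : (Euc N × Euc k) × ℝ => chi z0 q.1) q :=
    ((contDiff_chi z0).comp contDiff_fst).contDiffAt
  have h5 : ContDiffAt ℝ 2 (fun q : (Euc N × Euc k) × ℝ => q.2) q := contDiff_snd.contDiffAt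
  have h6 : ContDiffAt ℝ 2 (fun q : (Euc N × Euc k) × ℝ => -1 / (4 * q.2)) q :=
    contDiffAt_const.div (contDiffAt_const.mul h5) (by simpa using hτ)
  exact ContDiffAt.mul (ContDiffAt.exp ((((contDiffAt_const.mul (h5.log hτ)).add
    (contDiffAt_const.mul (h1.log ha))).add (h6.mul h2)).add (h6.mul (h3.mul (h1.inv ha))))) h4

lemma contDiffAt_par {N k : ℕ} (z0 : Euc N × Euc k) {τ : ℝ} {w : Euc N × Euc k} (ha : aa z0 w ≠ 0)
    (hτ : τ ≠ 0) : ContDiffAt ℝ 2 (par z0 τ) w :=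
  (contDiffAt_parj z0 (q := (w, τ)) ha hτ).comp (f := fun w => (w, τ)) w
    (contDiffAt_id.prodMk contDiffAt_const)

def cq {N k : ℕ} (z0 w : Euc N × Euc k) : ℝ := 4 / ‖z0.1‖ ^ 2 * (hsq z0 w + esq z0 w)

lemma grushin_par {N k : ℕ} (z0 : Euc N × Euc k) {τ : ℝ} {w : Euc N × Euc k} (ha : aa z0 w ≠ 0)
    (hτ : τ ≠ 0) :
    grushin (par z0 τ) w = Real.exp (EE z0 τ w) * (
      ((k : ℝ) / 2 * ‖z0.1‖ ^ 2 / aa z0 w ^ 2 - N / (2 * τ) - esq z0 w * ‖z0.1‖ ^ 2 / (2 * τ * aa z0 w ^ 3)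
        + ‖z0.1‖ ^ 2 * bet z0 τ w ^ 2 - bet z0 τ w * (aa z0 w - ‖z0.1‖ ^ 2) / τ + hsq z0 w / (4 * τ ^ 2)
        + ‖w.1‖ ^ 2 * (-(k : ℝ) / (2 * τ * aa z0 w) + esq z0 w / (4 * τ ^ 2 * aa z0 w ^ 2))) * chi z0 w
      + 2 * (hh1 0 (cq z0 w) * (8 / ‖z0.1‖ ^ 2) * (bet z0 τ w * (aa z0 w - ‖z0.1‖ ^ 2) - hsq z0 w / (2 * τ)
          - ‖w.1‖ ^ 2 * (esq z0 w / (2 * τ * aa z0 w))))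
      + (hh2 0 (cq z0 w) * (8 / ‖z0.1‖ ^ 2) ^ 2 * (hsq z0 w + ‖w.1‖ ^ 2 * esq z0 w)
        + hh1 0 (cq z0 w) * (8 / ‖z0.1‖ ^ 2) * (N + ‖w.1‖ ^ 2 * k))) := by
  set X := Real.exp (EE z0 τ w) with hX
  set β := bet z0 τ w with hβ
  set a := aa z0 w with hadef
  set η := esq z0 w with hη
  set H := hsq z0 w with hH
  set c := 4 / ‖z0.1‖ ^ 2 with hc
  set h1' := hh1 0 (cq z0 w) with hh1'
  set h2' := hh2 0 (cq z0 w) with hh2'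
  have hx : ∀ i : Fin N, Jet (fun s => par z0 τ
      (w + s • ((EuclideanSpace.single i 1, 0) : Euc N × Euc k)))
      (X * ((z0.1 i * β - (w.1 - z0.1) i / (2 * τ)) * chi z0 w + h1' * (2 * c * (w.1 - z0.1) i)))
      (X * (((k : ℝ) / 2 * z0.1 i ^ 2 / a ^ 2 - 1 / (2 * τ) - η * z0.1 i ^ 2 / (2 * τ * a ^ 3) +
        (z0.1 i * β - (w.1 - z0.1) i / (2 * τ)) ^ 2) * chi z0 w +
        2 * (z0.1 i * β - (w.1 - z0.1) i / (2 * τ)) * (h1' * (2 * c * (w.1 - z0.1) i)) +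
        (h2' * (2 * c * (w.1 - z0.1) i) ^ 2 + h1' * (2 * c)))) := by
    intro i
    have J := jetx k (c1 := -(((N : ℝ) + k) / 2) * Real.log τ) (a := a) (x := z0.1 i) (τ := τ) (H := H)
      (h := (w.1 - z0.1) i) (η := η) (c := c) ha hτ
    have e : (fun s => par z0 τ (w + s • ((EuclideanSpace.single i 1, 0) : Euc N × Euc k))) =
      (fun s => Real.exp (-(((N : ℝ) + k) / 2) * Real.log τ + (-((k : ℝ) / 2)) * Real.log (a + z0.1 i * s + 0 * s ^ 2)
      + (-1 / (4 * τ)) * (H + 2 * (w.1 - z0.1) i * s + 1 * s ^ 2)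
      + (-1 / (4 * τ)) * (η * (a + z0.1 i * s + 0 * s ^ 2)⁻¹)) *
       hh 0 (c * ((H + 2 * (w.1 - z0.1) i * s + 1 * s ^ 2) + η))) := by
      funext s
      have k1 : aa z0 (w + s • ((EuclideanSpace.single i 1, 0) : Euc N × Euc k)) = a + z0.1 i * s + 0 * s ^ 2 := by
        simp [aa, hadef, inner_add_right, inner_smul_right, EuclideanSpace.inner_single_right]
        ring
      have k2 : hsq z0 (w + s • ((EuclideanSpace.single i 1, 0) : Euc N × Euc k)) =
          H + 2 * (w.1 - z0.1) i * s + 1 * s ^ 2 := by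
        rw [hH]; unfold hsq
        rw [← sq_norm_add_single]
        congr 2
        simp only [Prod.fst_add, Prod.smul_fst]
        abel
      have k3 : esq z0 (w + s • ((EuclideanSpace.single i 1, 0) : Euc N × Euc k)) = η := by
        simp [esq, hη]
      unfold par EE chi
      rw [k1, k2, k3]
    rw [e]
    exact J
  have hy : ∀ j : Fin k, Jet (fun s => par z0 τ
      (w + s • ((0, EuclideanSpace.single j 1) : Euc N × Euc k)))
      (X * (-(w.2 - z0.2) j / (2 * τ * a) * chi z0 w + h1' * (2 * c * (w.2 - z0.2) j)))
      (X * ((-1 / (2 * τ * a) + (-(w.2 - z0.2) j / (2 * τ * a)) ^ 2) * chi z0 w +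
        2 * (-(w.2 - z0.2) j / (2 * τ * a)) * (h1' * (2 * c * (w.2 - z0.2) j)) +
        (h2' * (2 * c * (w.2 - z0.2) j) ^ 2 + h1' * (2 * c)))) := by
    intro i
    have J := jety (c1 := -(((N : ℝ) + k) / 2) * Real.log τ + (-((k : ℝ) / 2)) * Real.log a + (-1 / (4 * τ)) * H)
      (a := a) (τ := τ) (H := η) (h := (w.2 - z0.2) i) (η := H) (c := c) ha hτ
    have e : (fun s => par z0 τ (w + s • ((0, EuclideanSpace.single i 1) : Euc N × Euc k))) =
      (fun s => Real.exp (-(((N : ℝ) + k) / 2) * Real.log τ + (-((k : ℝ) / 2)) * Real.log a + (-1 / (4 * τ)) * H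
      + (-1 / (4 * τ)) * ((η + 2 * (w.2 - z0.2) i * s + 1 * s ^ 2) * a⁻¹)) *
       hh 0 (c * (H + (η + 2 * (w.2 - z0.2) i * s + 1 * s ^ 2)))) := by
      funext s
      have k1 : aa z0 (w + s • ((0, EuclideanSpace.single i 1) : Euc N × Euc k)) = a := by
        simp [aa, hadef]
      have k2 : hsq z0 (w + s • ((0, EuclideanSpace.single i 1) : Euc N × Euc k)) = H := by
        simp [hsq, hH]
      have k3 : esq z0 (w + s • ((0, EuclideanSpace.single i 1) : Euc N × Euc k)) =
          η + 2 * (w.2 - z0.2) i * s + 1 * s ^ 2 := by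
        rw [hη]; unfold esq
        rw [← sq_norm_add_single]
        congr 2
        simp only [Prod.snd_add, Prod.smul_snd]
        abel
      unfold par EE chi
      rw [k1, k2, k3]
    rw [e]
    exact J
  rw [grushin_of_jets (contDiffAt_par z0 ha hτ) hx hy]
  have s1 : ∑ i, z0.1 i ^ 2 = ‖z0.1‖ ^ 2 := by
    rw [EuclideanSpace.norm_sq_eq]; simp
  have s2 : ∑ i, (w.1 - z0.1) i ^ 2 = H := by
    rw [hH, hsq, EuclideanSpace.norm_sq_eq]; simp
  have s3 : ∑ i, (w.2 - z0.2) i ^ 2 = η := by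
    rw [hη, esq, EuclideanSpace.norm_sq_eq]; simp
  have s4 : ∑ i, z0.1 i * (w.1 - z0.1) i = a - ‖z0.1‖ ^ 2 := by
    rw [hadef, aa, ← real_inner_self_eq_norm_sq, ← inner_sub_right]
    simp [PiLp.inner_apply, mul_comm]
  have t1 : ∑ i : Fin N, (X * (((k : ℝ) / 2 * z0.1 i ^ 2 / a ^ 2 - 1 / (2 * τ) - η * z0.1 i ^ 2 / (2 * τ * a ^ 3) +
        (z0.1 i * β - (w.1 - z0.1) i / (2 * τ)) ^ 2) * chi z0 w +
        2 * (z0.1 i * β - (w.1 - z0.1) i / (2 * τ)) * (h1' * (2 * c * (w.1 - z0.1) i)) +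
        (h2' * (2 * c * (w.1 - z0.1) i) ^ 2 + h1' * (2 * c)))) =
      X * chi z0 w * ((k : ℝ) / 2 / a ^ 2 - η / (2 * τ * a ^ 3) + β ^ 2) * ∑ i, z0.1 i ^ 2
      + N * (X * (h1' * (2 * c) - 1 / (2 * τ) * chi z0 w))
      + X * (chi z0 w / (4 * τ ^ 2) - 2 * h1' * c / τ + h2' * (2 * c) ^ 2) * ∑ i, (w.1 - z0.1) i ^ 2
      + X * (- chi z0 w * β / τ + 4 * β * h1' * c) * ∑ i, z0.1 i * (w.1 - z0.1) i := by
    have hN : (N : ℝ) * (X * (h1' * (2 * c) - 1 / (2 * τ) * chi z0 w)) =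
      ∑ i : Fin N, (X * (h1' * (2 * c) - 1 / (2 * τ) * chi z0 w)) := by simp
    rw [hN, Finset.mul_sum, Finset.mul_sum, Finset.mul_sum, ← Finset.sum_add_distrib,
      ← Finset.sum_add_distrib, ← Finset.sum_add_distrib]
    refine Finset.sum_congr rfl fun i _ => ?_
    field_simp
    ring
  have t2 : ∑ j : Fin k, (X * ((-1 / (2 * τ * a) + (-(w.2 - z0.2) j / (2 * τ * a)) ^ 2) * chi z0 w +
        2 * (-(w.2 - z0.2) j / (2 * τ * a)) * (h1' * (2 * c * (w.2 - z0.2) j)) +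
        (h2' * (2 * c * (w.2 - z0.2) j) ^ 2 + h1' * (2 * c)))) =
      k * (X * (-1 / (2 * τ * a) * chi z0 w + h1' * (2 * c)))
      + X * (chi z0 w / (4 * τ ^ 2 * a ^ 2) - 2 * h1' * c / (τ * a) + h2' * (2 * c) ^ 2) *
        ∑ j, (w.2 - z0.2) j ^ 2 := by
    have hN : (k : ℝ) * (X * (-1 / (2 * τ * a) * chi z0 w + h1' * (2 * c))) =
      ∑ i : Fin k, (X * (-1 / (2 * τ * a) * chi z0 w + h1' * (2 * c))) := by simp
    rw [hN, Finset.mul_sum, ← Finset.sum_add_distrib]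
    refine Finset.sum_congr rfl fun i _ => ?_
    field_simp
    ring
  rw [t1, t2, s1, s2, s3, s4]
  have hc8 : 8 / ‖z0.1‖ ^ 2 = 2 * c := by rw [hc]; ring
  rw [hc8]
  field_simp
  ring


def Br {N k : ℕ} (z0 : Euc N × Euc k) (τ : ℝ) (w : Euc N × Euc k) : ℝ :=
  chi z0 w * ((k : ℝ) * hsq z0 w / (2 * τ * aa z0 w) - esq z0 w * hsq z0 w / (4 * τ ^ 2 * aa z0 w ^ 2)
    - k * ‖z0.1‖ ^ 2 / (2 * aa z0 w ^ 2) + esq z0 w * ‖z0.1‖ ^ 2 / (2 * τ * aa z0 w ^ 3)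
    - ‖z0.1‖ ^ 2 * bet z0 τ w ^ 2)
  - 2 * (hh1 0 (cq z0 w) * (8 / ‖z0.1‖ ^ 2) * (bet z0 τ w * (aa z0 w - ‖z0.1‖ ^ 2) - hsq z0 w / (2 * τ)
          - ‖w.1‖ ^ 2 * (esq z0 w / (2 * τ * aa z0 w))))
  - (hh2 0 (cq z0 w) * (8 / ‖z0.1‖ ^ 2) ^ 2 * (hsq z0 w + ‖w.1‖ ^ 2 * esq z0 w)
        + hh1 0 (cq z0 w) * (8 / ‖z0.1‖ ^ 2) * (N + ‖w.1‖ ^ 2 * k))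

lemma normsq_eq {N k : ℕ} (z0 w : Euc N × Euc k) :
    ‖w.1‖ ^ 2 = 2 * aa z0 w - ‖z0.1‖ ^ 2 + hsq z0 w := by
  have := norm_sub_sq_real w.1 z0.1
  rw [real_inner_comm] at this
  unfold hsq aa; linarith

lemma hasDerivAt_par {N k : ℕ} (z0 : Euc N × Euc k) {τ : ℝ} {w : Euc N × Euc k} (ha : aa z0 w ≠ 0)
    (hτ : τ ≠ 0) :
    HasDerivAt (fun τ => par z0 τ w) (grushin (par z0 τ) w + Real.exp (EE z0 τ w) * Br z0 τ w) τ := by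
  have hi : HasDerivAt (fun τ : ℝ => -1 / (4 * τ)) (1 / (4 * τ ^ 2)) τ := by
    have := ((hasDerivAt_inv hτ).const_mul (-1 / 4 : ℝ))
    refine (this.congr_deriv ?_).congr_of_eventuallyEq (Eventually.of_forall fun x => ?_)
    · field_simp
    · simp only; rw [div_mul_eq_div_div]; ring
  have h1 := ((((Real.hasDerivAt_log hτ).const_mul (-(((N : ℝ) + k) / 2))).add_const
    ((-((k : ℝ) / 2)) * Real.log (aa z0 w))).add (hi.mul_const (hsq z0 w))).add
    (hi.mul_const (esq z0 w * (aa z0 w)⁻¹))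
  have h2 := h1.exp.mul_const (chi z0 w)
  refine h2.congr_deriv ?_
  rw [grushin_par z0 ha hτ]
  have e : Real.exp (EE z0 τ w) = Real.exp (-(((N : ℝ) + k) / 2) * Real.log τ + (-((k : ℝ) / 2)) * Real.log (aa z0 w)
    + (-1 / (4 * τ)) * hsq z0 w + (-1 / (4 * τ)) * (esq z0 w * (aa z0 w)⁻¹)) := rfl
  simp only [Pi.add_apply]
  rw [← e]
  unfold Br
  rw [normsq_eq z0 w]
  unfold bet
  field_simp
  ring

lemma aa_bounds {N k : ℕ} {z0 w : Euc N × Euc k} (hs : hsq z0 w ≤ ‖z0.1‖ ^ 2 / 4) :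
    ‖z0.1‖ ^ 2 / 2 ≤ aa z0 w ∧ aa z0 w ≤ 3 / 2 * ‖z0.1‖ ^ 2 ∧ ‖w.1‖ ^ 2 ≤ 9 / 4 * ‖z0.1‖ ^ 2 := by
  have h1 : ‖w.1 - z0.1‖ ≤ ‖z0.1‖ / 2 := by
    unfold hsq at hs
    refine abs_le_of_sq_le_sq' ?_ (by positivity) |>.2
    linarith
  have h2 : aa z0 w - ‖z0.1‖ ^ 2 = inner ℝ z0.1 (w.1 - z0.1) := by
    rw [inner_sub_right, real_inner_self_eq_norm_sq]; rfl
  have h3 := abs_le.1 (abs_real_inner_le_norm z0.1 (w.1 - z0.1))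
  have h4 : ‖z0.1‖ * ‖w.1 - z0.1‖ ≤ ‖z0.1‖ * (‖z0.1‖ / 2) := by gcongr
  have h5 : aa z0 w ≤ 3 / 2 * ‖z0.1‖ ^ 2 := by nlinarith
  refine ⟨by nlinarith, h5, ?_⟩
  rw [normsq_eq z0 w]; linarith

lemma abs_hh12 (s : ℝ) : |hh1 0 s| ≤ 900 ∧ |hh2 0 s| ≤ 900 := by
  have a := abs_hh1_le 0 s
  have b := abs_hh2_le 0 s
  have := pow_le_one₀ (n := 0 + 1) (kk_nonneg s) (kk_le_one s)
  norm_num at a b this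
  constructor <;> linarith

set_option maxHeartbeats 2000000 in
lemma Br_bound {N k : ℕ} (z0 : Euc N × Euc k) (h0 : 0 < ‖z0.1‖ ^ 2) :
    ∃ M, 0 < M ∧ ∀ τ w, 0 < τ → hsq z0 w + esq z0 w ≤ ‖z0.1‖ ^ 2 / 4 →
      |Br z0 τ w| ≤ M * (1 + (hsq z0 w + esq z0 w) / τ) ^ 2 := by
  set c := ‖z0.1‖ ^ 2 with hc
  set D := 2 / c with hD
  have hD0 : 0 < D := by positivity
  set M1 : ℝ := k * D + D ^ 2 + k * c * D ^ 2 + D ^ 3 * c + c * (k * D + D ^ 2) ^ 2 with hM1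
  set M2 : ℝ := 2 * (900 * (8 / c) * ((k * D + D ^ 2) * c + 1 + 9 / 4 * c * D)) with hM2
  set M3 : ℝ := 900 * (8 / c) ^ 2 * (c + 9 / 4 * c * c) + 900 * (8 / c) * (N + 9 / 4 * c * k) with hM3
  refine ⟨M1 + M2 + M3 + 1, by positivity, ?_⟩
  intro τ w hτ hs
  have hH : 0 ≤ hsq z0 w := sq_nonneg _
  have hη : 0 ≤ esq z0 w := sq_nonneg _
  obtain ⟨a1, a2, a3⟩ := aa_bounds (z0 := z0) (w := w) (by linarith)
  rw [← hc] at a1 a2 a3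
  obtain ⟨b1, b2⟩ := abs_hh12 (cq z0 w)
  have ha : 0 < aa z0 w := by linarith
  have hr : 0 ≤ ‖w.1‖ ^ 2 := sq_nonneg _
  have c1 : |chi z0 w| ≤ 1 := by
    unfold chi; rw [abs_of_nonneg (hh_nonneg _ _)]; exact hh_le_one _ _
  unfold Br bet
  rw [← hc]
  generalize hsq z0 w = H at *
  generalize esq z0 w = η at *
  generalize aa z0 w = a at *
  generalize chi z0 w = χ at *
  generalize hh1 0 (cq z0 w) = g1 at *
  generalize hh2 0 (cq z0 w) = g2 at *
  generalize ‖w.1‖ ^ 2 = r at *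
  clear_value M1 M2 M3 D c
  obtain ⟨A, hA⟩ : ∃ A, A = a⁻¹ := ⟨_, rfl⟩
  have hA0 : 0 < A := hA ▸ inv_pos.2 ha
  have hAD : A ≤ D := by
    rw [hA, hD, show 2 / c = (c / 2)⁻¹ by field_simp]
    exact inv_anti₀ (by linarith) a1
  obtain ⟨X, hX⟩ : ∃ X, X = H / τ := ⟨_, rfl⟩
  obtain ⟨Y, hY⟩ : ∃ Y, Y = η / τ := ⟨_, rfl⟩
  have hX0 : 0 ≤ X := hX ▸ by positivity
  have hY0 : 0 ≤ Y := hY ▸ by positivity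
  obtain ⟨S, hS⟩ : ∃ S, S = 1 + (H + η) / τ := ⟨_, rfl⟩
  have hS1 : S = 1 + X + Y := by rw [hS, hX, hY]; ring
  rw [← hS]
  have hXS : X ≤ S := by linarith
  have hYS : Y ≤ S := by linarith
  have hS0 : 0 ≤ S := by linarith
  have h1S : 1 ≤ S := by linarith
  have hSS : S ≤ S ^ 2 := by nlinarith
  have h1SS : 1 ≤ S ^ 2 := by nlinarith
  set β := -(k : ℝ) / (2 * a) + η / (4 * τ * a ^ 2) with hβ
  clear_value β
  have hβ' : β = - (k * A / 2) + Y * A ^ 2 / 4 := by rw [hβ, hA, hY]; field_simp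
  have q1 : k * A ≤ k * D * S := by
    calc (k : ℝ) * A ≤ k * D * 1 := by rw [mul_one]; gcongr
      _ ≤ _ := by gcongr
  have q2 : Y * A ^ 2 ≤ D ^ 2 * S := by
    calc Y * A ^ 2 ≤ S * D ^ 2 := by gcongr
      _ = _ := by ring
  have q1' : 0 ≤ (k : ℝ) * A := by positivity
  have q2' : 0 ≤ Y * A ^ 2 := by positivity
  have hβb : |β| ≤ (k * D + D ^ 2) * S := by
    rw [hβ', abs_le, add_mul]; constructor <;> linarith
  have p1 : |(k : ℝ) * H / (2 * τ * a)| ≤ k * D * S ^ 2 := by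
    rw [show (k : ℝ) * H / (2 * τ * a) = k * A * X / 2 by rw [hA, hX]; field_simp,
      abs_of_nonneg (by positivity)]
    have : k * A * X ≤ k * D * S ^ 2 := by
      gcongr; linarith
    have : 0 ≤ k * A * X := by positivity
    linarith
  have p2 : |η * H / (4 * τ ^ 2 * a ^ 2)| ≤ D ^ 2 * S ^ 2 := by
    rw [show η * H / (4 * τ ^ 2 * a ^ 2) = A ^ 2 * (X * Y) / 4 by rw [hA, hX, hY]; field_simp,
      abs_of_nonneg (by positivity)]
    have : A ^ 2 * (X * Y) ≤ D ^ 2 * (S * S) := by gcongr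
    have : 0 ≤ A ^ 2 * (X * Y) := by positivity
    nlinarith
  have p3 : |k * c / (2 * a ^ 2)| ≤ k * c * D ^ 2 * S ^ 2 := by
    rw [show k * c / (2 * a ^ 2) = k * c * A ^ 2 / 2 by rw [hA]; field_simp,
      abs_of_nonneg (by positivity)]
    have : k * c * A ^ 2 * 1 ≤ k * c * D ^ 2 * S ^ 2 := by gcongr
    have : 0 ≤ k * c * A ^ 2 := by positivity
    linarith
  have p4 : |η * c / (2 * τ * a ^ 3)| ≤ D ^ 3 * c * S ^ 2 := by
    rw [show η * c / (2 * τ * a ^ 3) = A ^ 3 * c * Y / 2 by rw [hA, hY]; field_simp,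
      abs_of_nonneg (by positivity)]
    have : A ^ 3 * c * Y ≤ D ^ 3 * c * S ^ 2 := by gcongr; linarith
    have : 0 ≤ A ^ 3 * c * Y := by positivity
    linarith
  have p5 : |c * β ^ 2| ≤ c * (k * D + D ^ 2) ^ 2 * S ^ 2 := by
    rw [abs_mul, abs_of_nonneg h0.le, abs_pow, mul_assoc, ← mul_pow]
    gcongr
  have p6 : |β * (a - c)| ≤ (k * D + D ^ 2) * c * S ^ 2 := by
    rw [abs_mul]
    calc |β| * |a - c| ≤ ((k * D + D ^ 2) * S ^ 2) * c := by
          gcongr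
          · exact hβb.trans (by gcongr)
          · rw [abs_le]; constructor <;> linarith
      _ = _ := by ring
  have p7 : |H / (2 * τ)| ≤ S ^ 2 := by
    rw [show H / (2 * τ) = X / 2 by rw [hX]; field_simp, abs_of_nonneg (by positivity)]
    linarith
  have p8 : |r * (η / (2 * τ * a))| ≤ 9 / 4 * c * D * S ^ 2 := by
    rw [show r * (η / (2 * τ * a)) = r * A * Y / 2 by rw [hA, hY]; field_simp,
      abs_of_nonneg (by positivity)]
    have : r * A * Y ≤ 9 / 4 * c * D * S ^ 2 := by gcongr; linarith
    have : 0 ≤ r * A * Y := by positivity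
    linarith
  have T1 : |χ * (k * H / (2 * τ * a) - η * H / (4 * τ ^ 2 * a ^ 2) - k * c / (2 * a ^ 2)
      + η * c / (2 * τ * a ^ 3) - c * β ^ 2)| ≤ M1 * S ^ 2 := by
    rw [abs_mul]
    refine (mul_le_of_le_one_left (abs_nonneg _) c1).trans ?_
    rw [hM1, add_mul, add_mul, add_mul, add_mul]
    rw [abs_le] at *
    constructor <;> linarith
  have T2 : |2 * (g1 * (8 / c) * (β * (a - c) - H / (2 * τ) - r * (η / (2 * τ * a))))| ≤ M2 * S ^ 2 := by
    rw [abs_mul, abs_mul, abs_mul, abs_of_pos (show (0:ℝ) < 2 by norm_num),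
      abs_of_pos (show (0:ℝ) < 8 / c by positivity), hM2]
    rw [show 2 * (900 * (8 / c) * ((k * D + D ^ 2) * c + 1 + 9 / 4 * c * D)) * S ^ 2 = 2 * (900 * (8 / c) * (((k * D + D ^ 2) * c + 1 + 9 / 4 * c * D) * S ^ 2)) by ring]
    gcongr
    rw [add_mul, add_mul, one_mul]
    rw [abs_le] at p6 p7 p8 ⊢
    constructor <;> linarith
  have T3 : |g2 * (8 / c) ^ 2 * (H + r * η) + g1 * (8 / c) * (N + r * k)| ≤ M3 * S ^ 2 := by
    refine le_trans ?_ (le_mul_of_one_le_right (by rw [hM3]; positivity) h1SS)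
    refine (abs_add_le _ _).trans ?_
    rw [abs_mul, abs_mul, abs_mul, abs_mul, abs_of_pos (show (0:ℝ) < 8 / c by positivity),
      abs_of_pos (show (0:ℝ) < (8 / c) ^ 2 by positivity),
      abs_of_nonneg (show 0 ≤ H + r * η by positivity),
      abs_of_nonneg (show (0:ℝ) ≤ N + r * k by positivity), hM3]
    gcongr <;> linarith
  have hS2 : 0 ≤ S ^ 2 := sq_nonneg _
  rw [abs_le] at T1 T2 T3 ⊢
  rw [add_mul, add_mul, add_mul]
  constructor <;> linarith


lemma norm_sq_le_hsq {N k : ℕ} (z0 w : Euc N × Euc k) : ‖w - z0‖ ^ 2 ≤ hsq z0 w + esq z0 w := by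
  unfold hsq esq
  rw [Prod.norm_def]
  rcases max_cases ‖(w - z0).1‖ ‖(w - z0).2‖ with ⟨h, _⟩ | ⟨h, _⟩ <;> rw [h]
  · have := sq_nonneg ‖w.2 - z0.2‖
    simp only [Prod.fst_sub]; linarith
  · have := sq_nonneg ‖w.1 - z0.1‖
    simp only [Prod.snd_sub]; linarith

lemma pow_exp_bound (j : ℕ) {c : ℝ} (hc : 0 < c) {ξ : ℝ} (hξ : 0 ≤ ξ) :
    (1 + ξ) ^ j * Real.exp (-(c * ξ)) ≤ j.factorial * Real.exp c / c ^ j := by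
  have h := Real.pow_div_factorial_le_exp (x := c * (1 + ξ)) (by positivity) j
  rw [div_le_iff₀ (by positivity), mul_pow, mul_add, mul_one, Real.exp_add] at h
  rw [Real.exp_neg, le_div_iff₀ (by positivity), ← div_eq_mul_inv, div_mul_eq_mul_div,
    div_le_iff₀ (Real.exp_pos _)]
  linarith

lemma kern_bound {N k : ℕ} (hN : 1 ≤ N) (z0 : Euc N × Euc k) (h0 : 0 < ‖z0.1‖ ^ 2) {κ : ℝ}
    (hκ1 : κ ≤ 1 / 2) (hκ0 : 0 < κ) :
    ∃ C, 0 < C ∧ ∀ τ w, 0 < τ → hsq z0 w + esq z0 w ≤ ‖z0.1‖ ^ 2 / 4 → w ≠ z0 →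
      (1 + (hsq z0 w + esq z0 w) / τ) ^ 2 * Real.exp (EE z0 τ w) ≤
        C * (τ ^ (-κ) * ‖w - z0‖ ^ (-(((N : ℝ) + k) - 2 * κ))) := by
  set c := ‖z0.1‖ ^ 2 with hc
  set d := min (1 / 4) (1 / (6 * c)) with hd
  have hd0 : 0 < d := lt_min (by norm_num) (by positivity)
  set B := Real.exp (-((k : ℝ) / 2) * Real.log (c / 2)) with hB
  refine ⟨B * ((2 + (N + k)).factorial * Real.exp d / d ^ (2 + (N + k))), by positivity, ?_⟩
  intro τ w hτ hs hw
  have hH : 0 ≤ hsq z0 w := sq_nonneg _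
  have hη : 0 ≤ esq z0 w := sq_nonneg _
  obtain ⟨a1, a2, -⟩ := aa_bounds (z0 := z0) (w := w) (by linarith)
  rw [← hc] at a1 a2
  have ha : 0 < aa z0 w := by linarith
  set ξ := (hsq z0 w + esq z0 w) / τ with hξ
  have hξ0 : 0 ≤ ξ := by positivity
  have hw0 : 0 < ‖w - z0‖ := norm_pos_iff.2 (sub_ne_zero.2 hw)
  have hρ := norm_sq_le_hsq z0 w
  set n : ℝ := (N : ℝ) + k with hn
  have hn1 : 1 ≤ n := by
    have : (1 : ℝ) ≤ N := by exact_mod_cast hN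
    have : (0 : ℝ) ≤ k := Nat.cast_nonneg _
    linarith
  have e1 : EE z0 τ w ≤ -(n / 2) * Real.log τ + (-((k : ℝ) / 2)) * Real.log (c / 2) - d * ξ := by
    unfold EE
    have l1 : (-((k : ℝ) / 2)) * Real.log (aa z0 w) ≤ (-((k : ℝ) / 2)) * Real.log (c / 2) := by
      have := Real.log_le_log (by linarith) a1
      have h2 : (0 : ℝ) ≤ k / 2 := by positivity
      nlinarith
    have l2 : (-1 / (4 * τ)) * hsq z0 w ≤ - d * (hsq z0 w / τ) := by
      have : d ≤ 1 / 4 := min_le_left _ _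
      have h3 : 0 ≤ hsq z0 w / τ := by positivity
      rw [show (-1 / (4 * τ)) * hsq z0 w = - (1 / 4) * (hsq z0 w / τ) by field_simp]
      nlinarith
    have l3 : (-1 / (4 * τ)) * (esq z0 w * (aa z0 w)⁻¹) ≤ - d * (esq z0 w / τ) := by
      have h4 : d ≤ 1 / (6 * c) := min_le_right _ _
      have h5 : 1 / (6 * c) ≤ (aa z0 w)⁻¹ / 4 := by
        rw [inv_eq_one_div, div_div]
        exact one_div_le_one_div_of_le (by positivity) (by linarith)
      have h3 : 0 ≤ esq z0 w / τ := by positivity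
      rw [show (-1 / (4 * τ)) * (esq z0 w * (aa z0 w)⁻¹) = - ((aa z0 w)⁻¹ / 4) * (esq z0 w / τ) by field_simp]
      nlinarith
    have : d * ξ = d * (hsq z0 w / τ) + d * (esq z0 w / τ) := by rw [hξ]; ring
    linarith
  have e2 : Real.exp (EE z0 τ w) ≤ τ ^ (-(n / 2)) * B * Real.exp (-(d * ξ)) := by
    refine (Real.exp_le_exp.2 e1).trans (le_of_eq ?_)
    rw [Real.rpow_def_of_pos hτ, hB, ← Real.exp_add, ← Real.exp_add]
    congr 1; ring
  have e3 : τ ^ (-(n / 2)) ≤ τ ^ (-κ) * ‖w - z0‖ ^ (-(n - 2 * κ)) * (1 + ξ) ^ (N + k) := by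
    have hm : 0 ≤ (n - 2 * κ) / 2 := by linarith
    have r1 : ‖w - z0‖ ^ 2 / τ ≤ ξ := by rw [hξ]; gcongr
    have r2 : (‖w - z0‖ ^ 2 / τ) ^ ((n - 2 * κ) / 2) ≤ (1 + ξ) ^ (N + k) := by
      calc (‖w - z0‖ ^ 2 / τ) ^ ((n - 2 * κ) / 2) ≤ (1 + ξ) ^ ((n - 2 * κ) / 2) := by
            apply Real.rpow_le_rpow (by positivity) (by linarith) hm
        _ ≤ (1 + ξ) ^ (n : ℝ) := Real.rpow_le_rpow_of_exponent_le (by linarith) (by linarith)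
        _ = (1 + ξ) ^ (N + k) := by rw [hn, ← Nat.cast_add, Real.rpow_natCast]
    calc τ ^ (-(n / 2)) = τ ^ (-κ) * ‖w - z0‖ ^ (-(n - 2 * κ)) * (‖w - z0‖ ^ 2 / τ) ^ ((n - 2 * κ) / 2) := by
          rw [Real.div_rpow (by positivity) hτ.le, ← Real.rpow_natCast, ← Real.rpow_mul hw0.le, mul_assoc,
            mul_div_assoc', ← Real.rpow_add hw0]
          have : -(n - 2 * κ) + ((2 : ℕ) : ℝ) * ((n - 2 * κ) / 2) = 0 := by push_cast; ring
          rw [this, Real.rpow_zero, one_div, ← Real.rpow_neg hτ.le, ← Real.rpow_add hτ]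
          congr 1; ring
      _ ≤ _ := by gcongr
  calc (1 + ξ) ^ 2 * Real.exp (EE z0 τ w)
      ≤ (1 + ξ) ^ 2 * ((τ ^ (-κ) * ‖w - z0‖ ^ (-(n - 2 * κ)) * (1 + ξ) ^ (N + k)) * B * Real.exp (-(d * ξ))) := by
        refine mul_le_mul_of_nonneg_left (e2.trans ?_) (by positivity)
        gcongr
    _ = B * ((1 + ξ) ^ (2 + (N + k)) * Real.exp (-(d * ξ))) * (τ ^ (-κ) * ‖w - z0‖ ^ (-(n - 2 * κ))) := by
        rw [pow_add]; ring
    _ ≤ _ := by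
        gcongr
        exact pow_exp_bound _ hd0 hξ0

/-- lower bound near the pole -/
lemma par_lower {N k : ℕ} (z0 : Euc N × Euc k) (h0 : 0 < ‖z0.1‖ ^ 2) :
    ∃ C, 0 < C ∧ ∀ ε τ w, 0 < ε → ε ≤ ‖z0.1‖ ^ 2 / 16 → 3 / 2 * ε ≤ τ → τ ≤ 7 / 4 * ε →
      ‖w - z0‖ ≤ √ε → C * ε ^ (-(((N : ℝ) + k) / 2)) ≤ par z0 τ w := by
  set c := ‖z0.1‖ ^ 2 with hc
  set n : ℝ := (N : ℝ) + k with hn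
  refine ⟨Real.exp (-(n / 2) * Real.log 2 + -((k : ℝ) / 2) * Real.log (3 / 2 * c) - 1 - 2 / c), Real.exp_pos _, ?_⟩
  intro ε τ w hε hεc t1 t2 hw
  have hτ : 0 < τ := by linarith
  have hH : hsq z0 w ≤ ε := by
    unfold hsq
    have : ‖w.1 - z0.1‖ ≤ √ε := (norm_fst_le (w - z0)).trans hw
    calc _ ≤ (√ε) ^ 2 := by gcongr
      _ = ε := Real.sq_sqrt hε.le
  have hη : esq z0 w ≤ ε := by
    unfold esq
    have : ‖w.2 - z0.2‖ ≤ √ε := (norm_snd_le (w - z0)).trans hw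
    calc _ ≤ (√ε) ^ 2 := by gcongr
      _ = ε := Real.sq_sqrt hε.le
  have hH0 : 0 ≤ hsq z0 w := sq_nonneg _
  have hη0 : 0 ≤ esq z0 w := sq_nonneg _
  obtain ⟨a1, a2, -⟩ := aa_bounds (z0 := z0) (w := w) (by linarith)
  rw [← hc] at a1 a2
  have ha : 0 < aa z0 w := by linarith
  have hchi : chi z0 w = 1 := by
    unfold chi
    apply hh_eq_one
    rw [← hc, div_mul_eq_mul_div, div_le_iff₀ h0]
    linarith
  unfold par
  rw [hchi, mul_one, Real.rpow_def_of_pos hε, ← Real.exp_add]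
  apply Real.exp_le_exp.2
  unfold EE
  have l0 : -(n / 2) * (Real.log 2 + Real.log ε) ≤ -(n / 2) * Real.log τ := by
    rw [← Real.log_mul (by norm_num) hε.ne']
    have := Real.log_le_log hτ (show τ ≤ 2 * ε by linarith)
    have h2 : (0 : ℝ) ≤ n / 2 := by positivity
    nlinarith
  have l1 : (-((k : ℝ) / 2)) * Real.log (3 / 2 * c) ≤ (-((k : ℝ) / 2)) * Real.log (aa z0 w) := by
    have := Real.log_le_log ha a2
    have h2 : (0 : ℝ) ≤ k / 2 := by positivity
    nlinarith
  have x1 : hsq z0 w / τ ≤ 1 := by rw [div_le_one hτ]; linarith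
  have x2 : esq z0 w / τ ≤ 1 := by rw [div_le_one hτ]; linarith
  have l2 : -1 ≤ (-1 / (4 * τ)) * hsq z0 w := by
    rw [show (-1 / (4 * τ)) * hsq z0 w = - (1 / 4) * (hsq z0 w / τ) by field_simp]
    linarith
  have l3 : - (2 / c) ≤ (-1 / (4 * τ)) * (esq z0 w * (aa z0 w)⁻¹) := by
    have h5 : (aa z0 w)⁻¹ ≤ 2 / c := by
      rw [inv_eq_one_div, div_le_div_iff₀ ha h0]; linarith
    have h6 : 0 < (aa z0 w)⁻¹ := inv_pos.2 ha
    have h3 : 0 ≤ esq z0 w / τ := by positivity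
    rw [show (-1 / (4 * τ)) * (esq z0 w * (aa z0 w)⁻¹) = - ((aa z0 w)⁻¹ / 4 * (esq z0 w / τ)) by field_simp]
    have := mul_le_mul h5 x2 h3 (by positivity)
    nlinarith
  linarith


def FF {N k : ℕ} (z0 : Euc N × Euc k) (t0 T ε : ℝ) (q : (Euc N × Euc k) × ℝ) : ℝ :=
  par z0 (t0 - q.2) q.1 * thE 0 T ε (t0 - q.2)

lemma chi_zero {N k : ℕ} {z0 w : Euc N × Euc k} (h0 : 0 < ‖z0.1‖ ^ 2)
    (h : ‖z0.1‖ ^ 2 / 4 ≤ hsq z0 w + esq z0 w) : chi z0 w = 0 := by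
  unfold chi
  apply hh_eq_zero
  rw [div_mul_eq_mul_div, le_div_iff₀ h0]
  linarith

lemma FF_zero {N k : ℕ} {z0 : Euc N × Euc k} (h0 : 0 < ‖z0.1‖ ^ 2) {t0 T ε : ℝ} (hT : 0 < T) (hε : 0 < ε)
    {q : (Euc N × Euc k) × ℝ} (h : ‖z0.1‖ ^ 2 / 4 ≤ hsq z0 q.1 + esq z0 q.1 ∨ t0 - q.2 < ε ∨ T < t0 - q.2) :
    FF z0 t0 T ε q = 0 := by
  unfold FF
  rcases h with h | h | h
  · rw [par, chi_zero h0 h]; simp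
  · rw [thE_zero 0 hT hε]; · simp
    intro hh; exact absurd hh.1 (not_le.2 h)
  · rw [thE_zero 0 hT hε]; · simp
    intro hh; exact absurd hh.2 (not_le.2 h)

lemma FF_ev_zero {N k : ℕ} {z0 : Euc N × Euc k} (h0 : 0 < ‖z0.1‖ ^ 2) {t0 T ε : ℝ} (hT : 0 < T) (hε : 0 < ε)
    {q : (Euc N × Euc k) × ℝ} (h : ‖z0.1‖ ^ 2 / 4 < hsq z0 q.1 + esq z0 q.1 ∨ t0 - q.2 < ε) :
    ∀ᶠ q' in nhds q, FF z0 t0 T ε q' = 0 := by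
  rcases h with h | h
  · have hc : Continuous fun q : (Euc N × Euc k) × ℝ => hsq z0 q.1 + esq z0 q.1 :=
      (((contDiff_hsq z0).add (contDiff_esq z0)).continuous).comp continuous_fst
    filter_upwards [hc.continuousAt.eventually (lt_mem_nhds h)] with q' hq'
    exact FF_zero h0 hT hε (Or.inl hq'.le)
  · have hc : Continuous fun q : (Euc N × Euc k) × ℝ => t0 - q.2 := by fun_prop
    filter_upwards [hc.continuousAt.eventually (gt_mem_nhds h)] with q' hq'
    exact FF_zero h0 hT hε (Or.inr (Or.inl hq'))

lemma aa_pos {N k : ℕ} {z0 w : Euc N × Euc k} (h0 : 0 < ‖z0.1‖ ^ 2)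
    (h : hsq z0 w + esq z0 w ≤ ‖z0.1‖ ^ 2 / 4) : 0 < aa z0 w := by
  have : 0 ≤ esq z0 w := sq_nonneg _
  have := (aa_bounds (z0 := z0) (w := w) (by linarith)).1
  linarith

lemma contDiff_FF {N k : ℕ} {z0 : Euc N × Euc k} (h0 : 0 < ‖z0.1‖ ^ 2) {t0 T ε : ℝ} (hT : 0 < T) (hε : 0 < ε) :
    ContDiff ℝ 2 (FF z0 t0 T ε) := by
  rw [contDiff_iff_contDiffAt]
  intro q
  by_cases h : ‖z0.1‖ ^ 2 / 4 < hsq z0 q.1 + esq z0 q.1 ∨ t0 - q.2 < ε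
  · exact (contDiffAt_const (c := (0:ℝ))).congr_of_eventuallyEq (FF_ev_zero h0 hT hε h)
  · push Not at h
    have ha := aa_pos h0 h.1
    have h1 : ContDiffAt ℝ 2 (fun q : (Euc N × Euc k) × ℝ => (q.1, t0 - q.2)) q :=
      (contDiff_fst.prodMk (contDiff_const.sub contDiff_snd)).contDiffAt
    have h2 := ContDiffAt.comp (g := fun q : (Euc N × Euc k) × ℝ => par z0 q.2 q.1) q
      (contDiffAt_parj z0 (q := (q.1, t0 - q.2)) ha.ne' (by simp only; linarith)) h1
    exact h2.mul ((contDiff_thE 0 T ε).comp (contDiff_const.sub contDiff_snd)).contDiffAt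

lemma hcs_FF {N k : ℕ} {z0 : Euc N × Euc k} (h0 : 0 < ‖z0.1‖ ^ 2) {t0 T ε : ℝ} (hT : 0 < T) (hε : 0 < ε) :
    HasCompactSupport (FF z0 t0 T ε) := by
  refine HasCompactSupport.intro (K := Metric.closedBall z0 ‖z0.1‖ ×ˢ Set.Icc (t0 - T) (t0 - ε))
    ((isCompact_closedBall _ _).prod isCompact_Icc) ?_
  intro q hq
  apply FF_zero h0 hT hε
  by_contra hc
  push Not at hc
  apply hq
  refine ⟨?_, by linarith, by linarith⟩
  rw [mem_closedBall_iff_norm]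
  have := norm_sq_le_hsq z0 q.1
  exact abs_le_of_sq_le_sq' (by linarith) (norm_nonneg _) |>.2

/-- the backward operator applied to the test function -/
def err {N k : ℕ} (z0 : Euc N × Euc k) (t0 T ε : ℝ) (q : (Euc N × Euc k) × ℝ) : ℝ :=
  grushin (fun w => FF z0 t0 T ε (w, q.2)) q.1 + deriv (fun s => FF z0 t0 T ε (q.1, s)) q.2

lemma err_zero {N k : ℕ} {z0 : Euc N × Euc k} (h0 : 0 < ‖z0.1‖ ^ 2) {t0 T ε : ℝ} (hT : 0 < T) (hε : 0 < ε)
    {q : (Euc N × Euc k) × ℝ} (h : ‖z0.1‖ ^ 2 / 4 < hsq z0 q.1 + esq z0 q.1 ∨ t0 - q.2 < ε) :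
    err z0 t0 T ε q = 0 := by
  have hev := FF_ev_zero h0 hT hε h
  unfold err
  have c1 : ContinuousAt (fun w => (w, q.2)) q.1 := by fun_prop
  have c2 : ContinuousAt (fun s : ℝ => (q.1, s)) q.2 := by fun_prop
  have e1 : ∀ᶠ w in nhds q.1, FF z0 t0 T ε (w, q.2) = 0 := c1.eventually hev
  have e2 : (fun s => FF z0 t0 T ε (q.1, s)) =ᶠ[nhds q.2] fun _ => (0:ℝ) := c2.eventually hev
  rw [grushin_eq_zero_of_eventually e1, e2.deriv_eq]
  simp

lemma grushin_mul_const_at {N k : ℕ} {f : Euc N × Euc k → ℝ} {z : Euc N × Euc k} (hf : ContDiffAt ℝ 2 f z) (c : ℝ) :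
    grushin (fun w => f w * c) z = grushin f z * c := by
  have hs : ∀ v, secondDeriv (fun w => f w * c) z v = secondDeriv f z v * c := by
    intro v
    unfold secondDeriv
    have h1 : ∀ᶠ w in nhds z, DifferentiableAt ℝ f w := by
      filter_upwards [hf.eventually (by simp)] with w hw
      exact hw.differentiableAt (by norm_num)
    have h2 : (fun w => fderiv ℝ (fun w => f w * c) w v) =ᶠ[nhds z] fun w => fderiv ℝ f w v * c := by
      filter_upwards [h1] with w hw
      rw [fderiv_mul_const hw]; simp [mul_comm]
    rw [h2.fderiv_eq]
    have h3 : DifferentiableAt ℝ (fun w => fderiv ℝ f w v) z := by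
      have := (hf.fderiv_right (m := 1) (by norm_num)).differentiableAt (by norm_num)
      exact this.clm_apply (differentiableAt_const v)
    rw [fderiv_mul_const h3]; simp [mul_comm]
  unfold grushin laplacianX laplacianY
  simp only [hs, ← Finset.sum_mul]
  ring

lemma err_eq {N k : ℕ} {z0 : Euc N × Euc k} (h0 : 0 < ‖z0.1‖ ^ 2) {t0 T ε : ℝ} (hε : 0 < ε)
    {q : (Euc N × Euc k) × ℝ} (h1 : hsq z0 q.1 + esq z0 q.1 ≤ ‖z0.1‖ ^ 2 / 4) (h2 : ε ≤ t0 - q.2) :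
    err z0 t0 T ε q = - (par z0 (t0 - q.2) q.1 * thE' 0 T ε (t0 - q.2) +
      thE 0 T ε (t0 - q.2) * (Real.exp (EE z0 (t0 - q.2) q.1) * Br z0 (t0 - q.2) q.1)) := by
  have ha := aa_pos h0 h1
  have hτ : t0 - q.2 ≠ 0 := by linarith
  unfold err
  have e1 : grushin (fun w => FF z0 t0 T ε (w, q.2)) q.1 =
      grushin (par z0 (t0 - q.2)) q.1 * thE 0 T ε (t0 - q.2) := by
    unfold FF
    exact grushin_mul_const_at (f := par z0 (t0 - q.2)) (contDiffAt_par z0 ha.ne' hτ) (thE 0 T ε (t0 - q.2))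
  have hs : HasDerivAt (fun s : ℝ => t0 - s) (-1) q.2 := by
    simpa using (hasDerivAt_id q.2).const_sub t0
  have d0 := hasDerivAt_par z0 ha.ne' hτ
  rw [e1]
  generalize grushin (par z0 (t0 - q.2)) q.1 = g at *
  generalize Real.exp (EE z0 (t0 - q.2) q.1) * Br z0 (t0 - q.2) q.1 = b at *
  have d1 : HasDerivAt (fun s => par z0 (t0 - s) q.1) ((g + b) * (-1)) q.2 :=
    HasDerivAt.comp (h₂ := fun τ => par z0 τ q.1) q.2 d0 hs
  have d2 : HasDerivAt (fun s => thE 0 T ε (t0 - s)) (thE' 0 T ε (t0 - q.2) * (-1)) q.2 :=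
    HasDerivAt.comp q.2 (hasDerivAt_thE 0 T ε (t0 - q.2)) hs
  have d3 : HasDerivAt (fun s => FF z0 t0 T ε (q.1, s)) ((g + b) * (-1) * thE 0 T ε (t0 - q.2) +
      par z0 (t0 - q.2) q.1 * (thE' 0 T ε (t0 - q.2) * (-1))) q.2 := d1.mul d2
  rw [d3.deriv]
  ring


def kx (N k : ℕ) (κ : ℝ) (v : Euc N × Euc k) : ℝ≥0∞ := ‖v‖ₑ ^ (-(((N : ℝ) + k) - 2 * κ))
def KK {N k : ℕ} (κ : ℝ) (z0 : Euc N × Euc k) (t0 : ℝ) (q : (Euc N × Euc k) × ℝ) : ℝ≥0∞ :=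
  ENNReal.ofReal ((t0 - q.2) ^ (-κ)) * kx N k κ (q.1 - z0)
def cyl {N k : ℕ} (z0 : Euc N × Euc k) (t0 ε : ℝ) : Set ((Euc N × Euc k) × ℝ) :=
  {q | ‖q.1 - z0‖ ≤ √ε ∧ 3 / 2 * ε ≤ t0 - q.2 ∧ t0 - q.2 ≤ 7 / 4 * ε}
def dom (N k : ℕ) (R t0 : ℝ) : Set ((Euc N × Euc k) × ℝ) := Metric.closedBall 0 (2 * R) ×ˢ Set.Iio t0

lemma kern_enn {N k : ℕ} (hN : 1 ≤ N) {z0 w : Euc N × Euc k} {κ τ C x : ℝ} (hκ1 : κ < 1 / 2) (hτ : 0 < τ)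
    (hC : 0 < C) (h : w ≠ z0 → x ≤ C * (τ ^ (-κ) * ‖w - z0‖ ^ (-(((N : ℝ) + k) - 2 * κ)))) :
    ENNReal.ofReal x ≤ ENNReal.ofReal C * (ENNReal.ofReal (τ ^ (-κ)) * kx N k κ (w - z0)) := by
  have hn : (1 : ℝ) ≤ N := by exact_mod_cast hN
  have hk : (0 : ℝ) ≤ k := Nat.cast_nonneg _
  by_cases hw : w = z0
  · rw [hw, sub_self]
    unfold kx
    rw [enorm_zero, ENNReal.zero_rpow_of_neg (by linarith), ENNReal.mul_top, ENNReal.mul_top]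
    · exact le_top
    · simpa using hC
    · simpa using Real.rpow_pos_of_pos hτ _
  · have hw0 : 0 < ‖w - z0‖ := norm_pos_iff.2 (sub_ne_zero.2 hw)
    unfold kx
    rw [← ofReal_norm, ENNReal.ofReal_rpow_of_pos hw0, ← ENNReal.ofReal_mul (by positivity),
      ← ENNReal.ofReal_mul hC.le]
    exact ENNReal.ofReal_le_ofReal (h hw)

lemma thE_bds (m : ℕ) (T ε t : ℝ) : 0 ≤ thE m T ε t ∧ thE m T ε t ≤ 1 := by
  unfold thE
  have a := hh_nonneg m (t / T)
  have b := hh_le_one m (t / T)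
  have c := hh_nonneg m (t / (2 * ε))
  have d := hh_le_one m (t / (2 * ε))
  constructor
  · exact mul_nonneg a (by linarith)
  · exact mul_le_one₀ b (by linarith) (by linarith)

lemma pt_bounds {N k : ℕ} (hN : 1 ≤ N) {z0 : Euc N × Euc k} (h0 : 0 < ‖z0.1‖ ^ 2) {R : ℝ} (hR : ‖z0‖ ≤ R)
    {κ : ℝ} (hκ1 : κ < 1 / 2) (hκ0 : 0 < κ) :
    ∃ C L : ℝ, 0 < C ∧ 0 < L ∧ ∀ t0 T0 ε, 0 < t0 → t0 < T0 → 0 < ε → ε ≤ ‖z0.1‖ ^ 2 / 16 → ∀ q, 0 ≤ q.2 →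
      0 ≤ FF z0 t0 (4 * T0) ε q ∧
      ENNReal.ofReal (FF z0 t0 (4 * T0) ε q) ≤ ENNReal.ofReal C * (dom N k R t0).indicator (KK κ z0 t0) q ∧
      ENNReal.ofReal ((cyl z0 t0 ε).indicator (fun _ => L * ε ^ (-(((N : ℝ) + k) / 2)) / ε) q
        + err z0 t0 (4 * T0) ε q) ≤ ENNReal.ofReal C * (dom N k R t0).indicator (KK κ z0 t0) q := by
  obtain ⟨M, hM, hBr⟩ := Br_bound z0 h0
  obtain ⟨C1, hC1, hK⟩ := kern_bound hN z0 h0 hκ1.le hκ0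
  obtain ⟨L1, hL1, hL⟩ := par_lower z0 h0
  refine ⟨(1 + M) * C1, L1 / 8, by positivity, by positivity, ?_⟩
  intro t0 T0 ε ht0 hT0 hε hεc q hq
  have hpar : ∀ τ w, 0 ≤ par z0 τ w := fun τ w => mul_nonneg (Real.exp_pos _).le (hh_nonneg _ _)
  have hT : 0 < 4 * T0 := by linarith
  refine ⟨mul_nonneg (hpar _ _) (thE_bds _ _ _ _).1, ?_⟩
  by_cases hreg : ‖z0.1‖ ^ 2 / 4 < hsq z0 q.1 + esq z0 q.1 ∨ t0 - q.2 < ε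
  · rw [(FF_ev_zero h0 hT hε hreg).self_of_nhds, err_zero h0 hT hε hreg, Set.indicator_of_notMem (s := cyl z0 t0 ε)]
    · simp
    rintro ⟨c1, c2, c3⟩
    rcases hreg with hreg | hreg
    · have hH : hsq z0 q.1 ≤ ε := by
        unfold hsq
        have : ‖q.1.1 - z0.1‖ ≤ √ε := (norm_fst_le (q.1 - z0)).trans c1
        calc _ ≤ (√ε) ^ 2 := by gcongr
          _ = ε := Real.sq_sqrt hε.le
      have hη : esq z0 q.1 ≤ ε := by
        unfold esq
        have : ‖q.1.2 - z0.2‖ ≤ √ε := (norm_snd_le (q.1 - z0)).trans c1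
        calc _ ≤ (√ε) ^ 2 := by gcongr
          _ = ε := Real.sq_sqrt hε.le
      linarith
    · linarith
  push Not at hreg
  obtain ⟨r1, r2⟩ := hreg
  have hτ : 0 < t0 - q.2 := by linarith
  have hdom : q ∈ dom N k R t0 := by
    refine ⟨?_, by simp only [Set.mem_Iio]; linarith⟩
    have h1 := norm_sq_le_hsq z0 q.1
    have h2 : ‖q.1 - z0‖ ≤ ‖z0.1‖ := by
      refine abs_le_of_sq_le_sq' (by linarith) (norm_nonneg _) |>.2
    have h3 : ‖z0.1‖ ≤ ‖z0‖ := norm_fst_le z0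
    have h4 : ‖q.1‖ ≤ ‖q.1 - z0‖ + ‖z0‖ := by
      have := norm_add_le (q.1 - z0) z0; rwa [sub_add_cancel] at this
    rw [mem_closedBall_zero_iff]; linarith
  rw [Set.indicator_of_mem hdom]
  have hξ : 0 ≤ (hsq z0 q.1 + esq z0 q.1) / (t0 - q.2) :=
    div_nonneg (add_nonneg (sq_nonneg _) (sq_nonneg _)) hτ.le
  have hξ1 : 1 ≤ (1 + (hsq z0 q.1 + esq z0 q.1) / (t0 - q.2)) ^ 2 := one_le_pow₀ (by linarith)
  have hE := Real.exp_pos (EE z0 (t0 - q.2) q.1)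
  have hchi1 : chi z0 q.1 ≤ 1 := hh_le_one _ _
  have hchi0 : 0 ≤ chi z0 q.1 := hh_nonneg _ _
  obtain ⟨th0, th1⟩ := thE_bds 0 (4 * T0) ε (t0 - q.2)
  unfold KK
  constructor
  · refine kern_enn hN hκ1 hτ (by positivity) fun hw => ?_
    have := hK _ _ hτ r1 hw
    unfold FF par
    calc _ ≤ Real.exp (EE z0 (t0 - q.2) q.1) * 1 * 1 := by gcongr
      _ ≤ (1 + (hsq z0 q.1 + esq z0 q.1) / (t0 - q.2)) ^ 2 * Real.exp (EE z0 (t0 - q.2) q.1) := by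
        rw [mul_one, mul_one]; exact le_mul_of_one_le_left hE.le hξ1
      _ ≤ _ := this
      _ ≤ (1 + M) * (C1 * _) := le_mul_of_one_le_left (by positivity) (by linarith)
      _ = _ := by ring
  · refine kern_enn hN hκ1 hτ (by positivity) fun hw => ?_
    have hk' := hK _ _ hτ r1 hw
    rw [err_eq h0 hε r1 r2]
    have q1 : (t0 - q.2) / (4 * T0) ≤ 1 / 2 := by rw [div_le_iff₀ hT]; linarith
    have ethE : thE' 0 (4 * T0) ε (t0 - q.2) = - hh1 0 ((t0 - q.2) / (2 * ε)) / (2 * ε) := by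
      unfold thE'
      rw [hh1_eq_zero 0 q1, hh_eq_one 0 q1]; ring
    have hthE' : 0 ≤ thE' 0 (4 * T0) ε (t0 - q.2) := by
      rw [ethE]
      have := hh1_nonpos 0 ((t0 - q.2) / (2 * ε))
      exact div_nonneg (by linarith) (by linarith)
    have hind : (cyl z0 t0 ε).indicator (fun _ => L1 / 8 * ε ^ (-(((N : ℝ) + k) / 2)) / ε) q ≤
        par z0 (t0 - q.2) q.1 * thE' 0 (4 * T0) ε (t0 - q.2) := by
      by_cases hc : q ∈ cyl z0 t0 ε
      · rw [Set.indicator_of_mem hc]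
        obtain ⟨c1, c2, c3⟩ := hc
        have l1 := hL ε _ q.1 hε hεc c2 c3 c1
        have l2 : (1 / 4 : ℝ) / (2 * ε) ≤ thE' 0 (4 * T0) ε (t0 - q.2) := by
          rw [ethE]
          have := hh1_lower 0 (s := (t0 - q.2) / (2 * ε)) (by rw [le_div_iff₀ (by positivity)]; linarith)
            (by rw [div_le_iff₀ (by positivity)]; linarith)
          gcongr
          norm_num at this
          linarith
        calc _ = L1 * ε ^ (-(((N : ℝ) + k) / 2)) * ((1 / 4 : ℝ) / (2 * ε)) := by field_simp; norm_num
          _ ≤ _ := mul_le_mul l1 l2 (by positivity) (hpar _ _)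
      · rw [Set.indicator_of_notMem hc]
        exact mul_nonneg (hpar _ _) hthE'
    have hb := hBr _ _ hτ r1
    have : - (thE 0 (4 * T0) ε (t0 - q.2) * (Real.exp (EE z0 (t0 - q.2) q.1) * Br z0 (t0 - q.2) q.1)) ≤
        M * ((1 + (hsq z0 q.1 + esq z0 q.1) / (t0 - q.2)) ^ 2 * Real.exp (EE z0 (t0 - q.2) q.1)) := by
      calc _ = thE 0 (4 * T0) ε (t0 - q.2) * (Real.exp (EE z0 (t0 - q.2) q.1) * (- Br z0 (t0 - q.2) q.1)) := by ring
        _ ≤ thE 0 (4 * T0) ε (t0 - q.2) * (Real.exp (EE z0 (t0 - q.2) q.1) * |Br z0 (t0 - q.2) q.1|) := by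
          gcongr; exact neg_le_abs _
        _ ≤ 1 * (Real.exp (EE z0 (t0 - q.2) q.1) * (M * (1 + (hsq z0 q.1 + esq z0 q.1) / (t0 - q.2)) ^ 2)) := by
          gcongr
        _ = _ := by ring
    have h5 : M * ((1 + (hsq z0 q.1 + esq z0 q.1) / (t0 - q.2)) ^ 2 * Real.exp (EE z0 (t0 - q.2) q.1)) ≤
      M * (C1 * ((t0 - q.2) ^ (-κ) * ‖q.1 - z0‖ ^ (-((N : ℝ) + k - 2 * κ)))) := by gcongr
    have h6 : 0 ≤ C1 * ((t0 - q.2) ^ (-κ) * ‖q.1 - z0‖ ^ (-((N : ℝ) + k - 2 * κ))) := by positivity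
    nlinarith


lemma ofReal_integral_le {α : Type*} [MeasurableSpace α] {μ : Measure α} {h : α → ℝ} (hh : Integrable h μ) :
    ENNReal.ofReal (∫ x, h x ∂μ) ≤ ∫⁻ x, ENNReal.ofReal (h x) ∂μ := by
  have h1 : ∫ x, h x ∂μ ≤ ∫ x, max (h x) 0 ∂μ := integral_mono hh hh.pos_part fun x => le_max_left _ _
  refine (ENNReal.ofReal_le_ofReal h1).trans ?_
  rw [ofReal_integral_eq_lintegral_ofReal hh.pos_part (Eventually.of_forall fun x => le_max_right _ _)]
  refine lintegral_mono fun x => ?_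
  rcases le_total 0 (h x) with h | h
  · rw [max_eq_left h]
  · rw [max_eq_right h]; simp

def GG {N k : ℕ} (κ R : ℝ) (φ : Euc N × Euc k → ℝ≥0∞) (Φ : (Euc N × Euc k) × ℝ → ℝ≥0∞)
    (z0 : Euc N × Euc k) (t0 : ℝ) : ℝ≥0∞ :=
  ENNReal.ofReal (t0 ^ (-κ)) * (∫⁻ w in Metric.closedBall 0 (2 * R), φ w * kx N k κ (w - z0)) +
  ∫⁻ q in dom N k R t0 ∩ Om N k, Φ q * KK κ z0 t0 q

lemma measurable_kx (N k : ℕ) (κ : ℝ) : Measurable (kx N k κ) := by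
  unfold kx; fun_prop

lemma measurable_KK {N k : ℕ} (κ : ℝ) (z0 : Euc N × Euc k) (t0 : ℝ) : Measurable (KK κ z0 t0) := by
  unfold KK
  exact ((measurable_const.sub measurable_snd).pow_const _).ennreal_ofReal.mul
    ((measurable_kx N k κ).comp (measurable_fst.sub measurable_const))

lemma measurableSet_dom (N k : ℕ) (R t0 : ℝ) : MeasurableSet (dom N k R t0) :=
  Metric.isClosed_closedBall.measurableSet.prod measurableSet_Iio

lemma measurableSet_cyl {N k : ℕ} (z0 : Euc N × Euc k) (t0 ε : ℝ) : MeasurableSet (cyl z0 t0 ε) := by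
  apply IsClosed.measurableSet
  have h1 : Continuous fun q : (Euc N × Euc k) × ℝ => ‖q.1 - z0‖ := by fun_prop
  have h2 : Continuous fun q : (Euc N × Euc k) × ℝ => t0 - q.2 := by fun_prop
  exact (isClosed_le h1 continuous_const).inter ((isClosed_le continuous_const h2).inter
    (isClosed_le h2 continuous_const))

lemma isBounded_cyl {N k : ℕ} (z0 : Euc N × Euc k) (t0 ε : ℝ) : Bornology.IsBounded (cyl z0 t0 ε) := by
  have : cyl z0 t0 ε ⊆ Metric.closedBall z0 (√ε) ×ˢ Set.Icc (t0 - 7 / 4 * ε) (t0 - 3 / 2 * ε) := by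
    rintro q ⟨a, b, c⟩
    exact ⟨by rwa [mem_closedBall_iff_norm], by linarith, by linarith⟩
  exact (((isCompact_closedBall _ _).prod isCompact_Icc).isBounded).subset this

lemma cyl_bound {N k : ℕ} (hN : 1 ≤ N) {u0 : Euc N × Euc k → ℝ} {U f1 f2 : (Euc N × Euc k) × ℝ → ℝ}
    (S : WS N k u0 U f1 f2) {p2 : ℝ} (hp2 : 1 < p2) (hf2 : ∀ q, f2 q = U q ^ p2) (hu0 : Integrable u0)
    {φ : Euc N × Euc k → ℝ≥0∞} {Φ : (Euc N × Euc k) × ℝ → ℝ≥0∞}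
    (hφ : (fun z => ‖u0 z‖ₑ) =ᵐ[volume] φ)
    (hΦ : (fun q => ENNReal.ofReal (f1 q) + ENNReal.ofReal (f2 q) + ENNReal.ofReal (U q)) =ᵐ[volume.restrict (Om N k)] Φ)
    {z0 : Euc N × Euc k} (h0 : 0 < ‖z0.1‖ ^ 2) {R : ℝ} (hR : ‖z0‖ ≤ R)
    {κ : ℝ} (hκ1 : κ < 1 / 2) (hκ0 : 0 < κ) :
    ∃ C : ℝ≥0∞, C ≠ ⊤ ∧ ∀ t0 T0 ε, 0 < t0 → t0 < T0 → 0 < ε → ε ≤ ‖z0.1‖ ^ 2 / 16 → 7 / 4 * ε < t0 →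
      ∫⁻ q in cyl z0 t0 ε, ENNReal.ofReal (U q) ≤
        ENNReal.ofReal (ε ^ (((N : ℝ) + k) / 2) * ε) * (C * GG κ R φ Φ z0 t0) := by
  obtain ⟨C, L, hC, hL, hpt⟩ := pt_bounds hN h0 hR hκ1 hκ0
  refine ⟨ENNReal.ofReal L⁻¹ * ENNReal.ofReal C, ENNReal.mul_ne_top (by simp) (by simp), ?_⟩
  intro t0 T0 ε ht0 hT0 hε hεc hεt
  have hpt' := hpt t0 T0 ε ht0 hT0 hε hεc
  have hT : 0 < 4 * T0 := by linarith
  obtain ⟨b1, b2, b3, b4, e⟩ := weak_full S hp2 hf2 (contDiff_FF (t0 := t0) h0 hT hε) (hcs_FF h0 hT hε)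
  set F := FF z0 t0 (4 * T0) ε with hF
  set ℓ := L * ε ^ (-(((N : ℝ) + k) / 2)) / ε with hℓ
  have hℓ0 : 0 < ℓ := by positivity
  have hcO : cyl z0 t0 ε ⊆ Om N k := by
    rintro q ⟨_, _, c⟩; rw [mem_Om]; linarith
  have hUc : IntegrableOn U (cyl z0 t0 ε) := by
    have := (int_up S hp2 hf2 (isBounded_cyl z0 t0 ε)).1
    rwa [Set.inter_eq_left.2 hcO] at this
  have i1 : IntegrableOn (fun q => U q * err z0 t0 (4 * T0) ε q) (Om N k) := by
    have := b3.add b4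
    refine this.congr (Eventually.of_forall fun q => ?_)
    simp only [err, Pi.add_apply, mul_add]; rfl
  have i2 : IntegrableOn (fun q => U q * (cyl z0 t0 ε).indicator (fun _ => ℓ) q) (Om N k) := by
    have : (fun q => U q * (cyl z0 t0 ε).indicator (fun _ => ℓ) q) =
        (cyl z0 t0 ε).indicator (fun q => U q * ℓ) := by
      funext q; by_cases h : q ∈ cyl z0 t0 ε <;> simp [h]
    rw [this, IntegrableOn, integrable_indicator_iff (measurableSet_cyl _ _ _), IntegrableOn,
      Measure.restrict_restrict (measurableSet_cyl _ _ _), Set.inter_eq_left.2 hcO]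
    exact hUc.mul_const _
  have e2 : ∫ q in Om N k, U q * (cyl z0 t0 ε).indicator (fun _ => ℓ) q = ℓ * ∫ q in cyl z0 t0 ε, U q := by
    have : (fun q => U q * (cyl z0 t0 ε).indicator (fun _ => ℓ) q) =
        (cyl z0 t0 ε).indicator (fun q => ℓ * U q) := by
      funext q; by_cases h : q ∈ cyl z0 t0 ε <;> simp [h, mul_comm]
    rw [this, integral_indicator (measurableSet_cyl _ _ _),
      Measure.restrict_restrict (measurableSet_cyl _ _ _), Set.inter_eq_left.2 hcO, integral_const_mul]
  have e1 : ∫ q in Om N k, U q * err z0 t0 (4 * T0) ε q = - (∫ z, u0 z * F (z, 0)) -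
      (∫ q in Om N k, f1 q * F q) - (∫ q in Om N k, f2 q * F q) := by
    have : ∫ q in Om N k, U q * err z0 t0 (4 * T0) ε q = (∫ q in Om N k, U q * grushin (fun w => F (w, q.2)) q.1) +
      (∫ q in Om N k, U q * deriv (fun s => F (q.1, s)) q.2) := by
      rw [← integral_add b3 b4]
      refine integral_congr_ae (Eventually.of_forall fun q => ?_)
      simp only [err, mul_add]; rfl
    rw [this, e]; ring
  have i0 : Integrable (fun z => u0 z * F (z, 0)) := by
    have hcont : Continuous F := (contDiff_FF (t0 := t0) h0 hT hε).continuous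
    obtain ⟨B, hB⟩ := (hcs_FF (t0 := t0) h0 hT hε).exists_bound_of_continuous hcont
    exact hu0.mul_bdd (c := B) (hcont.comp (by fun_prop : Continuous fun z : Euc N × Euc k => (z, (0:ℝ)))).aestronglyMeasurable
      (Eventually.of_forall fun z => hB _)
  set h : (Euc N × Euc k) × ℝ → ℝ := fun q => U q * (cyl z0 t0 ε).indicator (fun _ => ℓ) q + U q * err z0 t0 (4 * T0) ε q with hh
  have key : ℓ * ∫ q in cyl z0 t0 ε, U q = (∫ z, u0 z * F (z, 0)) +
      ((∫ q in Om N k, f1 q * F q) + (∫ q in Om N k, f2 q * F q) + ∫ q in Om N k, h q) := by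
    rw [hh, integral_add i2 i1, e1, e2]; ring
  have l0 : ∫⁻ z, ENNReal.ofReal (u0 z * F (z, 0)) ≤ ENNReal.ofReal C * (ENNReal.ofReal (t0 ^ (-κ)) *
      (∫⁻ w in Metric.closedBall 0 (2 * R), φ w * kx N k κ (w - z0))) := by
    calc ∫⁻ z, ENNReal.ofReal (u0 z * F (z, 0)) ≤ ∫⁻ z, (Metric.closedBall (0 : Euc N × Euc k) (2 * R)).indicator
          (fun w => ENNReal.ofReal C * ENNReal.ofReal (t0 ^ (-κ)) * (φ w * kx N k κ (w - z0))) z := by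
          refine lintegral_mono_ae ?_
          filter_upwards [hφ] with z hz
          obtain ⟨f0, f1', -⟩ := hpt' (z, 0) le_rfl
          have s1 : ENNReal.ofReal (u0 z * F (z, 0)) ≤ φ z * ENNReal.ofReal (F (z, 0)) := by
            rw [ENNReal.ofReal_mul' f0, ← hz]
            gcongr
            exact Real.ofReal_le_enorm _
          refine s1.trans ((mul_le_mul_right f1' _).trans ?_)
          by_cases hzm : z ∈ Metric.closedBall (0 : Euc N × Euc k) (2 * R)
          · have : ((z, 0) : (Euc N × Euc k) × ℝ) ∈ dom N k R t0 := ⟨hzm, ht0⟩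
            rw [Set.indicator_of_mem hzm, Set.indicator_of_mem this, KK]
            simp only [sub_zero]
            apply le_of_eq; ring
          · have : ((z, 0) : (Euc N × Euc k) × ℝ) ∉ dom N k R t0 := fun h => hzm h.1
            rw [Set.indicator_of_notMem this]; simp
      _ = _ := by
          rw [lintegral_indicator Metric.isClosed_closedBall.measurableSet, lintegral_const_mul', mul_assoc]
          exact ENNReal.mul_ne_top (by simp) (by simp)
  have l1 : (∫⁻ q in Om N k, ENNReal.ofReal (f1 q * F q)) + (∫⁻ q in Om N k, ENNReal.ofReal (f2 q * F q)) +
      (∫⁻ q in Om N k, ENNReal.ofReal (h q)) ≤ ENNReal.ofReal C * ∫⁻ q in dom N k R t0 ∩ Om N k, Φ q * KK κ z0 t0 q := by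
    have m1 : AEMeasurable (fun q => ENNReal.ofReal (f1 q * F q)) (volume.restrict (Om N k)) :=
      b1.aestronglyMeasurable.aemeasurable.ennreal_ofReal
    have m2 : AEMeasurable (fun q => ENNReal.ofReal (f2 q * F q)) (volume.restrict (Om N k)) :=
      b2.aestronglyMeasurable.aemeasurable.ennreal_ofReal
    have m12 : AEMeasurable (fun q => ENNReal.ofReal (f1 q * F q) + ENNReal.ofReal (f2 q * F q)) (volume.restrict (Om N k)) := m1.add m2
    rw [← lintegral_add_left' m1, ← lintegral_add_left' m12]
    calc _ ≤ ∫⁻ q in Om N k, (dom N k R t0).indicator (fun q => ENNReal.ofReal C * (Φ q * KK κ z0 t0 q)) q := by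
          refine lintegral_mono_ae ?_
          filter_upwards [hΦ, ae_restrict_mem (measurableSet_Om N k)] with q hq hqO
          have hq0 := mem_Om.1 hqO
          obtain ⟨c0, c1, c2⟩ := hpt' q hq0.le
          have hUq := S.hU q hq0
          have s3 : ENNReal.ofReal (h q) ≤ ENNReal.ofReal (U q) * (ENNReal.ofReal C * (dom N k R t0).indicator (KK κ z0 t0) q) := by
            rw [hh]
            simp only
            rw [← mul_add, ENNReal.ofReal_mul hUq]
            gcongr
          rw [ENNReal.ofReal_mul' c0, ENNReal.ofReal_mul' c0]
          refine (add_le_add (add_le_add (mul_le_mul_right c1 _) (mul_le_mul_right c1 _)) s3).trans ?_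
          rw [← add_mul, ← add_mul, hq]
          by_cases hd : q ∈ dom N k R t0
          · rw [Set.indicator_of_mem hd, Set.indicator_of_mem hd]; apply le_of_eq; ring
          · rw [Set.indicator_of_notMem hd]; simp
      _ = _ := by
          rw [lintegral_indicator (measurableSet_dom _ _ _ _), lintegral_const_mul' _ _ (by simp),
            Measure.restrict_restrict (measurableSet_dom _ _ _ _)]
  have l2 : ENNReal.ofReal (ℓ * ∫ q in cyl z0 t0 ε, U q) ≤ ENNReal.ofReal C * GG κ R φ Φ z0 t0 := by
    rw [key, GG, mul_add]
    refine ENNReal.ofReal_add_le.trans (add_le_add ((ofReal_integral_le i0).trans l0) ?_)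
    refine le_trans ?_ l1
    refine ENNReal.ofReal_add_le.trans (add_le_add ?_ (ofReal_integral_le (i2.add i1)))
    exact ENNReal.ofReal_add_le.trans (add_le_add (ofReal_integral_le b1) (ofReal_integral_le b2))
  rw [ENNReal.ofReal_mul hℓ0.le, ofReal_integral_eq_lintegral_ofReal hUc] at l2
  · have e3 : ENNReal.ofReal (ε ^ (((N : ℝ) + k) / 2) * ε) * ENNReal.ofReal L⁻¹ * ENNReal.ofReal ℓ = 1 := by
      rw [← ENNReal.ofReal_mul (by positivity), ← ENNReal.ofReal_mul (by positivity), ← ENNReal.ofReal_one]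
      congr 1
      rw [hℓ, Real.rpow_neg hε.le]
      field_simp
    calc _ = ENNReal.ofReal (ε ^ (((N : ℝ) + k) / 2) * ε) * ENNReal.ofReal L⁻¹ *
        (ENNReal.ofReal ℓ * ∫⁻ q in cyl z0 t0 ε, ENNReal.ofReal (U q)) := by rw [← mul_assoc, e3, one_mul]
      _ ≤ ENNReal.ofReal (ε ^ (((N : ℝ) + k) / 2) * ε) * ENNReal.ofReal L⁻¹ * (ENNReal.ofReal C * GG κ R φ Φ z0 t0) := by
        gcongr
      _ = _ := by ring
  · filter_upwards [ae_restrict_mem (measurableSet_cyl z0 t0 ε)] with q hq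
    exact S.hU q (mem_Om.1 (hcO hq))


instance haarE (N k : ℕ) : (volume : Measure (Euc N × Euc k)).IsAddHaarMeasure :=
  Measure.prod.instIsAddHaarMeasure (volume : Measure (Euc N)) (volume : Measure (Euc k))
instance haarEt (N k : ℕ) : (volume : Measure ((Euc N × Euc k) × ℝ)).IsAddHaarMeasure :=
  Measure.prod.instIsAddHaarMeasure (volume : Measure (Euc N × Euc k)) (volume : Measure ℝ)

def Pb (N k : ℕ) (ε : ℝ) : Set ((Euc N × Euc k) × ℝ) :=
  Metric.closedBall 0 (√ε) ×ˢ Set.Icc (-(7 / 4 * ε)) (-(3 / 2 * ε))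

lemma vol_Pb (N k : ℕ) {ε : ℝ} (hε : 0 < ε) : volume (Pb N k ε) =
    ENNReal.ofReal (ε ^ (((N : ℝ) + k) / 2) * ε) * (ENNReal.ofReal (1 / 4) * volume (Metric.ball (0 : Euc N × Euc k) 1)) := by
  rw [Pb, Measure.volume_eq_prod, Measure.prod_prod, Measure.addHaar_closedBall _ _ (Real.sqrt_nonneg _), Real.volume_Icc]
  have h1 : √ε ^ (Module.finrank ℝ (Euc N × Euc k)) = ε ^ (((N : ℝ) + k) / 2) := by
    rw [Module.finrank_prod, finrank_euclideanSpace_fin, finrank_euclideanSpace_fin, ← Real.rpow_natCast,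
      Real.sqrt_eq_rpow, ← Real.rpow_mul hε.le]
    congr 1; push_cast; ring
  have h2 : ENNReal.ofReal (-(3 / 2 * ε) - -(7 / 4 * ε)) = ENNReal.ofReal ε * ENNReal.ofReal (1 / 4) := by
    rw [← ENNReal.ofReal_mul hε.le]; congr 1; ring
  rw [h1, h2, ENNReal.ofReal_mul (by positivity)]
  ring

lemma ptwise {N k : ℕ} (hN : 1 ≤ N) {u0 : Euc N × Euc k → ℝ} {U f1 f2 : (Euc N × Euc k) × ℝ → ℝ}
    (S : WS N k u0 U f1 f2) {p2 : ℝ} (hp2 : 1 < p2) (hf2 : ∀ q, f2 q = U q ^ p2) (hu0 : Integrable u0)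
    {φ : Euc N × Euc k → ℝ≥0∞} {Φ : (Euc N × Euc k) × ℝ → ℝ≥0∞}
    (hφ : (fun z => ‖u0 z‖ₑ) =ᵐ[volume] φ)
    (hΦ : (fun q => ENNReal.ofReal (f1 q) + ENNReal.ofReal (f2 q) + ENNReal.ofReal (U q)) =ᵐ[volume.restrict (Om N k)] Φ)
    (R T0 : ℝ) {κ : ℝ} (hκ1 : κ < 1 / 2) (hκ0 : 0 < κ) :
    ∃ C : Euc N × Euc k → ℝ≥0∞, (∀ z, C z ≠ ⊤) ∧ ∀ᵐ q : (Euc N × Euc k) × ℝ,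
      q.1.1 ≠ 0 ∧ ‖q.1‖ ≤ R ∧ 0 < q.2 ∧ q.2 < T0 → ENNReal.ofReal (U q) ≤ C q.1 * GG κ R φ Φ q.1 q.2 := by
  have H : ∀ z0 : Euc N × Euc k, ∃ C : ℝ≥0∞, C ≠ ⊤ ∧ (z0.1 ≠ 0 → ‖z0‖ ≤ R →
      ∀ t0 T0 ε, 0 < t0 → t0 < T0 → 0 < ε → ε ≤ ‖z0.1‖ ^ 2 / 16 → 7 / 4 * ε < t0 →
      ∫⁻ q in cyl z0 t0 ε, ENNReal.ofReal (U q) ≤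
        ENNReal.ofReal (ε ^ (((N : ℝ) + k) / 2) * ε) * (C * GG κ R φ Φ z0 t0)) := by
    intro z0
    by_cases hz : z0.1 ≠ 0 ∧ ‖z0‖ ≤ R
    · obtain ⟨C, h1, h2⟩ := cyl_bound hN S hp2 hf2 hu0 hφ hΦ (z0 := z0) (by have := norm_pos_iff.2 hz.1; positivity) hz.2 hκ1 hκ0
      exact ⟨C, h1, fun _ _ => h2⟩
    · exact ⟨0, by simp, fun h1 h2 => absurd ⟨h1, h2⟩ hz⟩
  choose C hC hC2 using H
  set v1 := ENNReal.ofReal (1 / 4) * volume (Metric.ball (0 : Euc N × Euc k) 1) with hv1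
  have hv0 : v1 ≠ 0 := mul_ne_zero (by simp) (Metric.measure_ball_pos _ _ one_pos).ne'
  have hvt : v1 ≠ ⊤ := ENNReal.mul_ne_top (by simp) measure_ball_lt_top.ne
  refine ⟨fun z => v1⁻¹ * C z, fun z => ENNReal.mul_ne_top (ENNReal.inv_ne_top.2 hv0) (hC z), ?_⟩
  set B : Set ((Euc N × Euc k) × ℝ) := Metric.closedBall 0 (R + 1) ×ˢ Set.Ioo 0 T0 with hB
  have hBm : MeasurableSet B := Metric.isClosed_closedBall.measurableSet.prod measurableSet_Ioo
  have hBO : B ⊆ Om N k := fun q hq => mem_Om.2 hq.2.1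
  have hBi : IntegrableOn U B := by
    have hb : Bornology.IsBounded B := ((isCompact_closedBall (0 : Euc N × Euc k) (R + 1)).isBounded.prod
      (isCompact_Icc (a := (0:ℝ)) (b := T0)).isBounded).subset (Set.prod_mono subset_rfl Set.Ioo_subset_Icc_self)
    have := (int_up S hp2 hf2 hb).1
    rwa [Set.inter_eq_left.2 hBO] at this
  have hBi' : Integrable (B.indicator U) := (integrable_indicator_iff hBm).2 hBi
  set g := hBi'.aestronglyMeasurable.mk _ with hg
  have hgm : Measurable g := hBi'.aestronglyMeasurable.stronglyMeasurable_mk.measurable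
  have hge : B.indicator U =ᵐ[volume] g := hBi'.aestronglyMeasurable.ae_eq_mk
  have hVe : ∀ᵐ q, q ∈ B → max (g q) 0 = U q := by
    filter_upwards [hge] with q hq hqB
    rw [Set.indicator_of_mem hqB] at hq
    rw [← hq, max_eq_left (S.hU q (mem_Om.1 (hBO hqB)))]
  have hVi : Integrable (fun q => max (g q) 0) := (hBi'.congr hge).pos_part
  have main := avg_lim volume hVi (hgm.max measurable_const) (fun q => le_max_right _ _)
    (P := fun n : ℕ => Pb N k (1 / ((n : ℝ) + 1) ^ 2))
    (fun n => Metric.isClosed_closedBall.measurableSet.prod measurableSet_Icc)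
    (fun n => by
      rw [vol_Pb _ _ (by positivity)]
      refine mul_ne_zero ?_ hv0
      rw [Ne, ENNReal.ofReal_eq_zero, not_le]; positivity)
    (fun n => by
      rw [vol_Pb _ _ (by positivity)]
      exact ENNReal.mul_ne_top (by simp) hvt)
    (δ := fun n => 2 * (1 / ((n : ℝ) + 1)))
    (by simpa using tendsto_one_div_add_atTop_nhds_zero_nat.const_mul (2 : ℝ))
    (by
      rintro n v ⟨h1, h2⟩
      have e1 : √(1 / ((n : ℝ) + 1) ^ 2) = 1 / ((n : ℝ) + 1) := by
        rw [← one_div_pow, Real.sqrt_sq (by positivity)]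
      have e2 : 1 / ((n : ℝ) + 1) ≤ 1 := by
        rw [div_le_one (by positivity)]; linarith [Nat.cast_nonneg (α := ℝ) n]
      have e3 : 1 / ((n : ℝ) + 1) ^ 2 ≤ 1 / ((n : ℝ) + 1) := by
        rw [← one_div_pow, sq]; nlinarith [show 0 < 1 / ((n : ℝ) + 1) by positivity]
      have e4 : 0 < 1 / ((n : ℝ) + 1) ^ 2 := by positivity
      rw [mem_closedBall_zero_iff, e1] at h1
      rw [Prod.norm_def]
      refine max_le (by linarith [show 0 < 1 / ((n : ℝ) + 1) by positivity]) ?_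
      rw [Real.norm_eq_abs, abs_le]
      constructor <;> linarith [h2.1, h2.2])
    (A := {q | q.1.1 ≠ 0 ∧ ‖q.1‖ ≤ R ∧ 0 < q.2 ∧ q.2 < T0})
    (W := fun q => v1⁻¹ * C q.1 * GG κ R φ Φ q.1 q.2)
    (by
      rintro q ⟨q1, q2, q3, q4⟩
      have hlim : Tendsto (fun n : ℕ => 1 / ((n : ℝ) + 1) ^ 2) atTop (nhds 0) := by
        have := (tendsto_one_div_add_atTop_nhds_zero_nat (𝕜 := ℝ)).pow 2
        simpa [one_div_pow] using this
      have hz : 0 < ‖q.1.1‖ ^ 2 / 16 := by have := norm_pos_iff.2 q1; positivity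
      filter_upwards [hlim.eventually_lt_const hz, hlim.eventually_lt_const (show 0 < q.2 / 2 by linarith),
        hlim.eventually_lt_const one_pos] with n n1 n2 n3
      have n0 : 0 < 1 / ((n : ℝ) + 1) ^ 2 := by positivity
      set ε := 1 / ((n : ℝ) + 1) ^ 2
      have pre : Pb N k ε = (fun v => v + q) ⁻¹' cyl q.1 q.2 ε := by
        ext v
        simp only [Pb, cyl, Set.mem_prod, mem_closedBall_zero_iff, Set.mem_Icc, Set.mem_preimage, Set.mem_ofPred_eq,
          Prod.fst_add, Prod.snd_add, add_sub_cancel_right]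
        constructor
        · rintro ⟨a, b, c⟩; exact ⟨a, by linarith, by linarith⟩
        · rintro ⟨a, b, c⟩; exact ⟨a, by linarith, by linarith⟩
      have cB : cyl q.1 q.2 ε ⊆ B := by
        rintro w ⟨a, b, c⟩
        refine ⟨?_, by linarith, by linarith⟩
        have : √ε ≤ 1 := Real.sqrt_le_one.2 n3.le
        rw [mem_closedBall_zero_iff]
        calc ‖w.1‖ = ‖(w.1 - q.1) + q.1‖ := by rw [sub_add_cancel]
          _ ≤ ‖w.1 - q.1‖ + ‖q.1‖ := norm_add_le _ _
          _ ≤ _ := by linarith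
      have s1 : ∫⁻ v in Pb N k ε, ENNReal.ofReal (max (g (v + q)) 0) = ∫⁻ w in cyl q.1 q.2 ε, ENNReal.ofReal (U w) := by
        rw [pre, (measurePreserving_add_right volume q).setLIntegral_comp_preimage_emb
          (measurableEmbedding_addRight q) (fun w => ENNReal.ofReal (max (g w) 0))]
        refine setLIntegral_congr_fun_ae (measurableSet_cyl _ _ _) ?_
        filter_upwards [hVe] with w hw hwc
        rw [hw (cB hwc)]
      rw [s1]
      refine (hC2 q.1 q1 q2 q.2 T0 ε q3 q4 n0 n1.le (by linarith)).trans (le_of_eq ?_)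
      rw [vol_Pb _ _ n0, ← hv1]
      rw [mul_assoc (ENNReal.ofReal _), ← mul_assoc v1, ← mul_assoc v1, ENNReal.mul_inv_cancel hv0 hvt, one_mul])
  filter_upwards [main, hVe] with q h1 h2 h3
  have : q ∈ B := ⟨by rw [mem_closedBall_zero_iff]; linarith [h3.2.1], h3.2.2.1, h3.2.2.2⟩
  have h4 := h1 h3
  rwa [h2 this] at h4


lemma lint_rpow {r e : ℝ} (he : -1 < e) : ∫⁻ y in Set.Ioo 0 r, ENNReal.ofReal (y ^ e) < ⊤ := by
  have h : IntegrableOn (fun y : ℝ => y ^ e) (Set.Ioo 0 r) := by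
    rcases le_total r 0 with h | h
    · rw [Set.Ioo_eq_empty (by linarith)]; exact integrableOn_empty
    · exact (((intervalIntegrable_iff_integrableOn_Ioc_of_le h).1 (intervalIntegral.intervalIntegrable_rpow' he)).mono_set
        Set.Ioo_subset_Ioc_self)
  exact lt_of_le_of_lt (lintegral_mono fun y => Real.ofReal_le_enorm _) h.2

lemma lint_kx {N k : ℕ} (hN : 1 ≤ N) {κ : ℝ} (hκ0 : 0 < κ) (hκ1 : κ < 1 / 2) (r : ℝ) :
    ∫⁻ v in Metric.closedBall (0 : Euc N × Euc k) r, kx N k κ v < ⊤ := by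
  haveI : Nonempty (Fin N) := ⟨⟨0, hN⟩⟩
  haveI : Nontrivial (Euc N) := inferInstance
  haveI : Nontrivial (Euc N × Euc k) := inferInstance
  set f : ℝ → ℝ := (Set.Iic r).indicator fun y => y ^ (-(((N : ℝ) + k) - 2 * κ)) with hf
  have hi : Integrable (fun v : Euc N × Euc k => f ‖v‖) := by
    rw [integrable_fun_norm_addHaar]
    have hd : Module.finrank ℝ (Euc N × Euc k) = N + k := by
      rw [Module.finrank_prod, finrank_euclideanSpace_fin, finrank_euclideanSpace_fin]
    rw [hd]
    have e : Set.EqOn (fun y => y ^ (N + k - 1) • f y) ((Set.Iic r).indicator fun y => y ^ (2 * κ - 1)) (Set.Ioi 0) := by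
      intro y hy
      have hy' : 0 < y := hy
      by_cases hr : y ∈ Set.Iic r
      · simp only [hf, Set.indicator_of_mem hr, smul_eq_mul]
        rw [← Real.rpow_natCast, ← Real.rpow_add hy', Nat.cast_sub (by omega)]
        congr 1; push_cast; ring
      · simp only [hf, Set.indicator_of_notMem hr, smul_zero]
    rw [integrableOn_congr_fun e measurableSet_Ioi, IntegrableOn, integrable_indicator_iff measurableSet_Iic,
      IntegrableOn, Measure.restrict_restrict measurableSet_Iic]
    have : Set.Iic r ∩ Set.Ioi 0 = Set.Ioc 0 r := by ext; simp [and_comm]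
    rw [this]
    rcases le_total r 0 with h | h
    · rw [Set.Ioc_eq_empty (by linarith)]; exact integrableOn_empty
    · exact (intervalIntegrable_iff_integrableOn_Ioc_of_le h).1 (intervalIntegral.intervalIntegrable_rpow' (by linarith))
  refine lt_of_le_of_lt ?_ hi.2
  rw [← lintegral_indicator Metric.isClosed_closedBall.measurableSet]
  refine lintegral_mono_ae ?_
  have h0 : ∀ᵐ v : Euc N × Euc k, v ≠ 0 := by
    simp [ae_iff]
  filter_upwards [h0] with v hv
  by_cases hvr : v ∈ Metric.closedBall (0 : Euc N × Euc k) r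
  · rw [Set.indicator_of_mem hvr]
    have hr : ‖v‖ ∈ Set.Iic r := by simpa using hvr
    simp only [hf, Set.indicator_of_mem hr, kx]
    rw [← ofReal_norm, ← ofReal_norm, ENNReal.ofReal_rpow_of_pos (norm_pos_iff.2 hv)]
    exact ENNReal.ofReal_le_ofReal (le_abs_self _)
  · rw [Set.indicator_of_notMem hvr]; exact zero_le

lemma ae_fin {X : Type*} [MeasurableSpace X] {N k : ℕ} (hN : 1 ≤ N) {κ : ℝ} (hκ0 : 0 < κ) (hκ1 : κ < 1 / 2)
    {μ : Measure X} [SFinite μ] {g : X → ℝ≥0∞} (hg : Measurable g) (hgi : ∫⁻ x, g x ∂μ < ⊤) {pj : X → Euc N × Euc k}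
    (hpi : Measurable pj) {R : ℝ} (hpiR : ∀ᵐ x ∂μ, ‖pj x‖ ≤ 2 * R) :
    ∀ᵐ z : Euc N × Euc k, ‖z‖ ≤ R → ∫⁻ x, g x * kx N k κ (pj x - z) ∂μ < ⊤ := by
  have hm : Measurable (fun y : (Euc N × Euc k) × X => g y.2 * kx N k κ (pj y.2 - y.1)) :=
    (hg.comp measurable_snd).mul ((measurable_kx N k κ).comp ((hpi.comp measurable_snd).sub measurable_fst))
  have h1 : ∫⁻ z in Metric.closedBall 0 R, ∫⁻ x, g x * kx N k κ (pj x - z) ∂μ < ⊤ := by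
    rw [lintegral_lintegral_swap hm.aemeasurable]
    have : ∀ᵐ x ∂μ, ∫⁻ z in Metric.closedBall 0 R, g x * kx N k κ (pj x - z) ≤
        g x * ∫⁻ v in Metric.closedBall (0 : Euc N × Euc k) (3 * R), kx N k κ v := by
      filter_upwards [hpiR] with x hx
      have hmk : Measurable (fun z => kx N k κ (pj x - z)) :=
        (measurable_kx N k κ).comp (measurable_const.sub measurable_id)
      rw [lintegral_const_mul _ hmk]
      refine mul_le_mul_right ?_ (g x)
      rw [← lintegral_indicator Metric.isClosed_closedBall.measurableSet,
        ← lintegral_indicator Metric.isClosed_closedBall.measurableSet,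
        ← lintegral_sub_right_eq_self (fun v => (Metric.closedBall (0 : Euc N × Euc k) (3 * R)).indicator (kx N k κ) v) (pj x)]
      refine lintegral_mono fun z => ?_
      by_cases hz : z ∈ Metric.closedBall (0 : Euc N × Euc k) R
      · rw [Set.indicator_of_mem hz, Set.indicator_of_mem]
        · rw [kx, kx, enorm_sub_rev]
        · rw [mem_closedBall_zero_iff] at hz ⊢
          linarith [norm_sub_le z (pj x)]
      · rw [Set.indicator_of_notMem hz]; exact zero_le
    refine (lintegral_mono_ae this).trans_lt ?_
    rw [lintegral_mul_const _ hg]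
    exact ENNReal.mul_lt_top hgi (lint_kx hN hκ0 hκ1 _)
  have h2 := ae_lt_top (Measurable.lintegral_prod_right' hm) h1.ne
  rw [ae_restrict_iff' Metric.isClosed_closedBall.measurableSet] at h2
  filter_upwards [h2] with z hz hzR
  exact hz (by simpa using hzR)

lemma jensen_enn {X : Type*} [MeasurableSpace X] {μ : Measure X} {d g : X → ℝ≥0∞} (hd : Measurable d)
    (hg : Measurable g) {p : ℝ} (hp : 1 < p) :
    (∫⁻ x, d x * g x ∂μ) ^ p ≤ (∫⁻ x, d x ∂μ) ^ (p - 1) * ∫⁻ x, d x * g x ^ p ∂μ := by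
  have hpq := Real.HolderConjugate.conjExponent hp
  set ν := μ.withDensity d
  have e1 : ∫⁻ x, d x * g x ∂μ = ∫⁻ x, 1 * g x ∂ν := by
    simp only [one_mul]
    rw [lintegral_withDensity_eq_lintegral_mul _ hd hg]; rfl
  have e2 : ∫⁻ x, d x * g x ^ p ∂μ = ∫⁻ x, g x ^ p ∂ν := by
    rw [lintegral_withDensity_eq_lintegral_mul _ hd (hg.pow_const _)]; rfl
  have e3 : ∫⁻ x, d x ∂μ = ∫⁻ x, (1 : ℝ≥0∞) ^ (p.conjExponent) ∂ν := by
    simp only [ENNReal.one_rpow]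
    rw [lintegral_withDensity_eq_lintegral_mul _ hd measurable_const]; simp
  rw [e1, e2, e3]
  have h := ENNReal.lintegral_mul_le_Lp_mul_Lq ν hpq.symm aemeasurable_const (f := fun _ => 1) hg.aemeasurable
  have h' := ENNReal.rpow_le_rpow h (by linarith : 0 ≤ p)
  refine le_trans h' ?_
  rw [ENNReal.mul_rpow_of_nonneg _ _ (by linarith), ← ENNReal.rpow_mul, ← ENNReal.rpow_mul]
  have a1 : 1 / p.conjExponent * p = p - 1 := by
    rw [Real.conjExponent]; field_simp
  have a2 : 1 / p * p = 1 := by field_simp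
  rw [a1, a2, ENNReal.rpow_one]


lemma conv_fin {X : Type*} [MeasurableSpace X] {μ : Measure X} [SFinite μ] {d : X → ℝ≥0∞} (hd : Measurable d)
    (hdi : ∫⁻ x, d x ∂μ < ⊤) {s : X → ℝ} (hs : Measurable s) (hs0 : ∀ᵐ x ∂μ, 0 < s x) {p κ : ℝ} (hp : 1 < p)
    (hκ : κ * p < 1) (T : ℝ) :
    ∫⁻ t in Set.Ioo 0 T, (∫⁻ x, d x * (if s x < t then ENNReal.ofReal ((t - s x) ^ (-κ)) else 0) ∂μ) ^ p < ⊤ := by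
  have hm : Measurable (fun y : ℝ × X => (if s y.2 < y.1 then ENNReal.ofReal ((y.1 - s y.2) ^ (-κ)) else 0 : ℝ≥0∞)) := by
    refine Measurable.ite (measurableSet_lt (hs.comp measurable_snd) measurable_fst) ?_ measurable_const
    exact ((measurable_fst.sub (hs.comp measurable_snd)).pow_const _).ennreal_ofReal
  have hm2 : Measurable (fun y : ℝ × X => d y.2 * (if s y.2 < y.1 then ENNReal.ofReal ((y.1 - s y.2) ^ (-κ)) else 0 : ℝ≥0∞) ^ p) :=
    (hd.comp measurable_snd).mul (hm.pow_const _)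
  calc _ ≤ ∫⁻ t in Set.Ioo 0 T, (∫⁻ x, d x ∂μ) ^ (p - 1) * ∫⁻ x, d x * (if s x < t then ENNReal.ofReal ((t - s x) ^ (-κ)) else 0) ^ p ∂μ := by
        refine lintegral_mono fun t => jensen_enn hd ?_ hp
        exact hm.comp (measurable_const.prodMk measurable_id)
    _ = (∫⁻ x, d x ∂μ) ^ (p - 1) * ∫⁻ t in Set.Ioo 0 T, ∫⁻ x, d x * (if s x < t then ENNReal.ofReal ((t - s x) ^ (-κ)) else 0) ^ p ∂μ := by
        rw [lintegral_const_mul _ (Measurable.lintegral_prod_right' hm2)]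
    _ = (∫⁻ x, d x ∂μ) ^ (p - 1) * ∫⁻ x, (∫⁻ t in Set.Ioo 0 T, d x * (if s x < t then ENNReal.ofReal ((t - s x) ^ (-κ)) else 0) ^ p) ∂μ := by
        rw [lintegral_lintegral_swap hm2.aemeasurable]
    _ ≤ (∫⁻ x, d x ∂μ) ^ (p - 1) * ∫⁻ x, d x * (∫⁻ y in Set.Ioo 0 T, ENNReal.ofReal (y ^ (-(κ * p)))) ∂μ := by
        refine mul_le_mul_right ?_ _
        refine lintegral_mono_ae ?_
        filter_upwards [hs0] with x hx
        have hmx : Measurable (fun t : ℝ => (if s x < t then ENNReal.ofReal ((t - s x) ^ (-κ)) else 0 : ℝ≥0∞) ^ p) :=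
          (hm.comp (measurable_id.prodMk measurable_const)).pow_const _
        rw [lintegral_const_mul _ hmx]
        refine mul_le_mul_right ?_ _
        rw [← lintegral_indicator measurableSet_Ioo, ← lintegral_indicator measurableSet_Ioo,
          ← lintegral_sub_right_eq_self (fun y => (Set.Ioo 0 T).indicator (fun y => ENNReal.ofReal (y ^ (-(κ * p)))) y) (s x)]
        refine lintegral_mono fun t => ?_
        by_cases ht : t ∈ Set.Ioo 0 T
        swap
        · rw [Set.indicator_of_notMem ht]; exact zero_le
        rw [Set.indicator_of_mem ht]
        by_cases h : s x < t
        · have : t - s x ∈ Set.Ioo 0 T := ⟨by linarith, by linarith [ht.2]⟩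
          rw [if_pos h, Set.indicator_of_mem this, ENNReal.ofReal_rpow_of_nonneg (Real.rpow_nonneg this.1.le _) (by linarith),
            ← Real.rpow_mul this.1.le, neg_mul]
        · rw [if_neg h, ENNReal.zero_rpow_of_pos (by linarith)]; exact zero_le
    _ < ⊤ := by
        rw [lintegral_mul_const _ hd]
        exact ENNReal.mul_lt_top (ENNReal.rpow_lt_top_of_nonneg (by linarith) hdi.ne)
          (ENNReal.mul_lt_top hdi (lint_rpow (by linarith)))

lemma ae_fst_ne {N k : ℕ} (hN : 1 ≤ N) : ∀ᵐ z : Euc N × Euc k, z.1 ≠ 0 := by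
  haveI : Nonempty (Fin N) := ⟨⟨0, hN⟩⟩
  haveI : Nontrivial (Euc N) := inferInstance
  have h : ∀ᵐ x : Euc N, x ≠ 0 := by simp [ae_iff]
  exact Measure.quasiMeasurePreserving_fst.ae h

lemma key_fin {N k : ℕ} (hN : 1 ≤ N) {u0 : Euc N × Euc k → ℝ} {U f1 f2 : (Euc N × Euc k) × ℝ → ℝ}
    (S : WS N k u0 U f1 f2) {p1 p2 : ℝ} (hp1 : 1 < p1) (hp2 : 1 < p2) (hf2 : ∀ q, f2 q = U q ^ p2) (hu0 : Integrable u0) :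
    ∀ᵐ z, ∀ T, ∫⁻ s in Set.Ioo 0 T, ENNReal.ofReal (U (z, s)) ^ p1 < ⊤ := by
  suffices H : ∀ n : ℕ, ∀ᵐ z, ‖z‖ ≤ (n : ℝ) → ∫⁻ s in Set.Ioo 0 (n : ℝ), ENNReal.ofReal (U (z, s)) ^ p1 < ⊤ by
    filter_upwards [ae_all_iff.2 H] with z hz T
    obtain ⟨n, hn⟩ := exists_nat_ge (max ‖z‖ T)
    refine lt_of_le_of_lt (lintegral_mono_set (Set.Ioo_subset_Ioo_right ((le_max_right _ _).trans hn)))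
      (hz n ((le_max_left _ _).trans hn))
  intro n
  generalize (n : ℝ) = R
  obtain ⟨κ, hκ⟩ : ∃ κ, κ = 1 / (2 * p1) := ⟨_, rfl⟩
  have hκ0 : 0 < κ := by rw [hκ]; positivity
  have hκp : κ * p1 = 1 / 2 := by rw [hκ]; field_simp
  have hκ1 : κ < 1 / 2 := by nlinarith
  have m0 : AEMeasurable (fun z => ‖u0 z‖ₑ) := hu0.aestronglyMeasurable.enorm
  have mO : ∀ {f : (Euc N × Euc k) × ℝ → ℝ}, LocallyIntegrableOn f (Om N k) → AEMeasurable (fun q => ENNReal.ofReal (f q)) (volume.restrict (Om N k)) :=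
    fun h => (h.aestronglyMeasurable).aemeasurable.ennreal_ofReal
  have m1 : AEMeasurable (fun q => ENNReal.ofReal (f1 q) + ENNReal.ofReal (f2 q) + ENNReal.ofReal (U q)) (volume.restrict (Om N k)) :=
    ((mO S.i1).add (mO S.i2)).add (mO S.iU)
  obtain ⟨φ, hφm, hφ⟩ := m0
  obtain ⟨Φ, hΦm, hΦ⟩ := m1
  obtain ⟨C, hC, hpw⟩ := ptwise hN S hp2 hf2 hu0 hφ hΦ R R hκ1 hκ0
  have hφi : ∫⁻ w in Metric.closedBall 0 (2 * R), φ w < ⊤ := by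
    refine lt_of_le_of_lt (setLIntegral_le_lintegral _ _) ?_
    rw [← lintegral_congr_ae hφ]; exact hu0.2
  set D : Set ((Euc N × Euc k) × ℝ) := Metric.closedBall 0 (2 * R) ×ˢ Set.Ioo 0 R with hD
  have hDm : MeasurableSet D := Metric.isClosed_closedBall.measurableSet.prod measurableSet_Ioo
  have hDO : D ⊆ Om N k := fun q hq => mem_Om.2 hq.2.1
  have hΦi : ∫⁻ q in D, Φ q < ⊤ := by
    have hb : Bornology.IsBounded D := ((isCompact_closedBall (0 : Euc N × Euc k) (2 * R)).isBounded.prod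
      (isCompact_Icc (a := (0:ℝ)) (b := R)).isBounded).subset (Set.prod_mono subset_rfl Set.Ioo_subset_Icc_self)
    obtain ⟨a1, a2, a3⟩ := int_up S hp2 hf2 hb
    rw [Set.inter_eq_left.2 hDO] at a1 a2 a3
    have : ∫⁻ q in D, Φ q ≤ ∫⁻ q in D, ((‖f1 q‖ₑ + ‖f2 q‖ₑ) + ‖U q‖ₑ) := by
      refine lintegral_mono_ae ?_
      filter_upwards [ae_restrict_of_ae_restrict_of_subset hDO hΦ] with q hq
      rw [← hq]
      gcongr <;> exact Real.ofReal_le_enorm _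
    refine this.trans_lt ?_
    rw [lintegral_add_right' _ a1.aestronglyMeasurable.enorm, lintegral_add_right' _ a3.aestronglyMeasurable.enorm]
    exact ENNReal.add_lt_top.2 ⟨ENNReal.add_lt_top.2 ⟨a2.2, a3.2⟩, a1.2⟩
  have A1 := ae_fin hN hκ0 hκ1 (μ := volume.restrict (Metric.closedBall (0 : Euc N × Euc k) (2 * R))) hφm hφi
    (pj := id) measurable_id (R := R) (by
      filter_upwards [ae_restrict_mem Metric.isClosed_closedBall.measurableSet] with x hx
      simpa using hx)
  have A2 := ae_fin hN hκ0 hκ1 (μ := volume.restrict D) hΦm hΦi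
    (pj := Prod.fst) measurable_fst (R := R) (by
      filter_upwards [ae_restrict_mem hDm] with x hx
      simpa using hx.1)
  have A3 : ∀ᵐ z : Euc N × Euc k, ∀ᵐ t : ℝ, z.1 ≠ 0 ∧ ‖z‖ ≤ R ∧ 0 < t ∧ t < R → ENNReal.ofReal (U (z, t)) ≤ C z * GG κ R φ Φ z t :=
    Measure.ae_ae_of_ae_prod hpw
  filter_upwards [A1, A2, A3, ae_fst_ne hN] with z z1 z2 z3 z4 z5
  have z1 := z1 z5
  have z2 := z2 z5
  have hdm : Measurable fun q : (Euc N × Euc k) × ℝ => Φ q * kx N k κ (q.1 - z) :=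
    hΦm.mul ((measurable_kx N k κ).comp (measurable_fst.sub measurable_const))
  have key := conv_fin (μ := volume.restrict D) hdm z2 (s := Prod.snd) measurable_snd (by
      filter_upwards [ae_restrict_mem hDm] with x hx
      exact hx.2.1) hp1 (by rw [hκp]; norm_num : κ * p1 < 1) R
  set H : ℝ → ℝ≥0∞ := fun t => ∫⁻ x in D, Φ x * kx N k κ (x.1 - z) * (if x.2 < t then ENNReal.ofReal ((t - x.2) ^ (-κ)) else 0) with hH
  obtain ⟨a, ha⟩ : ∃ a, a = ∫⁻ w in Metric.closedBall 0 (2 * R), φ w * kx N k κ (w - z) := ⟨_, rfl⟩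
  have ha' : a < ⊤ := by rw [ha]; exact z1
  have hG : ∀ t, 0 < t → t < R → GG κ R φ Φ z t ≤ ENNReal.ofReal (t ^ (-κ)) * a + H t := by
    intro t ht0 htR
    rw [GG, ← ha]
    refine add_le_add le_rfl ?_
    simp only [hH]
    rw [← lintegral_indicator ((measurableSet_dom N k R t).inter (measurableSet_Om N k)), ← lintegral_indicator hDm]
    refine lintegral_mono fun q => ?_
    by_cases hq : q ∈ dom N k R t ∩ Om N k
    swap
    · rw [Set.indicator_of_notMem hq]; exact zero_le
    rw [Set.indicator_of_mem hq]
    have hq2 : q.2 < t := hq.1.2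
    have : q ∈ D := ⟨hq.1.1, mem_Om.1 hq.2, by linarith⟩
    rw [Set.indicator_of_mem this, if_pos hq2, KK]
    apply le_of_eq; ring
  have hb : ∫⁻ s in Set.Ioo 0 R, ENNReal.ofReal (U (z, s)) ^ p1 ≤
      ∫⁻ s in Set.Ioo 0 R, C z ^ p1 * (2 ^ (p1 - 1) * (a ^ p1 * ENNReal.ofReal (s ^ (-(1 / 2 : ℝ))) + H s ^ p1)) := by
    refine lintegral_mono_ae ?_
    filter_upwards [ae_restrict_of_ae z3, ae_restrict_mem measurableSet_Ioo] with s hs hs2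
    calc ENNReal.ofReal (U (z, s)) ^ p1 ≤ (C z * (ENNReal.ofReal (s ^ (-κ)) * a + H s)) ^ p1 := by
          gcongr
          refine (hs ⟨z4, z5, hs2.1, hs2.2⟩).trans ?_
          gcongr
          exact hG s hs2.1 hs2.2
      _ = C z ^ p1 * (ENNReal.ofReal (s ^ (-κ)) * a + H s) ^ p1 := ENNReal.mul_rpow_of_nonneg _ _ (by linarith)
      _ ≤ C z ^ p1 * (2 ^ (p1 - 1) * ((ENNReal.ofReal (s ^ (-κ)) * a) ^ p1 + H s ^ p1)) := by
          gcongr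
          exact ENNReal.rpow_add_le_mul_rpow_add_rpow _ _ hp1.le
      _ = _ := by
          rw [ENNReal.mul_rpow_of_nonneg _ _ (by linarith), ENNReal.ofReal_rpow_of_nonneg (Real.rpow_nonneg hs2.1.le _) (by linarith),
            ← Real.rpow_mul hs2.1.le, neg_mul, hκp, mul_comm (a ^ p1)]
  refine hb.trans_lt ?_
  have hpt : a ^ p1 < ⊤ := ENNReal.rpow_lt_top_of_nonneg (by linarith) ha'.ne
  have hcp : C z ^ p1 < ⊤ := ENNReal.rpow_lt_top_of_nonneg (by linarith) (hC z)
  have h2p : (2 : ℝ≥0∞) ^ (p1 - 1) < ⊤ := ENNReal.rpow_lt_top_of_nonneg (by linarith) (by simp)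
  have hms : Measurable fun s : ℝ => a ^ p1 * ENNReal.ofReal (s ^ (-(1 / 2 : ℝ))) := by fun_prop
  rw [lintegral_const_mul' _ _ hcp.ne, lintegral_const_mul' _ _ h2p.ne, lintegral_add_left hms, lintegral_const_mul' _ _ hpt.ne]
  refine ENNReal.mul_lt_top hcp (ENNReal.mul_lt_top h2p (ENNReal.add_lt_top.2 ⟨ENNReal.mul_lt_top hpt (lint_rpow (by norm_num)), key⟩))


def wk {N k : ℕ} (R T : ℝ) (q : (Euc N × Euc k) × ℝ) : ℝ := kk (gR R q.1) * kk (q.2 / T)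
def Dset (N k : ℕ) (R T : ℝ) : Set ((Euc N × Euc k) × ℝ) := {q | 1 / 2 ≤ gR R q.1 ∨ T / 2 ≤ q.2}
def tst {N k : ℕ} (m : ℕ) (R T : ℝ) (q : (Euc N × Euc k) × ℝ) : ℝ :=
  psiR m R q.1 * (hh m (q.2 / T) * hh m (-q.2))
def YY {N k : ℕ} (p : ℝ) (m : ℕ) (R T : ℝ) (U : (Euc N × Euc k) × ℝ → ℝ) (q : (Euc N × Euc k) × ℝ) : ℝ≥0∞ :=
  ENNReal.ofReal (U q) ^ p * ENNReal.ofReal (wk R T q ^ (m + 4))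

lemma wk_nonneg {N k : ℕ} (R T : ℝ) (q : (Euc N × Euc k) × ℝ) : 0 ≤ wk R T q := mul_nonneg (kk_nonneg _) (kk_nonneg _)
lemma wk_le_one {N k : ℕ} (R T : ℝ) (q : (Euc N × Euc k) × ℝ) : wk R T q ≤ 1 :=
  mul_le_one₀ (kk_le_one _) (kk_nonneg _) (kk_le_one _)
lemma continuous_wk {N k : ℕ} (R T : ℝ) : Continuous (wk R T : (Euc N × Euc k) × ℝ → ℝ) :=
  (continuous_kk.comp ((contDiff_gR R).continuous.comp continuous_fst)).mul
    (continuous_kk.comp (continuous_snd.div_const _))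
lemma measurableSet_Dset (N k : ℕ) (R T : ℝ) : MeasurableSet (Dset N k R T) := by
  apply IsClosed.measurableSet
  exact (isClosed_le continuous_const ((contDiff_gR R).continuous.comp continuous_fst)).union
    (isClosed_le continuous_const continuous_snd)

lemma tst_wk {N k : ℕ} (m : ℕ) (R T : ℝ) {q : (Euc N × Euc k) × ℝ} (hq : 0 ≤ q.2) :
    tst m R T q = wk R T q ^ (m + 3) := by
  rw [tst, hh_eq_one m (by linarith : -q.2 ≤ 1 / 2), wk, psiR, hh, hh]; ring

lemma contDiff_tst {N k : ℕ} (m : ℕ) (R T : ℝ) : ContDiff ℝ 2 (tst m R T : (Euc N × Euc k) × ℝ → ℝ) :=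
  contDiff_prodTest m R ((contDiff_hh_div m T).mul ((contDiff_hh m).comp contDiff_neg))

lemma hcs_tst {N k : ℕ} (m : ℕ) {R T : ℝ} (hR : 0 < R) (hT : 0 < T) :
    HasCompactSupport (tst m R T : (Euc N × Euc k) × ℝ → ℝ) := by
  refine hasCompactSupport_prodTest m hR (θ := fun t => hh m (t / T) * hh m (-t)) (a := -1) (b := T) fun t ht => ?_
  rw [Set.mem_Icc, not_and_or, not_le, not_le] at ht
  rcases ht with h | h
  · simp only [hh_eq_zero m (by linarith : 1 ≤ -t), mul_zero]
  · simp only [hh_eq_zero m ((one_le_div hT).2 h.le), zero_mul]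

def Cerr (N k m : ℕ) : ℝ := CL N k m + 100 * ((m : ℝ) + 3) ^ 2

lemma tst_err {N k : ℕ} (m : ℕ) {R T : ℝ} (hR : 0 < R) (hT : 0 < T) {q : (Euc N × Euc k) × ℝ} (hq : 0 < q.2) :
    |grushin (fun w => tst m R T (w, q.2)) q.1| + |deriv (fun s => tst m R T (q.1, s)) q.2| ≤
      Cerr N k m * ((R ^ 2)⁻¹ + T⁻¹) * (Dset N k R T).indicator (fun q => wk R T q ^ (m + 1)) q := by
  have e1 : grushin (fun w => tst m R T (w, q.2)) q.1 = grushin (psiR m R) q.1 * hh m (q.2 / T) := by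
    have : (fun w : Euc N × Euc k => tst m R T (w, q.2)) = fun w => psiR m R w * hh m (q.2 / T) := by
      funext w; simp only [tst]; rw [hh_eq_one m (by linarith : -q.2 ≤ 1 / 2), mul_one]
    rw [this, grushin_mul_const (contDiff_psiR m R)]
  have e2 : deriv (fun s => tst m R T (q.1, s)) q.2 = psiR m R q.1 * (hh1 m (q.2 / T) / T) := by
    have : (fun s => tst m R T (q.1, s)) =ᶠ[nhds q.2] fun s => psiR m R q.1 * hh m (s / T) := by
      filter_upwards [lt_mem_nhds hq] with s hs
      simp only [tst]; rw [hh_eq_one m (by linarith : -s ≤ 1 / 2), mul_one]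
    rw [this.deriv_eq]
    exact ((hasDerivAt_hh_div m T q.2).const_mul _).deriv
  rw [e1, e2]
  have hC0 := CL_nonneg N k m
  by_cases hD : q ∈ Dset N k R T
  · rw [Set.indicator_of_mem hD, abs_mul, abs_mul, abs_div, abs_of_pos hT]
    have a1 := abs_grushin_psiR_le m hR q.1
    have a2 := abs_hh1_le m (q.2 / T)
    have x0 := kk_nonneg (gR R q.1)
    have x1 := kk_le_one (gR R q.1)
    have y0 := kk_nonneg (q.2 / T)
    have y1 := kk_le_one (q.2 / T)
    have b1 : |hh m (q.2 / T)| ≤ kk (q.2 / T) ^ (m + 1) := by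
      rw [abs_of_nonneg (hh_nonneg _ _), hh]; exact pow_le_pow_of_le_one y0 y1 (by omega)
    have b2 : |psiR m R q.1| ≤ kk (gR R q.1) ^ (m + 1) := by
      rw [psiR, abs_of_nonneg (hh_nonneg _ _), hh]; exact pow_le_pow_of_le_one x0 x1 (by omega)
    rw [wk, mul_pow]
    generalize kk (gR R q.1) ^ (m + 1) = X at *
    generalize kk (q.2 / T) ^ (m + 1) = Y at *
    have hX : 0 ≤ X := (abs_nonneg _).trans b2
    have hY : 0 ≤ Y := (abs_nonneg _).trans b1
    calc _ ≤ (CL N k m / R ^ 2 * X) * Y + X * (100 * ((m : ℝ) + 3) ^ 2 * Y / T) := by gcongr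
      _ ≤ _ := by
        rw [Cerr]
        have : 0 ≤ CL N k m * T⁻¹ * (X * Y) + 100 * ((m : ℝ) + 3) ^ 2 * (R ^ 2)⁻¹ * (X * Y) := by positivity
        simp only [div_eq_mul_inv]
        nlinarith
  · rw [Set.indicator_of_notMem hD]
    have : ¬ (1 / 2 ≤ gR R q.1 ∨ T / 2 ≤ q.2) := hD
    push Not at this
    rw [grushin_psiR_eq_zero m R this.1.le, hh1_eq_zero m (by rw [div_le_iff₀ hT]; linarith [this.2])]
    simp

def v0 (N k : ℕ) : ℝ≥0∞ := volume (Metric.ball (0 : Euc N) 1) * volume (Metric.ball (0 : Euc k) 1)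
lemma v0_lt_top (N k : ℕ) : v0 N k < ⊤ := ENNReal.mul_lt_top measure_ball_lt_top measure_ball_lt_top

def Ksup (N k : ℕ) (R T : ℝ) : Set ((Euc N × Euc k) × ℝ) := {z | gR R z ≤ 1} ×ˢ Set.Icc 0 T

lemma vol_Ksup (N k : ℕ) {R T : ℝ} (hR : 0 < R) (hT : 0 < T) :
    volume (Ksup N k R T) ≤ v0 N k * ENNReal.ofReal (R ^ (N + 2 * k) * T) := by
  have hs : Ksup N k R T ⊆ (Metric.closedBall (0 : Euc N) R ×ˢ Metric.closedBall (0 : Euc k) (R ^ 2)) ×ˢ Set.Icc 0 T := by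
    rintro q ⟨h1, h2⟩
    obtain ⟨b1, b2⟩ := gR_bounds hR h1
    exact ⟨⟨by simpa using b1, by simpa using b2⟩, h2⟩
  refine (measure_mono hs).trans (le_of_eq ?_)
  rw [Measure.volume_eq_prod, Measure.prod_prod, Measure.volume_eq_prod, Measure.prod_prod,
    Measure.addHaar_closedBall _ _ hR.le, Measure.addHaar_closedBall _ _ (by positivity), Real.volume_Icc,
    finrank_euclideanSpace_fin, finrank_euclideanSpace_fin, sub_zero, pow_add, pow_mul,
    ENNReal.ofReal_mul (by positivity), ENNReal.ofReal_mul (by positivity), v0]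
  ring

lemma holder_wk {N k : ℕ} {U : (Euc N × Euc k) × ℝ → ℝ}
    (hU : AEMeasurable (fun q => ENNReal.ofReal (U q)) (volume.restrict (Om N k)))
    {p : ℝ} (hp : 1 < p) {m : ℕ} (hm : (m : ℝ) + 4 ≤ ((m : ℝ) + 1) * p) {R T : ℝ} (hR : 0 < R) (hT : 0 < T) :
    ∫⁻ q in Om N k, ENNReal.ofReal (U q) * ENNReal.ofReal ((Dset N k R T).indicator (fun q => wk R T q ^ (m + 1)) q) ≤
      (v0 N k * ENNReal.ofReal (R ^ (N + 2 * k) * T)) ^ (1 - 1 / p) *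
        (∫⁻ q in Om N k, (Dset N k R T).indicator (YY p m R T U) q) ^ (1 / p) := by
  have hpq := Real.HolderConjugate.conjExponent hp
  have hKm : MeasurableSet (Ksup N k R T) := (isCompact_gR hR).isClosed.measurableSet.prod measurableSet_Icc
  set f : (Euc N × Euc k) × ℝ → ℝ≥0∞ := fun q => ENNReal.ofReal (U q) * ENNReal.ofReal ((Dset N k R T).indicator (fun q => wk R T q ^ (m + 1)) q) with hf
  set g : (Euc N × Euc k) × ℝ → ℝ≥0∞ := (Ksup N k R T).indicator 1 with hg
  have hgm : Measurable g := measurable_one.indicator hKm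
  have hfm : AEMeasurable f (volume.restrict (Om N k)) := by
    refine hU.mul (Measurable.aemeasurable ?_)
    exact (((continuous_wk R T).pow _).measurable.indicator (measurableSet_Dset N k R T)).ennreal_ofReal
  have e1 : ∫⁻ q in Om N k, f q = ∫⁻ q in Om N k, (f * g) q := by
    refine setLIntegral_congr_fun (measurableSet_Om N k) fun q hq => ?_
    by_cases hK : q ∈ Ksup N k R T
    · simp [hg, hK]
    · have : wk R T q = 0 := by
        by_contra hne
        refine hK ⟨?_, (mem_Om.1 hq).le, ?_⟩
        · by_contra h
          have h : 1 < gR R q.1 := not_le.1 h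
          exact hne (by rw [wk, kk_eq_zero h.le, zero_mul])
        · by_contra h
          have h : T < q.2 := not_le.1 h
          exact hne (by rw [wk, kk_eq_zero ((one_le_div hT).2 h.le), mul_zero])
      have h2 : f q = 0 := by
        simp only [hf]
        by_cases hD : q ∈ Dset N k R T <;> simp [hD, this]
      simp [h2]
  rw [e1]
  refine (ENNReal.lintegral_mul_le_Lp_mul_Lq _ hpq hfm hgm.aemeasurable).trans ?_
  rw [mul_comm]
  have a1 : 1 / p.conjExponent = 1 - 1 / p := by
    rw [Real.conjExponent]; field_simp
  rw [a1]
  gcongr ?_ ^ _ * ?_ ^ _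
  · have : 1 / p < 1 := by rw [div_lt_one (by linarith)]; exact hp
    linarith
  · have : ∀ q, g q ^ p.conjExponent = g q := by
      intro q; by_cases h : q ∈ Ksup N k R T
      · simp [hg, h]
      · simp [hg, h, hpq.symm.pos]
    simp only [this]
    refine (setLIntegral_le_lintegral _ _).trans ?_
    rw [hg, lintegral_indicator_one hKm]
    exact vol_Ksup N k hR hT
  · refine lintegral_mono fun q => ?_
    simp only [hf]
    by_cases hD : q ∈ Dset N k R T
    · rw [Set.indicator_of_mem hD, Set.indicator_of_mem hD, ENNReal.mul_rpow_of_nonneg _ _ (by linarith), YY]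
      refine mul_le_mul_right ?_ _
      have w0 := wk_nonneg R T q
      rw [ENNReal.ofReal_rpow_of_nonneg (pow_nonneg w0 _) (by linarith)]
      apply ENNReal.ofReal_le_ofReal
      rw [← Real.rpow_natCast, ← Real.rpow_mul w0, ← Real.rpow_natCast]
      refine Real.rpow_le_rpow_of_exponent_ge_of_imp w0 (wk_le_one R T q) (by push_cast; exact hm) ?_
      intro _ h; push_cast at h; nlinarith
    · rw [Set.indicator_of_notMem hD, Set.indicator_of_notMem hD]
      simp only [ENNReal.ofReal_zero, mul_zero]
      rw [ENNReal.zero_rpow_of_pos (by linarith)]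

lemma ineqI {N k : ℕ} {u0 : Euc N × Euc k → ℝ} {U f1 f2 : (Euc N × Euc k) × ℝ → ℝ}
    (S : WS N k u0 U f1 f2) {p2 : ℝ} (hp2 : 1 < p2) (hf2 : ∀ q, f2 q = U q ^ p2)
    {p : ℝ} (hp : 1 < p) {m : ℕ} (hm : (m : ℝ) + 4 ≤ ((m : ℝ) + 1) * p) {R T : ℝ} (hR : 0 < R) (hT : 0 < T)
    (h0 : 0 ≤ ∫ z, u0 z * psiR m R z) :
    (∫⁻ q in Om N k, ENNReal.ofReal (f1 q * tst m R T q)) < ⊤ ∧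
    (∫⁻ q in Om N k, ENNReal.ofReal (f2 q * tst m R T q)) < ⊤ ∧
    ENNReal.ofReal (∫ z, u0 z * psiR m R z) + (∫⁻ q in Om N k, ENNReal.ofReal (f1 q * tst m R T q)) +
      (∫⁻ q in Om N k, ENNReal.ofReal (f2 q * tst m R T q)) ≤
      ENNReal.ofReal (Cerr N k m * ((R ^ 2)⁻¹ + T⁻¹)) * ((v0 N k * ENNReal.ofReal (R ^ (N + 2 * k) * T)) ^ (1 - 1 / p) *
        (∫⁻ q in Om N k, (Dset N k R T).indicator (YY p m R T U) q) ^ (1 / p)) := by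
  obtain ⟨b1, b2, b3, b4, e⟩ := weak_full S hp2 hf2 (contDiff_tst m R T) (hcs_tst m hR hT)
  have hfin : ∀ {h : (Euc N × Euc k) × ℝ → ℝ}, IntegrableOn h (Om N k) → ∫⁻ q in Om N k, ENNReal.ofReal (h q) < ⊤ :=
    fun h => lt_of_le_of_lt (lintegral_mono fun y => Real.ofReal_le_enorm _) h.2
  refine ⟨hfin b1, hfin b2, ?_⟩
  have ht0 : ∀ q : (Euc N × Euc k) × ℝ, 0 ≤ tst m R T q := fun q =>
    mul_nonneg (hh_nonneg _ _) (mul_nonneg (hh_nonneg _ _) (hh_nonneg _ _))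
  have n1 : 0 ≤ᵐ[volume.restrict (Om N k)] fun q => f1 q * tst m R T q := by
    filter_upwards [ae_restrict_mem (measurableSet_Om N k)] with q hq
    exact mul_nonneg (S.h1 q (mem_Om.1 hq)) (ht0 q)
  have n2 : 0 ≤ᵐ[volume.restrict (Om N k)] fun q => f2 q * tst m R T q := by
    filter_upwards [ae_restrict_mem (measurableSet_Om N k)] with q hq
    exact mul_nonneg (S.h2 q (mem_Om.1 hq)) (ht0 q)
  have hz : ∀ z : Euc N × Euc k, tst m R T (z, 0) = psiR m R z := by
    intro z; simp [tst, hh_eq_one m (by norm_num : (0 : ℝ) ≤ 1 / 2)]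
  simp only [hz] at e
  rw [← ofReal_integral_eq_lintegral_ofReal b1 n1, ← ofReal_integral_eq_lintegral_ofReal b2 n2,
    ← ENNReal.ofReal_add h0 (integral_nonneg_of_ae n1), ← ENNReal.ofReal_add (add_nonneg h0 (integral_nonneg_of_ae n1)) (integral_nonneg_of_ae n2)]
  have e' : (∫ z, u0 z * psiR m R z) + (∫ q in Om N k, f1 q * tst m R T q) + (∫ q in Om N k, f2 q * tst m R T q) =
      ∫ q in Om N k, -(U q * grushin (fun w => tst m R T (w, q.2)) q.1 + U q * deriv (fun s => tst m R T (q.1, s)) q.2) := by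
    rw [integral_neg, integral_add b3 b4]; linarith
  rw [e']
  refine (ofReal_integral_le (b3.add b4).neg).trans ?_
  have hUm : AEMeasurable (fun q => ENNReal.ofReal (U q)) (volume.restrict (Om N k)) :=
    S.iU.aestronglyMeasurable.aemeasurable.ennreal_ofReal
  refine le_trans ?_ (mul_le_mul_right (holder_wk hUm hp hm hR hT) _)
  rw [← lintegral_const_mul' _ _ (by simp)]
  refine lintegral_mono_ae ?_
  filter_upwards [ae_restrict_mem (measurableSet_Om N k)] with q hq
  have hq0 := mem_Om.1 hq
  have hUq := S.hU q hq0
  have hC : 0 ≤ Cerr N k m := by have := CL_nonneg N k m; unfold Cerr; positivity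
  rw [← ENNReal.ofReal_mul hUq, ← ENNReal.ofReal_mul (by positivity)]
  apply ENNReal.ofReal_le_ofReal
  have h3 := tst_err (N := N) (k := k) m hR hT hq0
  have h4 := neg_abs_le (grushin (fun w => tst m R T (w, q.2)) q.1)
  have h5 := neg_abs_le (deriv (fun s => tst m R T (q.1, s)) q.2)
  calc _ = U q * (-(grushin (fun w => tst m R T (w, q.2)) q.1) + -(deriv (fun s => tst m R T (q.1, s)) q.2)) := by
          simp only [Pi.neg_apply, Pi.add_apply]; ring
    _ ≤ U q * (|grushin (fun w => tst m R T (w, q.2)) q.1| + |deriv (fun s => tst m R T (q.1, s)) q.2|) := by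
      gcongr <;> linarith
    _ ≤ U q * _ := mul_le_mul_of_nonneg_left h3 hUq
    _ = _ := by ring


lemma w_lower {γ T s : ℝ} (m : ℕ) (hγ0 : 0 < γ) (hT : 0 < T) (hs : 0 < s) :
    ENNReal.ofReal (1 / (12 * 6 ^ (m + 3)) * T ^ (1 - γ)) * ENNReal.ofReal (kk (s / T) ^ (m + 4)) ≤
    ∫⁻ t in Set.Ioi 0, (if s < t then ENNReal.ofReal ((t - s) ^ (-γ)) else 0) * ENNReal.ofReal (hh m (t / T)) := by
  rcases le_or_gt T s with h | h
  · rw [kk_eq_zero ((one_le_div hT).2 h)]; simp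
  obtain ⟨x, hx⟩ : ∃ x, x = kk (s / T) := ⟨_, rfl⟩
  have hx0 : 0 ≤ x := hx ▸ kk_nonneg _
  have hsub : Set.Ioo s ((s + T) / 2) ⊆ Set.Ioi 0 := fun t ht => hs.trans ht.1
  have h1 : x ≤ 6 * (1 - s / T) := hx ▸ kk_le _ ((div_le_one hT).2 h.le)
  calc _ ≤ ENNReal.ofReal (T ^ (-γ) * (x / 6) ^ (m + 3)) * volume (Set.Ioo s ((s + T) / 2)) := by
        rw [Real.volume_Ioo, ← ENNReal.ofReal_mul (by positivity), ← ENNReal.ofReal_mul (by positivity), ← hx]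
        apply ENNReal.ofReal_le_ofReal
        have e : T ^ (1 - γ) = T ^ (-γ) * T := by
          rw [← Real.rpow_add_one hT.ne']; congr 1; ring
        have h2 : T * x / 12 ≤ (s + T) / 2 - s := by
          have : T * x ≤ T * (6 * (1 - s / T)) := by gcongr
          have e3 : T * (6 * (1 - s / T)) = 6 * (T - s) := by field_simp
          linarith
        calc _ = T ^ (-γ) * (x / 6) ^ (m + 3) * (T * x / 12) := by
              rw [e, div_pow]; field_simp; ring
          _ ≤ _ := by gcongr
    _ = ∫⁻ t in Set.Ioo s ((s + T) / 2), ENNReal.ofReal (T ^ (-γ) * (x / 6) ^ (m + 3)) := by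
        rw [setLIntegral_const]
    _ ≤ ∫⁻ t in Set.Ioo s ((s + T) / 2), (if s < t then ENNReal.ofReal ((t - s) ^ (-γ)) else 0) * ENNReal.ofReal (hh m (t / T)) := by
        refine setLIntegral_mono' measurableSet_Ioo fun t ht => ?_
        rw [if_pos ht.1, ENNReal.ofReal_mul (by positivity)]
        have ht1 : 0 < t - s := by linarith [ht.1]
        refine mul_le_mul' (ENNReal.ofReal_le_ofReal ?_) (ENNReal.ofReal_le_ofReal ?_)
        · exact Real.rpow_le_rpow_of_nonpos ht1 (by linarith [ht.2]) (by linarith)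
        · rw [hh, hx]
          have := kk_nonneg (s / T)
          gcongr
          refine kk_lower (by positivity) ((div_le_one hT).2 h.le) ?_
          rw [div_le_iff₀ hT]
          have : (1 + s / T) / 2 * T = (s + T) / 2 := by field_simp; ring
          linarith [ht.2]
    _ ≤ _ := lintegral_mono_set hsub

lemma f1_eq {γ p : ℝ} (hγ0 : 0 < γ) (hγ1 : γ < 1) (hp : 1 < p) {v : ℝ → ℝ} {G : ℝ → ℝ≥0∞} (hv : ∀ s, 0 < s → 0 ≤ v s)
    (hG : Measurable G) (hvG : ∀ᵐ s ∂(volume.restrict (Set.Ioi 0)), ENNReal.ofReal (v s) = G s)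
    (hfin : ∀ T, ∫⁻ s in Set.Ioo 0 T, ENNReal.ofReal (v s) ^ p < ⊤) :
    ∀ᵐ t ∂(volume.restrict (Set.Ioi 0)), ENNReal.ofReal (∫ s in Set.Ioc 0 t, (t - s) ^ (-γ) * v s ^ p) =
      ∫⁻ s in Set.Ioi 0, G s ^ p * (if s < t then ENNReal.ofReal ((t - s) ^ (-γ)) else 0) := by
  have hsub : ∀ t : ℝ, Set.Ioo 0 t ⊆ Set.Ioi 0 := fun t => Set.Ioo_subset_Ioi_self
  have eqn : ∀ t T : ℝ, t ≤ T → ∫⁻ s in Set.Ioi 0, G s ^ p * (if s < t then ENNReal.ofReal ((t - s) ^ (-γ)) else 0) =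
      ∫⁻ s in Set.Ioo 0 T, G s ^ p * (if s < t then ENNReal.ofReal ((t - s) ^ (-γ)) else 0) := by
    intro t T htT
    rw [← lintegral_indicator measurableSet_Ioi, ← lintegral_indicator measurableSet_Ioo]
    congr 1; funext s
    by_cases hs : s ∈ Set.Ioo 0 T
    · rw [Set.indicator_of_mem hs, Set.indicator_of_mem (hsub T hs)]
    · rw [Set.indicator_of_notMem hs]
      by_cases hs0 : s ∈ Set.Ioi 0
      · have : ¬ s < t := fun h => hs ⟨hs0, by linarith⟩
        rw [Set.indicator_of_mem hs0, if_neg this, mul_zero]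
      · rw [Set.indicator_of_notMem hs0]
  have hGfin : ∀ T, ∫⁻ s in Set.Ioo 0 T, G s ^ p < ⊤ := by
    intro T
    refine lt_of_le_of_lt (le_of_eq ?_) (hfin T)
    refine lintegral_congr_ae ?_
    filter_upwards [ae_restrict_of_ae_restrict_of_subset (hsub T) hvG] with s hs
    rw [hs]
  have hHm : Measurable fun t => ∫⁻ s in Set.Ioi 0, G s ^ p * (if s < t then ENNReal.ofReal ((t - s) ^ (-γ)) else 0) := by
    refine Measurable.lintegral_prod_right' (f := fun y : ℝ × ℝ => G y.2 ^ p * (if y.2 < y.1 then ENNReal.ofReal ((y.1 - y.2) ^ (-γ)) else 0)) ?_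
    refine ((hG.comp measurable_snd).pow_const _).mul (Measurable.ite (measurableSet_lt measurable_snd measurable_fst) ?_ measurable_const)
    exact ((measurable_fst.sub measurable_snd).pow_const _).ennreal_ofReal
  have fin : ∀ᵐ t, t ∈ Set.Ioi (0 : ℝ) → ∫⁻ s in Set.Ioi 0, G s ^ p * (if s < t then ENNReal.ofReal ((t - s) ^ (-γ)) else 0) < ⊤ := by
    have : ∀ n : ℕ, ∀ᵐ t, t ∈ Set.Ioo (0 : ℝ) n → ∫⁻ s in Set.Ioi 0, G s ^ p * (if s < t then ENNReal.ofReal ((t - s) ^ (-γ)) else 0) < ⊤ := by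
      intro n
      rw [← ae_restrict_iff' measurableSet_Ioo]
      have hp' : 1 < (1 + 1 / γ) / 2 := by
        have : 1 < 1 / γ := by rw [lt_div_iff₀ hγ0]; linarith
        linarith
      have hγp : γ * ((1 + 1 / γ) / 2) < 1 := by
        have : γ * ((1 + 1 / γ) / 2) = (γ + 1) / 2 := by field_simp
        linarith
      have key := conv_fin (μ := volume.restrict (Set.Ioo 0 (n : ℝ))) (hG.pow_const p) (hGfin n) (s := id) measurable_id
        (ae_restrict_of_forall_mem measurableSet_Ioo fun x hx => hx.1) hp' hγp n
      have key2 : ∫⁻ t in Set.Ioo 0 (n : ℝ), (∫⁻ s in Set.Ioi 0, G s ^ p * (if s < t then ENNReal.ofReal ((t - s) ^ (-γ)) else 0)) ^ ((1 + 1 / γ) / 2) < ⊤ := by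
        refine lt_of_le_of_lt (le_of_eq ?_) key
        refine setLIntegral_congr_fun measurableSet_Ioo fun t ht => ?_
        simp only [eqn t n ht.2.le, id]
      filter_upwards [ae_lt_top (hHm.pow_const _) key2.ne] with t ht
      by_contra h
      rw [not_lt, top_le_iff] at h
      rw [h, ENNReal.top_rpow_of_pos (by linarith)] at ht
      exact lt_irrefl _ ht
    filter_upwards [ae_all_iff.2 this] with t ht ht0
    obtain ⟨n, hn⟩ := exists_nat_gt t
    exact ht n ⟨ht0, hn⟩
  rw [ae_restrict_iff' measurableSet_Ioi]
  filter_upwards [fin] with t ht ht0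
  have ht := ht ht0
  have hsc : Set.Ioc 0 t ⊆ Set.Ioi 0 := Set.Ioc_subset_Ioi_self
  have hvm : AEMeasurable v (volume.restrict (Set.Ioc 0 t)) := by
    refine ⟨fun s => (G s).toReal, hG.ennreal_toReal, ?_⟩
    filter_upwards [ae_restrict_of_ae_restrict_of_subset hsc hvG, ae_restrict_mem measurableSet_Ioc] with s hs hs2
    rw [← hs, ENNReal.toReal_ofReal (hv s hs2.1)]
  have e : ∫⁻ s in Set.Ioc 0 t, ENNReal.ofReal ((t - s) ^ (-γ) * v s ^ p) =
      ∫⁻ s in Set.Ioi 0, G s ^ p * (if s < t then ENNReal.ofReal ((t - s) ^ (-γ)) else 0) := by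
    rw [eqn t t le_rfl, ← setLIntegral_congr Ioo_ae_eq_Ioc]
    refine lintegral_congr_ae ?_
    filter_upwards [ae_restrict_of_ae_restrict_of_subset (hsub t) hvG, ae_restrict_mem measurableSet_Ioo] with s hs hs2
    have : 0 ≤ t - s := by linarith [hs2.2]
    rw [if_pos hs2.2, ENNReal.ofReal_mul (by positivity), ← hs, ENNReal.ofReal_rpow_of_nonneg (hv s hs2.1) (by linarith), mul_comm]
  rw [integral_eq_lintegral_of_nonneg_ae, e, ENNReal.ofReal_toReal ht.ne]
  · filter_upwards [ae_restrict_mem measurableSet_Ioc] with s hs2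
    have : 0 ≤ t - s := by linarith [hs2.2]
    have := hv s hs2.1
    simp only [Pi.zero_apply]; positivity
  · refine AEMeasurable.aestronglyMeasurable ?_
    exact (((measurable_const.sub measurable_id).pow_const _).aemeasurable).mul (hvm.pow_const _)

lemma aem_YY {N k : ℕ} {U : (Euc N × Euc k) × ℝ → ℝ}
    (hU : AEMeasurable (fun q => ENNReal.ofReal (U q)) (volume.restrict (Om N k))) (p : ℝ) (m : ℕ) (R T : ℝ) :
    AEMeasurable (YY p m R T U) (volume.restrict (Om N k)) :=
  (hU.pow_const p).mul (((continuous_wk R T).pow _).measurable.ennreal_ofReal.aemeasurable)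

lemma mem_lower {N k : ℕ} (hN : 1 ≤ N) {u0 : Euc N × Euc k → ℝ} {U f1 f2 : (Euc N × Euc k) × ℝ → ℝ}
    (S : WS N k u0 U f1 f2) {γ p1 p2 : ℝ} (hγ0 : 0 < γ) (hγ1 : γ < 1) (hp1 : 1 < p1) (hp2 : 1 < p2) (hf2 : ∀ q, f2 q = U q ^ p2)
    (hf1 : ∀ q, f1 q = ∫ s in Set.Ioc 0 q.2, (q.2 - s) ^ (-γ) * U (q.1, s) ^ p1)
    (hu0 : Integrable u0) (m : ℕ) {R T : ℝ} (hR : 0 < R) (hT : 0 < T) :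
    ENNReal.ofReal (1 / (12 * 6 ^ (m + 3)) * T ^ (1 - γ)) * ∫⁻ q in Om N k, YY p1 m R T U q ≤
      ∫⁻ q in Om N k, ENNReal.ofReal (f1 q * tst m R T q) := by
  have hUm : AEMeasurable (fun q => ENNReal.ofReal (U q)) (volume.restrict (Om N k)) :=
    S.iU.aestronglyMeasurable.aemeasurable.ennreal_ofReal
  have hYm := aem_YY hUm p1 m R T
  have hFm : AEMeasurable (fun q => ENNReal.ofReal (f1 q * tst m R T q)) (volume.restrict (Om N k)) :=
    (S.i1.aestronglyMeasurable.aemeasurable.mul (contDiff_tst m R T).continuous.measurable.aemeasurable).ennreal_ofReal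
  obtain ⟨g, hg, hUg⟩ := hUm
  rw [restrict_Om] at hYm hFm hUg ⊢
  rw [lintegral_prod _ hYm, lintegral_prod _ hFm, ← lintegral_const_mul' _ _ ENNReal.ofReal_ne_top]
  refine lintegral_mono_ae ?_
  filter_upwards [Measure.ae_ae_of_ae_prod hUg, key_fin hN S hp1 hp2 hf2 hu0] with z z1 z2
  have z3 := f1_eq hγ0 hγ1 hp1 (v := fun s => U (z, s)) (G := fun s => g (z, s)) (fun s hs => S.hU (z, s) hs)
    (hg.comp (measurable_const.prodMk measurable_id)) z1 z2
  have hgz : Measurable fun s => g (z, s) := hg.comp (measurable_const.prodMk measurable_id)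
  have hψ0 : 0 ≤ psiR m R z := hh_nonneg _ _
  obtain ⟨c, hc⟩ : ∃ c, c = ENNReal.ofReal (1 / (12 * 6 ^ (m + 3)) * T ^ (1 - γ)) := ⟨_, rfl⟩
  have hct : c ≠ ⊤ := by rw [hc]; exact ENNReal.ofReal_ne_top
  have kmeas : Measurable fun y : ℝ × ℝ => (if y.2 < y.1 then ENNReal.ofReal ((y.1 - y.2) ^ (-γ)) else 0 : ℝ≥0∞) := by
    refine (Measurable.ite (measurableSet_lt measurable_snd measurable_fst) ?_ measurable_const)
    exact ((measurable_fst.sub measurable_snd).pow_const _).ennreal_ofReal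
  have hhm : Measurable fun t : ℝ => ENNReal.ofReal (hh m (t / T)) := (contDiff_hh_div m T).continuous.measurable.ennreal_ofReal
  rw [← hc]
  calc c * ∫⁻ s in Set.Ioi 0, YY p1 m R T U (z, s) = ∫⁻ s in Set.Ioi 0, c * YY p1 m R T U (z, s) := by
        rw [lintegral_const_mul' _ _ hct]
    _ ≤ ∫⁻ s in Set.Ioi 0, ENNReal.ofReal (psiR m R z) * (g (z, s) ^ p1 *
          ∫⁻ t in Set.Ioi 0, (if s < t then ENNReal.ofReal ((t - s) ^ (-γ)) else 0) * ENNReal.ofReal (hh m (t / T))) := by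
        refine lintegral_mono_ae ?_
        filter_upwards [z1, ae_restrict_mem measurableSet_Ioi] with s hs hs0
        have hw := w_lower m hγ0 hT hs0
        have hkl : ENNReal.ofReal (wk R T (z, s) ^ (m + 4)) ≤ ENNReal.ofReal (psiR m R z) * ENNReal.ofReal (kk (s / T) ^ (m + 4)) := by
          rw [← ENNReal.ofReal_mul hψ0, wk, mul_pow, psiR, hh]
          apply ENNReal.ofReal_le_ofReal
          have := kk_nonneg (s / T)
          gcongr ?_ * _
          exact pow_le_pow_of_le_one (kk_nonneg _) (kk_le_one _) (by omega)
        rw [YY, hs]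
        calc c * (g (z, s) ^ p1 * ENNReal.ofReal (wk R T (z, s) ^ (m + 4))) ≤
            c * (g (z, s) ^ p1 * (ENNReal.ofReal (psiR m R z) * ENNReal.ofReal (kk (s / T) ^ (m + 4)))) := by gcongr
          _ = ENNReal.ofReal (psiR m R z) * (g (z, s) ^ p1 * (c * ENNReal.ofReal (kk (s / T) ^ (m + 4)))) := by ring
          _ ≤ _ := by rw [hc]; gcongr
    _ = ENNReal.ofReal (psiR m R z) * ∫⁻ s in Set.Ioi 0, ∫⁻ t in Set.Ioi 0, (g (z, s) ^ p1 *
          ((if s < t then ENNReal.ofReal ((t - s) ^ (-γ)) else 0) * ENNReal.ofReal (hh m (t / T)))) := by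
        rw [lintegral_const_mul' _ _ (by simp)]
        congr 2; funext s
        rw [lintegral_const_mul]
        exact (kmeas.comp (measurable_id.prodMk measurable_const)).mul hhm
    _ = ENNReal.ofReal (psiR m R z) * ∫⁻ t in Set.Ioi 0, ∫⁻ s in Set.Ioi 0, (g (z, s) ^ p1 *
          ((if s < t then ENNReal.ofReal ((t - s) ^ (-γ)) else 0) * ENNReal.ofReal (hh m (t / T)))) := by
        rw [lintegral_lintegral_swap]
        refine Measurable.aemeasurable ?_
        exact ((hgz.comp measurable_fst).pow_const _).mul ((kmeas.comp measurable_swap).mul (hhm.comp measurable_snd))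
    _ = ∫⁻ t in Set.Ioi 0, ENNReal.ofReal (psiR m R z) * ((∫⁻ s in Set.Ioi 0, g (z, s) ^ p1 *
          (if s < t then ENNReal.ofReal ((t - s) ^ (-γ)) else 0)) * ENNReal.ofReal (hh m (t / T))) := by
        rw [lintegral_const_mul' _ _ (by simp)]
        congr 2; funext t
        rw [← lintegral_mul_const' _ _ (by simp)]
        simp only [mul_assoc]
    _ ≤ _ := by
        refine lintegral_mono_ae ?_
        filter_upwards [z3, ae_restrict_mem measurableSet_Ioi] with t ht ht0
        have ht0' : 0 < t := ht0
        rw [← ht, hf1, tst]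
        simp only
        rw [hh_eq_one m (by linarith : -t ≤ 1 / 2), mul_one, ENNReal.ofReal_mul' (mul_nonneg hψ0 (hh_nonneg _ _)),
          ENNReal.ofReal_mul hψ0]
        apply le_of_eq; ring

lemma src_lower {N k : ℕ} {u0 : Euc N × Euc k → ℝ} {U f1 f2 : (Euc N × Euc k) × ℝ → ℝ}
    (S : WS N k u0 U f1 f2) {p2 : ℝ} (hp2 : 1 < p2) (hf2 : ∀ q, f2 q = U q ^ p2) (m : ℕ) (R T : ℝ) :
    ∫⁻ q in Om N k, YY p2 m R T U q ≤ ∫⁻ q in Om N k, ENNReal.ofReal (f2 q * tst m R T q) := by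
  refine setLIntegral_mono_ae' (measurableSet_Om N k) (Eventually.of_forall fun q hq => ?_)
  have hq0 := mem_Om.1 hq
  have w0 := wk_nonneg R T q
  rw [YY, hf2, tst_wk m R T hq0.le, ENNReal.ofReal_mul' (by positivity), ENNReal.ofReal_rpow_of_nonneg (S.hU q hq0) (by linarith)]
  refine mul_le_mul_right (ENNReal.ofReal_le_ofReal ?_) _
  exact pow_le_pow_of_le_one w0 (wk_le_one R T q) (by omega)


lemma gR_lim {N k : ℕ} (z : Euc N × Euc k) : ∀ᶠ n : ℕ in atTop, gR (n : ℝ) z ≤ 1 / 2 := by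
  have h : Tendsto (fun n : ℕ => gR (n : ℝ) z) atTop (nhds 0) := by
    unfold gR
    refine Tendsto.div_atTop tendsto_const_nhds ?_
    exact (tendsto_pow_atTop (by norm_num)).comp tendsto_natCast_atTop_atTop
  exact h.eventually_le_const (by norm_num)

lemma psi_pos {N k : ℕ} {u0 : Euc N × Euc k → ℝ} (hu0 : Integrable u0) (h : 0 < ∫ z, u0 z) (m : ℕ) :
    ∀ᶠ n : ℕ in atTop, 0 < ∫ z, u0 z * psiR m (n : ℝ) z := by
  have : Tendsto (fun n : ℕ => ∫ z, u0 z * psiR m (n : ℝ) z) atTop (nhds (∫ z, u0 z)) := by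
    refine tendsto_integral_of_dominated_convergence (fun z => ‖u0 z‖) (fun n => ?_) hu0.norm (fun n => ?_) ?_
    · exact hu0.aestronglyMeasurable.mul (contDiff_psiR m _).continuous.aestronglyMeasurable
    · refine Eventually.of_forall fun z => ?_
      rw [norm_mul]
      refine mul_le_of_le_one_right (norm_nonneg _) ?_
      rw [Real.norm_eq_abs, psiR, abs_of_nonneg (hh_nonneg _ _)]
      exact hh_le_one _ _
    · refine Eventually.of_forall fun z => ?_
      refine tendsto_const_nhds.congr' ?_
      filter_upwards [gR_lim z] with n hn
      rw [psiR, hh_eq_one m hn, mul_one]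
  exact this.eventually_const_lt h

lemma fatou_le {α : Type*} [MeasurableSpace α] {μ : Measure α} {F : ℕ → α → ℝ≥0∞} {G : α → ℝ≥0∞} {b : ℕ → ℝ≥0∞} {B : ℝ≥0∞}
    (hF : ∀ n, AEMeasurable (F n) μ) (hG : ∀ᵐ x ∂μ, Tendsto (fun n => F n x) atTop (nhds (G x)))
    (hb : ∀ᶠ n in atTop, ∫⁻ x, F n x ∂μ ≤ b n) (hB : Tendsto b atTop (nhds B)) : ∫⁻ x, G x ∂μ ≤ B := by
  calc ∫⁻ x, G x ∂μ = ∫⁻ x, liminf (fun n => F n x) atTop ∂μ := by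
        refine lintegral_congr_ae ?_
        filter_upwards [hG] with x hx
        exact hx.liminf_eq.symm
    _ ≤ liminf (fun n => ∫⁻ x, F n x ∂μ) atTop := lintegral_liminf_le' hF
    _ ≤ liminf b atTop := liminf_le_liminf hb
    _ = B := hB.liminf_eq

lemma absorb {c K Y : ℝ≥0∞} {p : ℝ} (hp : 1 < p) (hc : c ≠ 0) (hc' : c ≠ ⊤) (hY : Y < ⊤) (h : c * Y ≤ K * Y ^ (1 / p)) :
    Y ≤ (c⁻¹ * K) ^ (1 / (1 - 1 / p)) := by
  have h1p : 1 / p < 1 := by rw [div_lt_one (by linarith)]; exact hp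
  have h0p : 0 < 1 / p := by positivity
  have hθ : 0 < 1 - 1 / p := by linarith
  rcases eq_or_ne Y 0 with h0 | h0
  · rw [h0]; exact zero_le
  have e : Y = Y ^ (1 / p) * Y ^ (1 - 1 / p) := by
    rw [← ENNReal.rpow_add _ _ h0 hY.ne]; simp
  have hn0 : Y ^ (1 / p) ≠ 0 := by simp [h0, hY.ne]
  have hnt : Y ^ (1 / p) ≠ ⊤ := ENNReal.rpow_ne_top_of_nonneg h0p.le hY.ne
  have h2 : Y ^ (1 / p) * Y ^ (1 - 1 / p) ≤ Y ^ (1 / p) * (c⁻¹ * K) := by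
    rw [← e]
    calc Y = c⁻¹ * (c * Y) := by rw [← mul_assoc, ENNReal.inv_mul_cancel hc hc', one_mul]
      _ ≤ c⁻¹ * (K * Y ^ (1 / p)) := mul_le_mul_right h _
      _ = _ := by ring
  have h3 := (ENNReal.mul_le_mul_iff_right hn0 hnt).1 h2
  calc Y = (Y ^ (1 - 1 / p)) ^ (1 / (1 - 1 / p)) := by
        rw [← ENNReal.rpow_mul, mul_one_div_cancel hθ.ne', ENNReal.rpow_one]
    _ ≤ _ := ENNReal.rpow_le_rpow h3 (by positivity)

/-- combined inequality -/
def HH {N k : ℕ} (u0 : Euc N × Euc k → ℝ) (U : (Euc N × Euc k) × ℝ → ℝ) (p : ℝ) (m : ℕ) (c a : ℝ) : Prop :=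
  ∀ R T : ℝ, 0 < R → 0 < T → 0 ≤ ∫ z, u0 z * psiR m R z →
    (∫⁻ q in Om N k, YY p m R T U q) < ⊤ ∧
    ENNReal.ofReal (∫ z, u0 z * psiR m R z) + ENNReal.ofReal (c * T ^ a) * (∫⁻ q in Om N k, YY p m R T U q) ≤
      ENNReal.ofReal (Cerr N k m * ((R ^ 2)⁻¹ + T⁻¹)) * ((v0 N k * ENNReal.ofReal (R ^ (N + 2 * k) * T)) ^ (1 - 1 / p) *
        (∫⁻ q in Om N k, (Dset N k R T).indicator (YY p m R T U) q) ^ (1 / p))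

lemma Cerr_nonneg (N k m : ℕ) : 0 ≤ Cerr N k m := by
  have := CL_nonneg N k m
  unfold Cerr; positivity

lemma YD_le {N k : ℕ} (U : (Euc N × Euc k) × ℝ → ℝ) (p : ℝ) (m : ℕ) (R T : ℝ) :
    (∫⁻ q in Om N k, (Dset N k R T).indicator (YY p m R T U) q) ≤ ∫⁻ q in Om N k, YY p m R T U q :=
  lintegral_mono fun q => Set.indicator_le_self _ _ _

lemma YY_le {N k : ℕ} (U : (Euc N × Euc k) × ℝ → ℝ) (p : ℝ) (m : ℕ) (R T : ℝ) (q : (Euc N × Euc k) × ℝ) :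
    YY p m R T U q ≤ ENNReal.ofReal (U q) ^ p := by
  rw [YY]
  refine mul_le_of_le_one_right' ?_
  rw [ENNReal.ofReal_le_one]
  exact pow_le_one₀ (wk_nonneg _ _ _) (wk_le_one _ _ _)

lemma HH_contra {N k : ℕ} {u0 : Euc N × Euc k → ℝ} {U : (Euc N × Euc k) × ℝ → ℝ} {p : ℝ} {m : ℕ} {c a : ℝ} (hp : 1 < p)
    (H : HH u0 U p m c a) {R T : ℝ} (hR : 0 < R) (hT : 0 < T) (h0 : 0 < ∫ z, u0 z * psiR m R z)
    (hY : (∫⁻ q in Om N k, (Dset N k R T).indicator (YY p m R T U) q) = 0) : False := by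
  have h := (H R T hR hT h0.le).2
  rw [hY, ENNReal.zero_rpow_of_pos (by positivity), mul_zero, mul_zero] at h
  have h2 := le_trans le_self_add h
  rw [nonpos_iff_eq_zero, ENNReal.ofReal_eq_zero] at h2
  linarith

lemma case_crit {N k : ℕ} {u0 : Euc N × Euc k → ℝ} {U : (Euc N × Euc k) × ℝ → ℝ} (hu0 : Integrable u0) (hpos : 0 < ∫ z, u0 z)
    (hUm : AEMeasurable (fun q => ENNReal.ofReal (U q)) (volume.restrict (Om N k)))
    {p : ℝ} {m : ℕ} {c a : ℝ} (hp : 1 < p) (hc : 0 < c) (H : HH u0 U p m c a)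
    (hcond : ((N : ℝ) + 2 * k + 2) * (1 - 1 / p) ≤ 2 + 2 * a) : False := by
  have h1p : 1 / p < 1 := by rw [div_lt_one (by linarith)]; exact hp
  have h0p : 0 < 1 / p := by positivity
  have hθ : 0 < 1 - 1 / p := by linarith
  have hC := Cerr_nonneg N k m
  obtain ⟨K, hK⟩ : ∃ K, K = ENNReal.ofReal (2 * Cerr N k m) * v0 N k ^ (1 - 1 / p) := ⟨_, rfl⟩
  have hKt : K ≠ ⊤ := by
    rw [hK]; exact ENNReal.mul_ne_top ENNReal.ofReal_ne_top (ENNReal.rpow_ne_top_of_nonneg hθ.le (v0_lt_top N k).ne)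
  obtain ⟨c', hc'⟩ : ∃ c', c' = ENNReal.ofReal c := ⟨_, rfl⟩
  have hc0 : c' ≠ 0 := by rw [hc']; simpa using hc
  have hct : c' ≠ ⊤ := by rw [hc']; exact ENNReal.ofReal_ne_top
  have main : ∀ R : ℝ, 1 ≤ R → 0 < ∫ z, u0 z * psiR m R z →
      (∫⁻ q in Om N k, YY p m R (R ^ 2) U q) < ⊤ ∧
      c' * (∫⁻ q in Om N k, YY p m R (R ^ 2) U q) ≤ K * (∫⁻ q in Om N k, (Dset N k R (R ^ 2)).indicator (YY p m R (R ^ 2) U) q) ^ (1 / p) := by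
    intro R hR h0
    have hR0 : 0 < R := by linarith
    obtain ⟨h1, h2⟩ := H R (R ^ 2) hR0 (by positivity) h0.le
    refine ⟨h1, ?_⟩
    have h3 := le_trans le_add_self h2
    have hX0 : 0 < (R ^ 2) ^ a := by positivity
    have key : ENNReal.ofReal (Cerr N k m * ((R ^ 2)⁻¹ + (R ^ 2)⁻¹)) * (v0 N k * ENNReal.ofReal (R ^ (N + 2 * k) * R ^ 2)) ^ (1 - 1 / p)
        ≤ ENNReal.ofReal ((R ^ 2) ^ a) * K := by
      rw [ENNReal.mul_rpow_of_nonneg _ _ hθ.le, ENNReal.ofReal_rpow_of_nonneg (by positivity) hθ.le, hK]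
      have e : ENNReal.ofReal (Cerr N k m * ((R ^ 2)⁻¹ + (R ^ 2)⁻¹)) = ENNReal.ofReal (2 * Cerr N k m) * ENNReal.ofReal ((R ^ 2)⁻¹) := by
        rw [← ENNReal.ofReal_mul (by positivity)]; congr 1; ring
      have e2 : ENNReal.ofReal ((R ^ 2)⁻¹) * ENNReal.ofReal ((R ^ (N + 2 * k) * R ^ 2) ^ (1 - 1 / p)) ≤ ENNReal.ofReal ((R ^ 2) ^ a) := by
        rw [← ENNReal.ofReal_mul (by positivity)]
        apply ENNReal.ofReal_le_ofReal
        have e3 : (R ^ (N + 2 * k) * R ^ 2) ^ (1 - 1 / p) = R ^ (((N : ℝ) + 2 * k + 2) * (1 - 1 / p)) := by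
          rw [← pow_add, ← Real.rpow_natCast, ← Real.rpow_mul hR0.le]; push_cast; rfl
        have e4 : R ^ (((N : ℝ) + 2 * k + 2) * (1 - 1 / p)) ≤ R ^ (2 + 2 * a) := Real.rpow_le_rpow_of_exponent_le hR hcond
        have e5 : R ^ (2 + 2 * a) = R ^ 2 * (R ^ 2) ^ a := by
          rw [Real.rpow_add hR0, Real.rpow_mul hR0.le]; norm_num
        rw [e3, inv_mul_le_iff₀ (by positivity), ← e5]; exact e4
      calc _ = ENNReal.ofReal (2 * Cerr N k m) * v0 N k ^ (1 - 1 / p) * (ENNReal.ofReal ((R ^ 2)⁻¹) * ENNReal.ofReal ((R ^ (N + 2 * k) * R ^ 2) ^ (1 - 1 / p))) := by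
              rw [e]; ring
        _ ≤ ENNReal.ofReal (2 * Cerr N k m) * v0 N k ^ (1 - 1 / p) * ENNReal.ofReal ((R ^ 2) ^ a) := mul_le_mul_right e2 _
        _ = _ := by ring
    have hXn : ENNReal.ofReal ((R ^ 2) ^ a) ≠ 0 := by simpa using hX0
    refine (ENNReal.mul_le_mul_iff_right hXn ENNReal.ofReal_ne_top).1 ?_
    rw [ENNReal.ofReal_mul hc.le, ← hc'] at h3
    calc _ = c' * ENNReal.ofReal ((R ^ 2) ^ a) * (∫⁻ q in Om N k, YY p m R (R ^ 2) U q) := by ring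
      _ ≤ _ := h3
      _ = _ := (mul_assoc _ _ _).symm
      _ ≤ _ := mul_le_mul_left key _
      _ = _ := by ring
  have ev : ∀ᶠ n : ℕ in atTop, 1 ≤ (n : ℝ) ∧ 0 < ∫ z, u0 z * psiR m (n : ℝ) z := by
    filter_upwards [eventually_ge_atTop 1, psi_pos hu0 hpos m] with n h1 h2
    exact ⟨by exact_mod_cast h1, h2⟩
  have evq : ∀ q : (Euc N × Euc k) × ℝ, ∀ᶠ n : ℕ in atTop, gR (n : ℝ) q.1 < 1 / 2 ∧ q.2 < (n : ℝ) ^ 2 / 2 := by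
    intro q
    have t1 : Tendsto (fun n : ℕ => gR (n : ℝ) q.1) atTop (nhds 0) := by
      unfold gR
      refine Tendsto.div_atTop tendsto_const_nhds ?_
      exact (tendsto_pow_atTop (by norm_num)).comp tendsto_natCast_atTop_atTop
    have t2 : Tendsto (fun n : ℕ => (n : ℝ) ^ 2 / 2) atTop atTop :=
      ((tendsto_pow_atTop (by norm_num)).comp tendsto_natCast_atTop_atTop).atTop_div_const (by norm_num)
    filter_upwards [t1.eventually_lt_const (by norm_num : (0 : ℝ) < 1 / 2), t2.eventually_gt_atTop q.2] with n h1 h2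
    exact ⟨h1, h2⟩
  have hYlim : ∀ q : (Euc N × Euc k) × ℝ, Tendsto (fun n : ℕ => YY p m (n : ℝ) ((n : ℝ) ^ 2) U q) atTop (nhds (ENNReal.ofReal (U q) ^ p)) := by
    intro q
    refine tendsto_const_nhds.congr' ?_
    filter_upwards [evq q, eventually_ge_atTop 1] with n hn hn1
    have hn1' : (1 : ℝ) ≤ n := by exact_mod_cast hn1
    rw [YY, wk, kk_eq_one hn.1.le, kk_eq_one]
    · simp
    · rw [div_le_iff₀ (by positivity)]; linarith [hn.2]
  have hYm : ∀ n : ℕ, AEMeasurable (YY p m (n : ℝ) ((n : ℝ) ^ 2) U) (volume.restrict (Om N k)) := fun n => aem_YY hUm _ _ _ _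
  have bd : ∫⁻ q in Om N k, ENNReal.ofReal (U q) ^ p ≤ (c'⁻¹ * K) ^ (1 / (1 - 1 / p)) := by
    refine fatou_le hYm (Eventually.of_forall hYlim) (b := fun _ => (c'⁻¹ * K) ^ (1 / (1 - 1 / p))) ?_ tendsto_const_nhds
    filter_upwards [ev] with n hn
    obtain ⟨h1, h2⟩ := main n hn.1 hn.2
    refine absorb hp hc0 hct h1 (h2.trans (mul_le_mul_right ?_ _))
    exact ENNReal.rpow_le_rpow (YD_le _ _ _ _ _) h0p.le
  have fin : ∫⁻ q in Om N k, ENNReal.ofReal (U q) ^ p ≠ ⊤ := by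
    refine ne_top_of_le_ne_top ?_ bd
    exact ENNReal.rpow_ne_top_of_nonneg (by positivity) (ENNReal.mul_ne_top (ENNReal.inv_ne_top.2 hc0) hKt)
  have dct : Tendsto (fun n : ℕ => ∫⁻ q in Om N k, (Dset N k (n : ℝ) ((n : ℝ) ^ 2)).indicator (fun q => ENNReal.ofReal (U q) ^ p) q) atTop (nhds 0) := by
    have := tendsto_lintegral_of_dominated_convergence' (μ := volume.restrict (Om N k))
      (F := fun (n : ℕ) q => (Dset N k (n : ℝ) ((n : ℝ) ^ 2)).indicator (fun q => ENNReal.ofReal (U q) ^ p) q) (f := fun _ => 0)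
      (fun q => ENNReal.ofReal (U q) ^ p) (fun n => (hUm.pow_const p).indicator (measurableSet_Dset _ _ _ _))
      (fun n => Eventually.of_forall fun q => Set.indicator_le_self _ _ _) fin ?_
    · simpa using this
    · refine Eventually.of_forall fun q => ?_
      refine tendsto_const_nhds.congr' ?_
      filter_upwards [evq q] with n hn
      rw [Set.indicator_of_notMem]
      rintro (h | h)
      · linarith [hn.1]
      · linarith [hn.2]
  have hz : ∫⁻ q in Om N k, ENNReal.ofReal (U q) ^ p ≤ 0 := by
    refine fatou_le hYm (Eventually.of_forall hYlim) (b := fun n : ℕ => c'⁻¹ * (K *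
      (∫⁻ q in Om N k, (Dset N k (n : ℝ) ((n : ℝ) ^ 2)).indicator (fun q => ENNReal.ofReal (U q) ^ p) q) ^ (1 / p))) ?_ ?_
    · filter_upwards [ev] with n hn
      obtain ⟨h1, h2⟩ := main n hn.1 hn.2
      calc _ = c'⁻¹ * (c' * (∫⁻ q in Om N k, YY p m (n : ℝ) ((n : ℝ) ^ 2) U q)) := by
            rw [← mul_assoc, ENNReal.inv_mul_cancel hc0 hct, one_mul]
        _ ≤ _ := by
            refine mul_le_mul_right (h2.trans (mul_le_mul_right (ENNReal.rpow_le_rpow ?_ h0p.le) _)) _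
            refine lintegral_mono fun q => ?_
            exact Set.indicator_le_indicator (YY_le _ _ _ _ _ _)
    · have t := (dct.ennrpow_const (1 / p))
      rw [ENNReal.zero_rpow_of_pos h0p] at t
      have t2 := ENNReal.Tendsto.const_mul (a := K) t (Or.inr hKt)
      have t3 := ENNReal.Tendsto.const_mul (a := c'⁻¹) t2 (Or.inr (ENNReal.inv_ne_top.2 hc0))
      simpa using t3
  obtain ⟨n, hn1, hn2⟩ := ev.exists
  refine HH_contra hp H (R := n) (T := (n : ℝ) ^ 2) (by linarith) (by positivity) hn2 ?_
  rw [← nonpos_iff_eq_zero]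
  exact (YD_le _ _ _ _ _).trans ((lintegral_mono fun q => YY_le _ _ _ _ _ _).trans hz)

lemma case_sub {N k : ℕ} {u0 : Euc N × Euc k → ℝ} {U : (Euc N × Euc k) × ℝ → ℝ} (hu0 : Integrable u0) (hpos : 0 < ∫ z, u0 z)
    (hUm : AEMeasurable (fun q => ENNReal.ofReal (U q)) (volume.restrict (Om N k)))
    {p : ℝ} {m : ℕ} {c a : ℝ} (hp : 1 < p) (hc : 0 < c) (H : HH u0 U p m c a)
    (hcond : 1 - 1 / p < a) : False := by
  have h1p : 1 / p < 1 := by rw [div_lt_one (by linarith)]; exact hp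
  have h0p : 0 < 1 / p := by positivity
  have hθ : 0 < 1 - 1 / p := by linarith
  have hC := Cerr_nonneg N k m
  obtain ⟨n0, hn0, hn1⟩ := ((eventually_ge_atTop 1).and (psi_pos hu0 hpos m)).exists
  obtain ⟨R, hRn⟩ : ∃ R : ℝ, R = n0 := ⟨_, rfl⟩
  have hR : 0 < R := by rw [hRn]; exact_mod_cast hn0
  rw [← hRn] at hn1
  obtain ⟨K, hK⟩ : ∃ K, K = ENNReal.ofReal (Cerr N k m * ((R ^ 2)⁻¹ + 1)) * (v0 N k * ENNReal.ofReal (R ^ (N + 2 * k))) ^ (1 - 1 / p) := ⟨_, rfl⟩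
  have hKt : K ≠ ⊤ := by
    rw [hK]; exact ENNReal.mul_ne_top ENNReal.ofReal_ne_top (ENNReal.rpow_ne_top_of_nonneg hθ.le (ENNReal.mul_ne_top (v0_lt_top N k).ne ENNReal.ofReal_ne_top))
  obtain ⟨c', hc'⟩ : ∃ c', c' = ENNReal.ofReal c := ⟨_, rfl⟩
  have hc0 : c' ≠ 0 := by rw [hc']; simpa using hc
  have hct : c' ≠ ⊤ := by rw [hc']; exact ENNReal.ofReal_ne_top
  have main : ∀ T : ℝ, 1 ≤ T →
      (∫⁻ q in Om N k, YY p m R T U q) ≤ (c'⁻¹ * (K * ENNReal.ofReal (T ^ (1 - 1 / p - a)))) ^ (1 / (1 - 1 / p)) := by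
    intro T hT
    have hT0 : 0 < T := by linarith
    obtain ⟨h1, h2⟩ := H R T hR hT0 hn1.le
    refine absorb hp hc0 hct h1 ?_
    have h3 := le_trans le_add_self h2
    have hX0 : 0 < T ^ a := by positivity
    have hXn : ENNReal.ofReal (T ^ a) ≠ 0 := by simpa using hX0
    refine (ENNReal.mul_le_mul_iff_right hXn ENNReal.ofReal_ne_top).1 ?_
    rw [ENNReal.ofReal_mul hc.le, ← hc'] at h3
    have eT : ENNReal.ofReal (T ^ a) * ENNReal.ofReal (T ^ (1 - 1 / p - a)) = ENNReal.ofReal T ^ (1 - 1 / p) := by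
      rw [← ENNReal.ofReal_mul hX0.le, ← Real.rpow_add hT0, ENNReal.ofReal_rpow_of_pos hT0]; congr 2; ring
    calc _ = c' * ENNReal.ofReal (T ^ a) * (∫⁻ q in Om N k, YY p m R T U q) := by ring
      _ ≤ _ := h3
      _ ≤ ENNReal.ofReal (Cerr N k m * ((R ^ 2)⁻¹ + 1)) * ((v0 N k * ENNReal.ofReal (R ^ (N + 2 * k) * T)) ^ (1 - 1 / p) *
            (∫⁻ q in Om N k, YY p m R T U q) ^ (1 / p)) := by
          refine mul_le_mul' (ENNReal.ofReal_le_ofReal ?_) (mul_le_mul_right (ENNReal.rpow_le_rpow (YD_le _ _ _ _ _) h0p.le) _)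
          have : T⁻¹ ≤ 1 := inv_le_one_of_one_le₀ hT
          gcongr
      _ = K * ENNReal.ofReal T ^ (1 - 1 / p) * (∫⁻ q in Om N k, YY p m R T U q) ^ (1 / p) := by
          rw [ENNReal.ofReal_mul (p := R ^ (N + 2 * k)) (by positivity), ← mul_assoc (v0 N k), ENNReal.mul_rpow_of_nonneg _ _ hθ.le, hK]; ring
      _ = _ := by rw [← eT]; ring
  have hz : ∫⁻ q in Om N k, ENNReal.ofReal (U q) ^ p * ENNReal.ofReal (kk (gR R q.1) ^ (m + 4)) ≤ 0 := by
    refine fatou_le (F := fun (n : ℕ) => YY p m R (n : ℝ) U) (fun n => aem_YY hUm _ _ _ _) (Eventually.of_forall fun q => ?_)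
      (b := fun n : ℕ => (c'⁻¹ * (K * ENNReal.ofReal ((n : ℝ) ^ (1 - 1 / p - a)))) ^ (1 / (1 - 1 / p))) ?_ ?_
    · refine tendsto_const_nhds.congr' ?_
      have t2 : Tendsto (fun n : ℕ => (n : ℝ) / 2) atTop atTop :=
        tendsto_natCast_atTop_atTop.atTop_div_const (by norm_num)
      filter_upwards [t2.eventually_gt_atTop q.2, eventually_ge_atTop 1] with n hn hn1
      have hn1' : (1 : ℝ) ≤ n := by exact_mod_cast hn1
      rw [YY, wk, kk_eq_one (s := q.2 / n), mul_one]
      rw [div_le_iff₀ (by positivity)]; linarith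
    · filter_upwards [eventually_ge_atTop 1] with n hn
      exact main n (by exact_mod_cast hn)
    · have t0 : Tendsto (fun n : ℕ => (n : ℝ) ^ (1 - 1 / p - a)) atTop (nhds 0) := by
        have := (tendsto_rpow_neg_atTop (by linarith : 0 < a - (1 - 1 / p))).comp (tendsto_natCast_atTop_atTop (R := ℝ))
        refine this.congr fun n => ?_
        simp only [Function.comp]; congr 1; ring
      have t1 := ENNReal.tendsto_ofReal t0
      rw [ENNReal.ofReal_zero] at t1
      have t2 := ENNReal.Tendsto.const_mul (a := K) t1 (Or.inr hKt)
      have t3 := ENNReal.Tendsto.const_mul (a := c'⁻¹) t2 (Or.inr (ENNReal.inv_ne_top.2 hc0))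
      have t4 := t3.ennrpow_const (1 / (1 - 1 / p))
      rwa [mul_zero, mul_zero, ENNReal.zero_rpow_of_pos (by positivity)] at t4
  refine HH_contra hp H hR (T := 1) one_pos hn1 ?_
  rw [← nonpos_iff_eq_zero]
  refine (YD_le _ _ _ _ _).trans (le_trans (lintegral_mono fun q => ?_) hz)
  rw [YY]
  refine mul_le_mul_right (ENNReal.ofReal_le_ofReal ?_) _
  have := kk_nonneg (gR R q.1)
  refine pow_le_pow_left₀ (wk_nonneg _ _ _) ?_ _
  rw [wk]; exact mul_le_of_le_one_right this (kk_le_one _)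

lemma exists_m {p : ℝ} (hp : 1 < p) : ∃ m : ℕ, (m : ℝ) + 4 ≤ ((m : ℝ) + 1) * p := by
  obtain ⟨m, hm⟩ := exists_nat_gt (3 / (p - 1))
  refine ⟨m, ?_⟩
  rw [div_lt_iff₀ (by linarith)] at hm
  nlinarith

theorem no_global_weak_solution_memory_source (N k : ℕ) (hN : 1 ≤ N) (hk : 1 ≤ k)
    (γ p1 p2 : ℝ) (hγ0 : 0 < γ) (hγ1 : γ < 1) (hp1 : 1 < p1) (hp2 : 1 < p2)
    (hpc : p1 ≤ 1 + 2 * (2 - γ) / ((N : ℝ) + 2 * k - 2 + 2 * γ) ∨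
           p2 ≤ 1 + 2 / ((N : ℝ) + 2 * k) ∨ p1 < 1 / γ)
    (u0 : Euc N × Euc k → ℝ) (hu0 : Integrable u0)
    (hu0pos : 0 < ∫ z, u0 z) :
    ¬ ∃ u : Euc N × Euc k → ℝ → ℝ,
        (∀ z : Euc N × Euc k, ∀ t : ℝ, 0 ≤ t → 0 ≤ u z t) ∧
        (∀ T : ℝ, 0 < T → IsWeakSolutionGen N k 1 1 γ p1 p2 T u0 u) := by
  rintro ⟨u, hu, hw⟩
  have S := WS_of_sol hγ1 hp1 hp2 hu hw
  obtain ⟨U, hU⟩ : ∃ U : (Euc N × Euc k) × ℝ → ℝ, U = fun q => u q.1 q.2 := ⟨_, rfl⟩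
  obtain ⟨f1, hf1⟩ : ∃ f1 : (Euc N × Euc k) × ℝ → ℝ, f1 = (fun q => ∫ s in Set.Ioc 0 q.2, (q.2 - s)^(-γ) * u q.1 s^p1) := ⟨_, rfl⟩
  obtain ⟨f2, hf2⟩ : ∃ f2 : (Euc N × Euc k) × ℝ → ℝ, f2 = (fun q => u q.1 q.2^p2) := ⟨_, rfl⟩
  rw [← hU, ← hf1, ← hf2] at S
  replace hf1 : ∀ q, f1 q = ∫ s in Set.Ioc 0 q.2, (q.2 - s) ^ (-γ) * U (q.1, s) ^ p1 := by
    intro q; rw [hf1, hU]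
  replace hf2 : ∀ q, f2 q = U q ^ p2 := by
    intro q; rw [hf2, hU]
  have hUm : AEMeasurable (fun q => ENNReal.ofReal (U q)) (volume.restrict (Om N k)) :=
    S.iU.aestronglyMeasurable.aemeasurable.ennreal_ofReal
  have hN' : (1 : ℝ) ≤ N := by exact_mod_cast hN
  have hk' : (1 : ℝ) ≤ k := by exact_mod_cast hk
  obtain ⟨m1, hm1⟩ := exists_m hp1
  obtain ⟨m2, hm2⟩ := exists_m hp2
  have hc1 : (0 : ℝ) < 1 / (12 * 6 ^ (m1 + 3)) := by positivity
  have H1 : HH u0 U p1 m1 (1 / (12 * 6 ^ (m1 + 3))) (1 - γ) := by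
    intro R T hR hT h0
    obtain ⟨a1, a2, a3⟩ := ineqI S hp2 hf2 hp1 hm1 hR hT h0
    have ml := mem_lower hN S hγ0 hγ1 hp1 hp2 hf2 hf1 hu0 m1 hR hT
    refine ⟨?_, le_trans ?_ a3⟩
    · by_contra h
      rw [not_lt, top_le_iff] at h
      have hne : ENNReal.ofReal (1 / (12 * 6 ^ (m1 + 3)) * T ^ (1 - γ)) ≠ 0 := by
        have : 0 < 1 / (12 * 6 ^ (m1 + 3)) * T ^ (1 - γ) := by positivity
        exact (ENNReal.ofReal_pos.2 this).ne'
      rw [h, ENNReal.mul_top hne] at ml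
      exact absurd (lt_of_le_of_lt ml a1) (lt_irrefl _)
    · exact le_trans (add_le_add_right ml _) le_self_add
  have H2 : HH u0 U p2 m2 1 0 := by
    intro R T hR hT h0
    obtain ⟨a1, a2, a3⟩ := ineqI S hp2 hf2 hp2 hm2 hR hT h0
    have ml := src_lower S hp2 hf2 m2 R T
    refine ⟨lt_of_le_of_lt ml a2, le_trans ?_ a3⟩
    rw [Real.rpow_zero, mul_one, ENNReal.ofReal_one, one_mul]
    exact add_le_add le_self_add ml
  rcases hpc with h | h | h
  · refine case_crit hu0 hu0pos hUm hp1 hc1 H1 ?_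
    have hd : 0 < (N : ℝ) + 2 * k - 2 + 2 * γ := by linarith
    have h2 : (p1 - 1) * ((N : ℝ) + 2 * k - 2 + 2 * γ) ≤ 2 * (2 - γ) := by
      rw [← le_div_iff₀ hd]; linarith
    have e : 1 - 1 / p1 = (p1 - 1) / p1 := by field_simp
    rw [e, ← mul_div_assoc, div_le_iff₀ (by linarith)]
    nlinarith
  · refine case_crit hu0 hu0pos hUm hp2 one_pos H2 ?_
    have hd : 0 < (N : ℝ) + 2 * k := by linarith
    have h2 : (p2 - 1) * ((N : ℝ) + 2 * k) ≤ 2 := by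
      rw [← le_div_iff₀ hd]; linarith
    have e : 1 - 1 / p2 = (p2 - 1) / p2 := by field_simp
    rw [e, ← mul_div_assoc, div_le_iff₀ (by linarith)]
    nlinarith
  · refine case_sub hu0 hu0pos hUm hp1 hc1 H1 ?_
    have : γ < 1 / p1 := by
      rw [lt_div_iff₀ hγ0] at h
      rw [lt_div_iff₀ (by linarith)]; linarith
    linarith
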